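/- arXiv:1008.3520 — 2 statements merged into one kernel-verified Lean document; each statement's English description precedes it below -/
import Mathlib

section
/- Assume c ≤ 0, f ∈ C^{0,α}(Ω̄), g ∈ C⁰(Ω̄), and let u(x) := sup_{v ∈ S_g} v(x) be the Perron solution. If a boundary point x₀ ∈ ∂Ω admits a barrier to (L, f, g), then u(x) → g(x₀) as x → x₀; i.e. u attains the boundary value continuously at x₀. -/
open scoped NNReal Topology
open Set Metric

noncomputable section

/-- Partial derivative within a set `s`, in coordinate direction `i`. -/
def pdW {n : ℕ} (s : Set (EuclideanSpace ℝ (Fin n))) (i : Fin n)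
    (u : EuclideanSpace ℝ (Fin n) → ℝ) (x : EuclideanSpace ℝ (Fin n)) : ℝ :=
  fderivWithin ℝ u s x (EuclideanSpace.single i 1)

/-- The second-order elliptic operator `Lu = Σ aᵢⱼ ∂ᵢ∂ⱼ u + Σ bᵢ ∂ᵢ u + c·u`,
with derivatives taken within `s`. -/
def LopW {n : ℕ} (s : Set (EuclideanSpace ℝ (Fin n)))
    (a : Fin n → Fin n → EuclideanSpace ℝ (Fin n) → ℝ)
    (b : Fin n → EuclideanSpace ℝ (Fin n) → ℝ)
    (c : EuclideanSpace ℝ (Fin n) → ℝ)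
    (u : EuclideanSpace ℝ (Fin n) → ℝ) (x : EuclideanSpace ℝ (Fin n)) : ℝ :=
  (∑ i, ∑ j, a i j x * pdW s i (pdW s j u) x) + (∑ i, b i x * pdW s i u x) + c x * u x

/-- `f ∈ C^{0,α}(s)`: `f` is `α`-Hölder continuous on `s`. -/
def MemC0α {n : ℕ} (α : ℝ≥0) (f : EuclideanSpace ℝ (Fin n) → ℝ)
    (s : Set (EuclideanSpace ℝ (Fin n))) : Prop :=
  ∃ C : ℝ≥0, HolderOnWith C α f s

/-- `u ∈ C^{2,α}(s)`: `u` is twice continuously differentiable on `s` and its second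
derivative is `α`-Hölder continuous on `s`. -/
def MemC2α {n : ℕ} (α : ℝ≥0) (u : EuclideanSpace ℝ (Fin n) → ℝ)
    (s : Set (EuclideanSpace ℝ (Fin n))) : Prop :=
  ContDiffOn ℝ 2 u s ∧ ∃ C : ℝ≥0, HolderOnWith C α (iteratedFDerivWithin ℝ 2 u s) s

/-- Uniform ellipticity of the coefficient matrix `(aᵢⱼ)` on `s` with constant `lam`. -/
def UnifElliptic {n : ℕ} (a : Fin n → Fin n → EuclideanSpace ℝ (Fin n) → ℝ) (lam : ℝ)
    (s : Set (EuclideanSpace ℝ (Fin n))) : Prop :=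
  ∀ x ∈ s, ∀ ξ : EuclideanSpace ℝ (Fin n), lam * ‖ξ‖ ^ 2 ≤ ∑ i, ∑ j, a i j x * ξ i * ξ j

/-- All coefficients are bounded by `Λ` on `s`. -/
def CoeffBound {n : ℕ} (a : Fin n → Fin n → EuclideanSpace ℝ (Fin n) → ℝ)
    (b : Fin n → EuclideanSpace ℝ (Fin n) → ℝ)
    (c : EuclideanSpace ℝ (Fin n) → ℝ) (Lam : ℝ)
    (s : Set (EuclideanSpace ℝ (Fin n))) : Prop :=
  ∀ x ∈ s, (∀ i j, |a i j x| ≤ Lam) ∧ (∀ i, |b i x| ≤ Lam) ∧ |c x| ≤ Lam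

/-- Supremum norm of `u` over the set `s`. -/
def supNormOn {n : ℕ} (u : EuclideanSpace ℝ (Fin n) → ℝ)
    (s : Set (EuclideanSpace ℝ (Fin n))) : ℝ :=
  sSup ((fun x => |u x|) '' s)

/-- `u` is subharmonic w.r.t. `(L, f)` on `Ω`: `u ∈ C⁰(Ω̄)` and for every ball
`B ⊂⊂ Ω` and every `v ∈ C²(B) ∩ C⁰(B̄)` with `Lv = f` in `B` and `u ≤ v` on `∂B`,
one has `u ≤ v` in `B`. -/
def Subharmonic {n : ℕ} (Ω : Set (EuclideanSpace ℝ (Fin n)))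
    (a : Fin n → Fin n → EuclideanSpace ℝ (Fin n) → ℝ)
    (b : Fin n → EuclideanSpace ℝ (Fin n) → ℝ)
    (c : EuclideanSpace ℝ (Fin n) → ℝ)
    (f : EuclideanSpace ℝ (Fin n) → ℝ)
    (u : EuclideanSpace ℝ (Fin n) → ℝ) : Prop :=
  ContinuousOn u (closure Ω) ∧
  ∀ (y : EuclideanSpace ℝ (Fin n)) (r : ℝ), 0 < r → closedBall y r ⊆ Ω →
    ∀ v : EuclideanSpace ℝ (Fin n) → ℝ,
      ContDiffOn ℝ 2 v (ball y r) → ContinuousOn v (closedBall y r) →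
      (∀ x ∈ ball y r, LopW (ball y r) a b c v x = f x) →
      (∀ x ∈ sphere y r, u x ≤ v x) →
      ∀ x ∈ closedBall y r, u x ≤ v x

/-- `u` is a subfunction to `(L, f, g)`: subharmonic with `u ≤ g` on `∂Ω`. -/
def Subfunction {n : ℕ} (Ω : Set (EuclideanSpace ℝ (Fin n)))
    (a : Fin n → Fin n → EuclideanSpace ℝ (Fin n) → ℝ)
    (b : Fin n → EuclideanSpace ℝ (Fin n) → ℝ)
    (c : EuclideanSpace ℝ (Fin n) → ℝ)
    (f g : EuclideanSpace ℝ (Fin n) → ℝ)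
    (u : EuclideanSpace ℝ (Fin n) → ℝ) : Prop :=
  Subharmonic Ω a b c f u ∧ ∀ x ∈ frontier Ω, u x ≤ g x

/-- The Perron function `x ↦ sup_{v ∈ S_g} v(x)`. -/
def perron {n : ℕ} (Ω : Set (EuclideanSpace ℝ (Fin n)))
    (a : Fin n → Fin n → EuclideanSpace ℝ (Fin n) → ℝ)
    (b : Fin n → EuclideanSpace ℝ (Fin n) → ℝ)
    (c : EuclideanSpace ℝ (Fin n) → ℝ)
    (f g : EuclideanSpace ℝ (Fin n) → ℝ)
    (x : EuclideanSpace ℝ (Fin n)) : ℝ :=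
  sSup {t : ℝ | ∃ v : EuclideanSpace ℝ (Fin n) → ℝ, Subfunction Ω a b c f g v ∧ t = v x}


section Smearing

open MeasureTheory

variable {n : ℕ} {F : Type*} [NormedAddCommGroup F] [NormedSpace ℝ F]

/-- Convolution `x ↦ ∫ f(t) g(x - t) dt` of a scalar function with a vector-valued kernel. -/
def smear (f : EuclideanSpace ℝ (Fin n) → ℝ) (g : EuclideanSpace ℝ (Fin n) → F)
    (x : EuclideanSpace ℝ (Fin n)) : F :=
  ∫ t, f t • g (x - t)

lemma hasCompactSupport_comp_sub_left {F : Type*} [NormedAddCommGroup F]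
    {g : EuclideanSpace ℝ (Fin n) → F}
    (hc : HasCompactSupport g) (x : EuclideanSpace ℝ (Fin n)) :
    HasCompactSupport fun t => g (x - t) :=
  hc.comp_homeomorph (Homeomorph.subLeft x)

lemma integrable_smear {f : EuclideanSpace ℝ (Fin n) → ℝ} {g : EuclideanSpace ℝ (Fin n) → F}
    (hf : Continuous f) (hg : Continuous g) (hc : HasCompactSupport g)
    (x : EuclideanSpace ℝ (Fin n)) : Integrable fun t => f t • g (x - t) := by
  refine Continuous.integrable_of_hasCompactSupport (by fun_prop) ?_
  exact (hasCompactSupport_comp_sub_left hc x).smul_left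

lemma hasFDerivAt_smear {f : EuclideanSpace ℝ (Fin n) → ℝ} {g : EuclideanSpace ℝ (Fin n) → F}
    (hf : Continuous f) (hg : ContDiff ℝ 1 g) (hc : HasCompactSupport g)
    (x : EuclideanSpace ℝ (Fin n)) :
    HasFDerivAt (smear f g) (smear f (fderiv ℝ g) x) x :=
  hc.hasFDerivAt_convolution_right (ContinuousLinearMap.lsmul ℝ ℝ)
    (hf.locallyIntegrable (μ := volume)) hg x

lemma smear_one (g : EuclideanSpace ℝ (Fin n) → F) (x : EuclideanSpace ℝ (Fin n)) :
    smear (fun _ => 1) g x = ∫ t, g t := by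
  simp only [smear, one_smul]
  exact integral_sub_left_eq_self g volume x

lemma integral_fderiv_eq_zero_of_hasCompactSupport {g : EuclideanSpace ℝ (Fin n) → F}
    (hg : ContDiff ℝ 1 g) (hc : HasCompactSupport g) : ∫ t, fderiv ℝ g t = 0 := by
  have h := hasFDerivAt_smear (f := fun _ => (1 : ℝ)) continuous_const hg hc 0
  rw [smear_one] at h
  have h2 : smear (fun _ => (1 : ℝ)) g = fun _ => ∫ t, g t := funext (smear_one g)
  rw [h2] at h
  exact h.unique (hasFDerivAt_const _ _)

lemma norm_smear_le {f : EuclideanSpace ℝ (Fin n) → ℝ} {g : EuclideanSpace ℝ (Fin n) → F}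
    {m : ℝ} (hm : ∀ x, |f x| ≤ m) (hg : Continuous g) (hc : HasCompactSupport g)
    (x : EuclideanSpace ℝ (Fin n)) : ‖smear f g x‖ ≤ m * ∫ t, ‖g t‖ := by
  rw [← integral_sub_left_eq_self (fun t => ‖g t‖) volume x, ← integral_const_mul]
  refine norm_integral_le_of_norm_le ?_ (.of_forall fun t => ?_)
  · refine Continuous.integrable_of_hasCompactSupport (by fun_prop) ?_
    exact (hasCompactSupport_comp_sub_left hc x).norm.mul_left
  · rw [norm_smul]
    exact mul_le_mul_of_nonneg_right (hm t) (norm_nonneg _)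

lemma norm_smear_sub_le [CompleteSpace F] {f : EuclideanSpace ℝ (Fin n) → ℝ}
    {g : EuclideanSpace ℝ (Fin n) → F}
    {M α R : ℝ} (hf : Continuous f) (hα : 0 < α) (hα1 : α ≤ 1)
    (hM0 : 0 ≤ M) (hM : ∀ x y, |f x - f y| ≤ M * ‖x - y‖ ^ α) (hR : 1 ≤ R)
    (hg : Continuous g) (hc : HasCompactSupport g) (hgR : ∀ t, g t ≠ 0 → ‖t‖ ≤ R)
    (x : EuclideanSpace ℝ (Fin n)) :
    ‖smear f g x - f x • ∫ t, g t‖ ≤ M * R * ∫ t, ‖g t‖ := by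
  have h1 : smear f g x - f x • ∫ t, g t = ∫ t, (f t - f x) • g (x - t) := by
    rw [smear, ← integral_sub_left_eq_self g volume x, ← integral_smul, ← integral_sub]
    · simp_rw [sub_smul]
    · exact integrable_smear hf hg hc x
    · exact integrable_smear continuous_const hg hc x
  rw [h1, ← integral_sub_left_eq_self (fun t => ‖g t‖) volume x, ← integral_const_mul]
  refine norm_integral_le_of_norm_le ?_ (.of_forall fun t => ?_)
  · refine Continuous.integrable_of_hasCompactSupport (by fun_prop) ?_
    exact (hasCompactSupport_comp_sub_left hc x).norm.mul_left
  · rw [norm_smul]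
    by_cases h0 : g (x - t) = 0
    · simp [h0]
    refine mul_le_mul_of_nonneg_right ?_ (norm_nonneg _)
    refine (hM t x).trans (mul_le_mul_of_nonneg_left ?_ hM0)
    rw [norm_sub_rev]
    calc ‖x - t‖ ^ α ≤ R ^ α := Real.rpow_le_rpow (norm_nonneg _) (hgR _ h0) hα.le
      _ ≤ R ^ (1 : ℝ) := Real.rpow_le_rpow_of_exponent_le hR hα1
      _ = R := Real.rpow_one R

lemma smear_comp_smul (f g : EuclideanSpace ℝ (Fin n) → ℝ) (x : EuclideanSpace ℝ (Fin n)) :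
    smear f (fun z => 2 ^ n * g ((2 : ℝ) • z)) x =
      smear (fun t => f ((2 : ℝ)⁻¹ • t)) g ((2 : ℝ) • x) := by
  have h := Measure.integral_comp_smul (volume : Measure (EuclideanSpace ℝ (Fin n)))
    (fun t => f ((2 : ℝ)⁻¹ • t) • g ((2 : ℝ) • x - t)) 2
  simp only [inv_smul_smul₀ (two_ne_zero' ℝ), finrank_euclideanSpace, Fintype.card_fin] at h
  have h2 : (0 : ℝ) < 2 ^ n := by positivity
  have h3 : smear f (fun z => 2 ^ n * g ((2 : ℝ) • z)) x =
      2 ^ n * ∫ t, f t • g ((2 : ℝ) • x - (2 : ℝ) • t) := by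
    rw [smear, ← integral_const_mul]
    congr 1
    ext t
    simp only [smul_sub, smul_eq_mul]
    ring
  rw [h3, h, abs_of_pos (by positivity), smul_eq_mul, ← mul_assoc, mul_inv_cancel₀ h2.ne',
    one_mul]
  rfl

end Smearing

section Kernel

open scoped ContDiff

lemma monotone_smoothTransition_two_mul_sub_one :
    Monotone fun s : ℝ => Real.smoothTransition (2 * s - 1) :=
  fun _ _ h => Real.smoothTransition.monotone (by linarith)

lemma contDiff_smoothTransition_mul_rpow (n : ℕ) :
    ContDiff ℝ ∞ fun s : ℝ => Real.smoothTransition (2 * s - 1) * s ^ (-(n : ℝ) / 2) := by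
  rw [contDiff_iff_contDiffAt]
  intro s
  rcases lt_or_ge s (1 / 2) with hs | hs
  · have : (fun s : ℝ => Real.smoothTransition (2 * s - 1) * s ^ (-(n : ℝ) / 2)) =ᶠ[𝓝 s]
        fun _ => 0 := by
      filter_upwards [Iio_mem_nhds hs] with t ht
      rw [Real.smoothTransition.zero_of_nonpos (by simp at ht; linarith), zero_mul]
    exact contDiffAt_const.congr_of_eventuallyEq this
  · have hs0 : s ≠ 0 := by linarith
    refine ContDiffAt.mul ?_ (Real.contDiffAt_rpow_const_of_ne hs0)
    exact (Real.smoothTransition.contDiff.comp (by fun_prop :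
      ContDiff ℝ ∞ fun s : ℝ => 2 * s - 1)).contDiffAt

lemma exists_radial_profile (n : ℕ) : ∃ h G : ℝ → ℝ, ContDiff ℝ ∞ h ∧ ContDiff ℝ ∞ G ∧
    (∀ s, 1 ≤ s → h s = 0) ∧ (∀ s, 1 < s → G s = 0) ∧ (∀ s, 0 ≤ G s) ∧ (∃ s, 0 < s ∧ 0 < G s) ∧
    ∀ s, 4 * s * deriv (deriv h) s + 2 * n * deriv h s = 2 ^ n * G (4 * s) - G s := by
  set q : ℝ → ℝ := fun s => Real.smoothTransition (2 * s - 1) * s ^ (-(n : ℝ) / 2) with hq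
  have hqs : ContDiff ℝ ∞ q := contDiff_smoothTransition_mul_rpow n
  have hq' : ContDiff ℝ ∞ (deriv q) := (contDiff_infty_iff_deriv.1 hqs).2
  have hqd : ∀ s, HasDerivAt q (deriv q s) s := fun s =>
    ((contDiff_infty_iff_deriv.1 hqs).1 s).hasDerivAt
  set χ : ℝ → ℝ := fun s => Real.smoothTransition (2 * s - 1) with hχ
  have hχs : ContDiff ℝ ∞ χ := Real.smoothTransition.contDiff.comp (by fun_prop)
  have hχd : Differentiable ℝ χ := (contDiff_infty_iff_deriv.1 hχs).1
  have hχm : Monotone χ := monotone_smoothTransition_two_mul_sub_one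
  set G : ℝ → ℝ := fun s => 4 * s * deriv q s + 2 * n * q s with hG
  have hGpos : ∀ s, 0 < s → G s = 4 * (s * s ^ (-(n : ℝ) / 2)) * deriv χ s := by
    intro s hs
    have h1 : HasDerivAt q (deriv χ s * s ^ (-(n : ℝ) / 2) +
        χ s * (-(n : ℝ) / 2 * s ^ (-(n : ℝ) / 2 - 1))) s := by
      refine (hχd s).hasDerivAt.mul ?_
      simpa using Real.hasDerivAt_rpow_const (p := -(n : ℝ) / 2) (Or.inl hs.ne')
    have h2 : s * s ^ (-(n : ℝ) / 2 - 1) = s ^ (-(n : ℝ) / 2) := by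
      rw [Real.rpow_sub_one hs.ne']
      field_simp
    simp only [hG, h1.deriv]
    simp only [hq]
    have : χ s = Real.smoothTransition (2 * s - 1) := rfl
    rw [← this]
    linear_combination (- 2 * n * χ s) * h2
  have hGneg : ∀ s, s < 1 / 2 → G s = 0 := by
    intro s hs
    have h0 : q =ᶠ[𝓝 s] fun _ => 0 := by
      filter_upwards [Iio_mem_nhds hs] with t ht
      simp only [hq]
      rw [Real.smoothTransition.zero_of_nonpos (by simp at ht; linarith), zero_mul]
    simp [hG, h0.deriv_eq, h0.eq_of_nhds]
  set φ : ℝ → ℝ := fun s => 2 ^ n * q (4 * s) - q s with hφ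
  have hφs : ContDiff ℝ ∞ φ :=
    (contDiff_const.mul (hqs.comp (contDiff_const.mul contDiff_id))).sub hqs
  have hφ0 : ∀ s, 1 ≤ s → φ s = 0 := by
    intro s hs
    simp only [hφ, hq]
    rw [Real.smoothTransition.one_of_one_le (by linarith),
      Real.smoothTransition.one_of_one_le (by linarith),
      Real.mul_rpow (by norm_num) (by linarith)]
    have : (4 : ℝ) ^ (-(n : ℝ) / 2) = (2 ^ n)⁻¹ := by
      rw [show (4 : ℝ) = 2 ^ (2 : ℝ) by norm_num, ← Real.rpow_mul (by norm_num),
        show (2 : ℝ) * (-(n : ℝ) / 2) = -n by ring, Real.rpow_neg (by norm_num),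
        Real.rpow_natCast]
    rw [this]
    field_simp
    ring
  set h : ℝ → ℝ := fun s => ∫ t in (1 : ℝ)..s, φ t with hh
  have hhd : ∀ s, HasDerivAt h (φ s) s := fun s =>
    intervalIntegral.integral_hasDerivAt_right (hφs.continuous.intervalIntegrable _ _)
      (hφs.continuous.stronglyMeasurableAtFilter _ _) hφs.continuous.continuousAt
  have hhd' : deriv h = φ := funext fun s => (hhd s).deriv
  refine ⟨h, G, ?_, ?_, ?_, ?_, ?_, ?_, ?_⟩
  · exact contDiff_infty_iff_deriv.2 ⟨fun s => (hhd s).differentiableAt, hhd' ▸ hφs⟩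
  · exact ((contDiff_const.mul contDiff_id).mul hq').add (contDiff_const.mul hqs)
  · intro s hs
    have : ∫ t in (1 : ℝ)..s, φ t = ∫ t in (1 : ℝ)..s, (0 : ℝ) := by
      refine intervalIntegral.integral_congr fun t ht => hφ0 t ?_
      rw [uIcc_of_le hs] at ht
      exact ht.1
    simp [hh, this]
  · intro s hs
    rw [hGpos s (by linarith)]
    have h0 : χ =ᶠ[𝓝 s] fun _ => 1 := by
      filter_upwards [Ioi_mem_nhds hs] with t ht
      exact Real.smoothTransition.one_of_one_le (by simp at ht; linarith)
    simp [h0.deriv_eq]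
  · intro s
    rcases lt_or_ge s (1 / 2) with hs | hs
    · exact (hGneg s hs).ge
    · have hs0 : 0 < s := by linarith
      rw [hGpos s hs0]
      have := hχm.deriv_nonneg (x := s)
      positivity
  · obtain ⟨s, hs, hs'⟩ := exists_deriv_eq_slope χ (show (1 / 2 : ℝ) < 1 by norm_num)
      hχs.continuous.continuousOn hχd.differentiableOn
    have hs0 : 0 < s := by linarith [hs.1]
    refine ⟨s, hs0, ?_⟩
    have h1 : χ 1 = 1 := Real.smoothTransition.one_of_one_le (by norm_num)
    have h2 : χ (1 / 2) = 0 := Real.smoothTransition.zero_of_nonpos (by norm_num)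
    rw [hGpos s hs0, hs', h1, h2]
    positivity
  · intro s
    have h1 : HasDerivAt φ (2 ^ n * (deriv q (4 * s) * 4) - deriv q s) s := by
      refine HasDerivAt.sub (HasDerivAt.const_mul _ ?_) (hqd s)
      have h4 : HasDerivAt (fun s : ℝ => 4 * s) 4 s := by
        simpa using (hasDerivAt_id s).const_mul 4
      exact (hqd (4 * s)).comp s h4
    rw [hhd', h1.deriv]
    simp only [hφ, hG]
    ring

end Kernel

section DualForm

variable {n : ℕ}

/-- The contraction `∑ Aᵢⱼ Hᵢⱼ` of a coefficient array with a bilinear form. -/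
def hessTrace (A : Fin n → Fin n → ℝ) :
    (EuclideanSpace ℝ (Fin n) →L[ℝ] EuclideanSpace ℝ (Fin n) →L[ℝ] ℝ) →L[ℝ] ℝ :=
  LinearMap.toContinuousLinearMap
    { toFun := fun H : EuclideanSpace ℝ (Fin n) →L[ℝ] EuclideanSpace ℝ (Fin n) →L[ℝ] ℝ =>
        ∑ i, ∑ j, A i j * H (EuclideanSpace.single i 1) (EuclideanSpace.single j 1)
      map_add' := fun H K => by
        simp only [add_apply, mul_add, Finset.sum_add_distrib]
      map_smul' := fun c H => by
        simp only [smul_apply, smul_eq_mul, RingHom.id_apply, Finset.mul_sum]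
        exact Finset.sum_congr rfl fun i _ => Finset.sum_congr rfl fun j _ => by ring }

lemma hessTrace_apply (A : Fin n → Fin n → ℝ)
    (H : EuclideanSpace ℝ (Fin n) →L[ℝ] EuclideanSpace ℝ (Fin n) →L[ℝ] ℝ) :
    hessTrace A H =
      ∑ i, ∑ j, A i j * H (EuclideanSpace.single i 1) (EuclideanSpace.single j 1) := rfl

lemma abs_apply_single_le
    (H : EuclideanSpace ℝ (Fin n) →L[ℝ] EuclideanSpace ℝ (Fin n) →L[ℝ] ℝ) (i j : Fin n) :
    |H (EuclideanSpace.single i 1) (EuclideanSpace.single j 1)| ≤ ‖H‖ := by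
  have := H.le_opNorm₂ (EuclideanSpace.single i (1 : ℝ)) (EuclideanSpace.single j (1 : ℝ))
  simpa using this

/-- The bilinear form dual to an elliptic coefficient array. -/
lemma exists_dual_form (A : Fin n → Fin n → ℝ) {lam : ℝ} (hlam : 0 < lam)
    (hA : ∀ ξ : EuclideanSpace ℝ (Fin n), lam * ‖ξ‖ ^ 2 ≤ ∑ i, ∑ j, A i j * ξ i * ξ j) :
    ∃ (b : EuclideanSpace ℝ (Fin n) →L[ℝ] EuclideanSpace ℝ (Fin n) →L[ℝ] ℝ) (κ : ℝ), 0 < κ ∧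
      (∀ x y, b x y = b y x) ∧ (∀ x, κ * ‖x‖ ^ 2 ≤ b x x) ∧ hessTrace A b = n ∧
      ∀ x, ∑ i, ∑ j, A i j *
        (b x (EuclideanSpace.single i 1) * b x (EuclideanSpace.single j 1)) = b x x := by
  set B : EuclideanSpace ℝ (Fin n) →L[ℝ] EuclideanSpace ℝ (Fin n) →L[ℝ] ℝ :=
    ∑ i, ∑ j, ((A i j + A j i) / 2) •
      (EuclideanSpace.proj i : EuclideanSpace ℝ (Fin n) →L[ℝ] ℝ).smulRight
        (EuclideanSpace.proj j : EuclideanSpace ℝ (Fin n) →L[ℝ] ℝ) with hB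
  have hBa : ∀ x y, B x y = ∑ i, ∑ j, (A i j + A j i) / 2 * (x i * y j) := by
    intro x y
    simp [hB]
  have hBs : ∀ x y, B x y = B y x := by
    intro x y
    rw [hBa, hBa, Finset.sum_comm]
    exact Finset.sum_congr rfl fun i _ => Finset.sum_congr rfl fun j _ => by ring
  have hsym : ∀ P : Fin n → Fin n → ℝ, (∀ i j, P i j = P j i) →
      ∑ i, ∑ j, (A i j + A j i) / 2 * P i j = ∑ i, ∑ j, A i j * P i j := by
    intro P hP
    have h1 : ∑ i, ∑ j, A j i * P i j = ∑ i, ∑ j, A i j * P i j := by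
      rw [Finset.sum_comm]
      exact Finset.sum_congr rfl fun i _ => Finset.sum_congr rfl fun j _ => by rw [hP]
    have h2 : ∑ i, ∑ j, (A i j + A j i) / 2 * P i j =
        (∑ i, ∑ j, A i j * P i j + ∑ i, ∑ j, A j i * P i j) / 2 := by
      rw [← Finset.sum_add_distrib, Finset.sum_div]
      refine Finset.sum_congr rfl fun i _ => ?_
      rw [← Finset.sum_add_distrib, Finset.sum_div]
      exact Finset.sum_congr rfl fun j _ => by ring
    rw [h2, h1]
    ring
  have hBB : ∀ x, B x x = ∑ i, ∑ j, A i j * (x i * x j) := fun x => by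
    rw [hBa]
    exact hsym (fun i j => x i * x j) fun i j => mul_comm _ _
  have hBl : ∀ x, lam * ‖x‖ ^ 2 ≤ B x x := fun x => by
    rw [hBB]
    refine (hA x).trans_eq ?_
    exact Finset.sum_congr rfl fun i _ => Finset.sum_congr rfl fun j _ => by ring
  have hco : IsCoercive B := ⟨lam, hlam, fun x => by rw [mul_assoc, ← sq]; exact hBl x⟩
  set T := hco.continuousLinearEquivOfBilin with hT
  have hTB : ∀ v w, inner ℝ (T v) w = B v w := hco.continuousLinearEquivOfBilin_apply
  have hTB' : ∀ x w, B (T.symm x) w = inner ℝ x w := fun x w => by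
    rw [← hTB, T.apply_symm_apply]
  set b : EuclideanSpace ℝ (Fin n) →L[ℝ] EuclideanSpace ℝ (Fin n) →L[ℝ] ℝ :=
    (innerSL ℝ).comp (T.symm : EuclideanSpace ℝ (Fin n) →L[ℝ] EuclideanSpace ℝ (Fin n)) with hb
  have hba : ∀ x y, b x y = inner ℝ (T.symm x) y := fun x y => rfl
  have hbB : ∀ x y, b x y = B (T.symm x) (T.symm y) := fun x y => by
    rw [hba, hBs, hTB', real_inner_comm]
  have hbs : ∀ x i, b x (EuclideanSpace.single i 1) = (T.symm x) i := fun x i => by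
    rw [hba, EuclideanSpace.inner_single_right]
    simp
  refine ⟨b, lam / (‖(T : EuclideanSpace ℝ (Fin n) →L[ℝ] EuclideanSpace ℝ (Fin n))‖ + 1) ^ 2,
    by positivity, ?_, ?_, ?_, ?_⟩
  · intro x y
    rw [hbB, hbB, hBs]
  · intro x
    rw [hbB]
    refine le_trans ?_ (hBl _)
    have h1 : ‖x‖ ≤ (‖(T : EuclideanSpace ℝ (Fin n) →L[ℝ] EuclideanSpace ℝ (Fin n))‖ + 1) *
        ‖T.symm x‖ := by
      have h2 := (T : EuclideanSpace ℝ (Fin n) →L[ℝ] EuclideanSpace ℝ (Fin n)).le_opNorm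
        (T.symm x)
      simp only [ContinuousLinearEquiv.coe_coe, ContinuousLinearEquiv.apply_symm_apply] at h2
      nlinarith [norm_nonneg (T.symm x)]
    rw [div_mul_eq_mul_div, div_le_iff₀ (by positivity), mul_assoc]
    refine mul_le_mul_of_nonneg_left ?_ hlam.le
    rw [← mul_pow, mul_comm ‖T.symm x‖]
    exact pow_le_pow_left₀ (norm_nonneg _) h1 2
  · rw [hessTrace_apply, ← hsym]
    · have h1 : ∀ i, ∑ j, (A i j + A j i) / 2 *
          b (EuclideanSpace.single i 1) (EuclideanSpace.single j 1) = 1 := by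
        intro i
        have h2 : B (EuclideanSpace.single i 1) (T.symm (EuclideanSpace.single i 1)) = 1 := by
          rw [hBs, hTB']
          simp
        refine Eq.trans ?_ h2
        rw [hBa]
        symm
        rw [Finset.sum_eq_single i]
        · exact Finset.sum_congr rfl fun j _ => by rw [hbs]; simp
        · intro k _ hk
          exact Finset.sum_eq_zero fun j _ => by simp [hk]
        · simp
      simp [h1]
    · intro i j
      rw [hbB, hbB, hBs]
  · intro x
    simp_rw [hbs]
    rw [← hBB, hbB]

end DualForm

section EllipticKernel

open scoped ContDiff
open MeasureTheory

variable {n : ℕ}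

lemma hasCompactSupport_comp_of_coercive {g : ℝ → ℝ} (hg : ∀ s, 1 < s → g s = 0)
    {Q : EuclideanSpace ℝ (Fin n) → ℝ} {κ : ℝ} (hκ : 0 < κ) (hQ : ∀ x, κ * ‖x‖ ^ 2 ≤ Q x) :
    HasCompactSupport fun x => g (Q x) := by
  refine HasCompactSupport.intro (isCompact_closedBall 0 (1 / κ + 1)) fun x hx => hg _ ?_
  refine lt_of_lt_of_le ?_ (hQ x)
  simp only [mem_closedBall, dist_zero_right, not_le] at hx
  have h1 : 0 < 1 / κ := by positivity
  have h2 : 1 / κ < ‖x‖ ^ 2 := by nlinarith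
  rwa [div_lt_iff₀' hκ] at h2

lemma fderiv_fderiv_comp_quadratic {h : ℝ → ℝ} (hh : ContDiff ℝ ∞ h)
    (b : EuclideanSpace ℝ (Fin n) →L[ℝ] EuclideanSpace ℝ (Fin n) →L[ℝ] ℝ)
    (hb : ∀ x y, b x y = b y x) (x v w : EuclideanSpace ℝ (Fin n)) :
    fderiv ℝ (fderiv ℝ fun x => h (b x x)) x v w =
      deriv (deriv h) (b x x) * (2 * b x v) * (2 * b x w) + deriv h (b x x) * (2 * b v w) := by
  have hQ : ∀ x, HasFDerivAt (fun x => b x x) ((2 : ℝ) • b x) x := by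
    intro x
    have h1 := (b.hasFDerivAt (x := x)).clm_apply (hasFDerivAt_id x)
    refine h1.congr_fderiv ?_
    ext v
    simp [hb v x, two_mul]
  have hd := contDiff_infty_iff_deriv.1 hh
  have hd2 := contDiff_infty_iff_deriv.1 hd.2
  have h1 : (fderiv ℝ fun x => h (b x x)) = fun x => deriv h (b x x) • ((2 : ℝ) • b x) := by
    ext1 x
    exact (HasDerivAt.comp_hasFDerivAt (f := fun x => b x x) x
      (hd.1 (b x x)).hasDerivAt (hQ x)).fderiv
  rw [h1]
  have h2 : HasFDerivAt (fun x => deriv h (b x x))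
      (deriv (deriv h) (b x x) • ((2 : ℝ) • b x)) x :=
    HasDerivAt.comp_hasFDerivAt (f := fun x => b x x) x (hd2.1 (b x x)).hasDerivAt (hQ x)
  have h3 : HasFDerivAt (fun x => deriv h (b x x) • ((2 : ℝ) • b x)) _ x :=
    h2.smul ((b.hasFDerivAt (x := x)).const_smul (2 : ℝ))
  rw [h3.fderiv]
  simp
  ring

/-- A truncated fundamental solution: its image under the constant-coefficient operator is the
difference of two dilates of an approximate identity. -/
lemma exists_elliptic_kernel (hn : 0 < n) (A : Fin n → Fin n → ℝ) {lam : ℝ} (hlam : 0 < lam)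
    (hA : ∀ ξ : EuclideanSpace ℝ (Fin n), lam * ‖ξ‖ ^ 2 ≤ ∑ i, ∑ j, A i j * ξ i * ξ j) :
    ∃ ψ ρ : EuclideanSpace ℝ (Fin n) → ℝ, ContDiff ℝ ∞ ψ ∧ HasCompactSupport ψ ∧
      ContDiff ℝ ∞ ρ ∧ HasCompactSupport ρ ∧ ∫ x, ρ x = 1 ∧
      ∀ x, hessTrace A (fderiv ℝ (fderiv ℝ ψ) x) = 2 ^ n * ρ ((2 : ℝ) • x) - ρ x := by
  obtain ⟨b, κ, hκ, hbs, hbκ, htr, hdual⟩ := exists_dual_form A hlam hA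
  obtain ⟨h, G, hh, hG, hh0, hG0, hGnn, ⟨s, hs, hGs⟩, hode⟩ := exists_radial_profile n
  have hbc : ContDiff ℝ ∞ fun x => b x x := by fun_prop
  have hρs : ContDiff ℝ ∞ fun x => G (b x x) := hG.comp hbc
  have hρc : HasCompactSupport fun x => G (b x x) := hasCompactSupport_comp_of_coercive hG0 hκ hbκ
  set I : ℝ := ∫ x, G (b x x) with hI
  have hIpos : 0 < I := by
    set e : EuclideanSpace ℝ (Fin n) := EuclideanSpace.single ⟨0, hn⟩ 1
    have he : 0 < b e e := by
      refine lt_of_lt_of_le ?_ (hbκ e)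
      simp [e, hκ]
    refine Continuous.integral_pos_of_hasCompactSupport_nonneg_nonzero (x := √(s / b e e) • e)
      hρs.continuous hρc (fun x => hGnn _) ?_
    have : b (√(s / b e e) • e) (√(s / b e e) • e) = s := by
      simp only [map_smul, smul_apply, smul_eq_mul, ← mul_assoc]
      rw [Real.mul_self_sqrt (by positivity)]
      field_simp
    rw [this]
    exact hGs.ne'
  have hk : ContDiff ℝ ∞ fun s => I⁻¹ * h s := contDiff_const.mul hh
  refine ⟨fun x => I⁻¹ * h (b x x), fun x => I⁻¹ * G (b x x), hk.comp hbc, ?_,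
    contDiff_const.mul hρs, hρc.mul_left, ?_, ?_⟩
  · exact (hasCompactSupport_comp_of_coercive (fun s hs => hh0 s hs.le) hκ hbκ).mul_left
  · rw [integral_const_mul, ← hI, inv_mul_cancel₀ hIpos.ne']
  · intro x
    have hd1 : deriv (fun s => I⁻¹ * h s) = fun s => I⁻¹ * deriv h s := by
      ext s
      exact deriv_const_mul_field _
    have hd2 : deriv (fun s => I⁻¹ * deriv h s) = fun s => I⁻¹ * deriv (deriv h) s := by
      ext s
      exact deriv_const_mul_field _
    have h1 : hessTrace A (fderiv ℝ (fderiv ℝ fun x => I⁻¹ * h (b x x)) x) =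
        I⁻¹ * (4 * b x x * deriv (deriv h) (b x x) + 2 * n * deriv h (b x x)) := by
      rw [hessTrace_apply] at htr ⊢
      have h2 := hdual x
      simp_rw [fderiv_fderiv_comp_quadratic hk b hbs, hd1, hd2]
      calc _ = I⁻¹ * deriv (deriv h) (b x x) * 4 * (∑ i, ∑ j, A i j *
              (b x (EuclideanSpace.single i 1) * b x (EuclideanSpace.single j 1))) +
            I⁻¹ * deriv h (b x x) * 2 * ∑ i, ∑ j, A i j *
              b (EuclideanSpace.single i 1) (EuclideanSpace.single j 1) := by
            simp only [Finset.mul_sum, ← Finset.sum_add_distrib]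
            exact Finset.sum_congr rfl fun i _ => Finset.sum_congr rfl fun j _ => by ring
        _ = _ := by
            rw [h2, htr]
            ring
    rw [h1, hode]
    have h4 : b ((2 : ℝ) • x) ((2 : ℝ) • x) = 4 * b x x := by
      simp only [map_smul, smul_apply, smul_eq_mul]
      ring
    simp only [h4]
    ring

end EllipticKernel

section ApproximateInverse

open scoped ContDiff
open MeasureTheory

set_option maxSynthPendingDepth 3

variable {n : ℕ}

/-- `u` is twice differentiable on `s` with first and second derivatives `p` and `H`, all three
being bounded by `K` on `s`. -/
structure BoundedC2On (s : Set (EuclideanSpace ℝ (Fin n))) (u : EuclideanSpace ℝ (Fin n) → ℝ)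
    (p : EuclideanSpace ℝ (Fin n) → EuclideanSpace ℝ (Fin n) →L[ℝ] ℝ)
    (H : EuclideanSpace ℝ (Fin n) →
      EuclideanSpace ℝ (Fin n) →L[ℝ] EuclideanSpace ℝ (Fin n) →L[ℝ] ℝ) (K : ℝ) : Prop where
  hasFDerivAt : ∀ x ∈ s, HasFDerivAt u (p x) x
  hasFDerivAt_fderiv : ∀ x ∈ s, HasFDerivAt p (H x) x
  abs_le : ∀ x ∈ s, |u x| ≤ K
  norm_fderiv_le : ∀ x ∈ s, ‖p x‖ ≤ K
  norm_hessian_le : ∀ x ∈ s, ‖H x‖ ≤ K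

lemma BoundedC2On.tsum {s : Set (EuclideanSpace ℝ (Fin n))} (hs : IsOpen s)
    (hs' : IsPreconnected s) {u : ℕ → EuclideanSpace ℝ (Fin n) → ℝ}
    {p : ℕ → EuclideanSpace ℝ (Fin n) → EuclideanSpace ℝ (Fin n) →L[ℝ] ℝ}
    {H : ℕ → EuclideanSpace ℝ (Fin n) →
      EuclideanSpace ℝ (Fin n) →L[ℝ] EuclideanSpace ℝ (Fin n) →L[ℝ] ℝ} {K : ℕ → ℝ}
    (hK : Summable K) (h : ∀ k, BoundedC2On s (u k) (p k) (H k) (K k)) :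
    BoundedC2On s (fun x => ∑' k, u k x) (fun x => ∑' k, p k x) (fun x => ∑' k, H k x)
      (∑' k, K k) where
  hasFDerivAt x hx := hasFDerivAt_tsum_of_isPreconnected hK hs hs'
    (fun k => (h k).hasFDerivAt) (fun k => (h k).norm_fderiv_le) hx
    (.of_norm_bounded hK fun k => (h k).abs_le x hx) hx
  hasFDerivAt_fderiv x hx := hasFDerivAt_tsum_of_isPreconnected hK hs hs'
    (fun k => (h k).hasFDerivAt_fderiv) (fun k => (h k).norm_hessian_le) hx
    (.of_norm_bounded hK fun k => (h k).norm_fderiv_le x hx) hx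
  abs_le x hx := by
    rw [← Real.norm_eq_abs]
    exact tsum_of_norm_bounded hK.hasSum fun k => (h k).abs_le x hx
  norm_fderiv_le x hx := tsum_of_norm_bounded hK.hasSum fun k => (h k).norm_fderiv_le x hx
  norm_hessian_le x hx := tsum_of_norm_bounded hK.hasSum fun k => (h k).norm_hessian_le x hx

lemma continuous_of_abs_sub_le_rpow {f : EuclideanSpace ℝ (Fin n) → ℝ} {M α : ℝ} (hα : 0 < α)
    (hM : ∀ x y, |f x - f y| ≤ M * ‖x - y‖ ^ α) : Continuous f := by
  rw [continuous_iff_continuousAt]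
  intro x
  rw [ContinuousAt, tendsto_iff_norm_sub_tendsto_zero]
  have h1 : Continuous fun y : EuclideanSpace ℝ (Fin n) => M * ‖y - x‖ ^ α :=
    continuous_const.mul ((continuous_id.sub continuous_const).norm.rpow_const
      fun _ => Or.inr hα.le)
  have h2 := h1.tendsto x
  simp only [sub_self, norm_zero, Real.zero_rpow hα.ne', mul_zero] at h2
  exact squeeze_zero (fun _ => norm_nonneg _) (fun y => hM y x) h2

lemma exists_smear_bounds {ψ : EuclideanSpace ℝ (Fin n) → ℝ} (hψ : ContDiff ℝ ∞ ψ)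
    (hc : HasCompactSupport ψ) : ∃ C : ℝ, 0 ≤ C ∧ ∀ (f : EuclideanSpace ℝ (Fin n) → ℝ) (m M α : ℝ),
      0 < α → α ≤ 1 → 0 ≤ m → 0 ≤ M → (∀ x, |f x| ≤ m) →
      (∀ x y, |f x - f y| ≤ M * ‖x - y‖ ^ α) →
      (∀ x, HasFDerivAt (smear f ψ) (smear f (fderiv ℝ ψ) x) x) ∧
      (∀ x, HasFDerivAt (smear f (fderiv ℝ ψ)) (smear f (fderiv ℝ (fderiv ℝ ψ)) x) x) ∧
      (∀ x, |smear f ψ x| ≤ C * m) ∧ (∀ x, ‖smear f (fderiv ℝ ψ) x‖ ≤ C * m) ∧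
      (∀ x, ‖smear f (fderiv ℝ (fderiv ℝ ψ)) x‖ ≤ C * M) ∧
      ∀ x y, ‖smear f (fderiv ℝ (fderiv ℝ ψ)) x - smear f (fderiv ℝ (fderiv ℝ ψ)) y‖ ≤
        C * M * ‖x - y‖ := by
  have hψ1 := (contDiff_infty_iff_fderiv.1 hψ).2
  have hψ2 := (contDiff_infty_iff_fderiv.1 hψ1).2
  have hψ3 := (contDiff_infty_iff_fderiv.1 hψ2).2
  have hc1 := hc.fderiv (𝕜 := ℝ)
  have hc2 := hc1.fderiv (𝕜 := ℝ)
  have hc3 := hc2.fderiv (𝕜 := ℝ)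
  obtain ⟨R₀, hR₀⟩ := hc2.isCompact.isBounded.subset_closedBall 0
  set R := max R₀ 1
  have hR1 : 1 ≤ R := le_max_right _ _
  have hsupp : tsupport (fderiv ℝ (fderiv ℝ ψ)) ⊆ closedBall 0 R :=
    hR₀.trans (closedBall_subset_closedBall (le_max_left _ _))
  have hsupp2 : ∀ t, fderiv ℝ (fderiv ℝ ψ) t ≠ 0 → ‖t‖ ≤ R := fun t ht => by
    simpa using hsupp (subset_tsupport _ ht)
  have hsupp3 : ∀ t, fderiv ℝ (fderiv ℝ (fderiv ℝ ψ)) t ≠ 0 → ‖t‖ ≤ R := fun t ht => by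
    simpa using hsupp (support_fderiv_subset ℝ ht)
  set I0 := ∫ t, ‖ψ t‖
  set I1 := ∫ t, ‖fderiv ℝ ψ t‖
  set I2 := ∫ t, ‖fderiv ℝ (fderiv ℝ ψ) t‖
  set I3 := ∫ t, ‖fderiv ℝ (fderiv ℝ (fderiv ℝ ψ)) t‖
  have hI0 : 0 ≤ I0 := integral_nonneg fun _ => norm_nonneg _
  have hI1 : 0 ≤ I1 := integral_nonneg fun _ => norm_nonneg _
  have hI2 : 0 ≤ I2 := integral_nonneg fun _ => norm_nonneg _
  have hI3 : 0 ≤ I3 := integral_nonneg fun _ => norm_nonneg _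
  have hRI2 : 0 ≤ R * I2 := by positivity
  have hRI3 : 0 ≤ R * I3 := by positivity
  refine ⟨I0 + I1 + R * I2 + R * I3, by positivity, ?_⟩
  intro f m M α hα hα1 hm0 hM0 hm hM
  have hf : Continuous f := continuous_of_abs_sub_le_rpow hα hM
  have hz2 : ∀ x, ‖smear f (fderiv ℝ (fderiv ℝ ψ)) x‖ ≤ M * R * I2 := fun x => by
    have := norm_smear_sub_le hf hα hα1 hM0 hM hR1 hψ2.continuous hc2 hsupp2 x
    rwa [integral_fderiv_eq_zero_of_hasCompactSupport (hψ1.of_le (by norm_cast)) hc1, smul_zero,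
      sub_zero] at this
  have hz3 : ∀ x, ‖smear f (fderiv ℝ (fderiv ℝ (fderiv ℝ ψ))) x‖ ≤ M * R * I3 := fun x => by
    have := norm_smear_sub_le hf hα hα1 hM0 hM hR1 hψ3.continuous hc3 hsupp3 x
    rwa [integral_fderiv_eq_zero_of_hasCompactSupport (hψ2.of_le (by norm_cast)) hc2, smul_zero,
      sub_zero] at this
  refine ⟨hasFDerivAt_smear hf (hψ.of_le (by norm_cast)) hc,
    hasFDerivAt_smear hf (hψ1.of_le (by norm_cast)) hc1, fun x => ?_, fun x => ?_, fun x => ?_,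
    fun x y => ?_⟩
  · refine (norm_smear_le hm hψ.continuous hc x).trans ?_
    nlinarith
  · refine (norm_smear_le hm hψ1.continuous hc1 x).trans ?_
    nlinarith
  · refine (hz2 x).trans ?_
    nlinarith
  · have h1 : ‖smear f (fderiv ℝ (fderiv ℝ ψ)) x - smear f (fderiv ℝ (fderiv ℝ ψ)) y‖ ≤
        M * R * I3 * ‖x - y‖ :=
      convex_univ.norm_image_sub_le_of_norm_hasFDerivWithin_le
        (fun z _ => (hasFDerivAt_smear hf (hψ2.of_le (by norm_cast)) hc2 z).hasFDerivWithinAt)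
        (fun z _ => hz3 z) (mem_univ _) (mem_univ _)
    refine h1.trans (mul_le_mul_of_nonneg_right ?_ (norm_nonneg _))
    nlinarith

lemma summable_pow_mul_min {θ : ℝ} (hθ0 : 0 ≤ θ) (hθ1 : θ < 1) {h : ℝ} (hh : 0 ≤ h) :
    Summable fun j : ℕ => θ ^ j * min 1 (2 ^ j * h) := by
  refine Summable.of_nonneg_of_le (fun j => by positivity) (fun j => ?_)
    (summable_geometric_of_lt_one hθ0 hθ1)
  exact mul_le_of_le_one_right (by positivity) (min_le_left _ _)

lemma tsum_pow_mul_min_le {α : ℝ} (hα : 0 < α) (hα1 : α < 1) : ∃ C : ℝ, 0 ≤ C ∧ ∀ h : ℝ, 0 ≤ h →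
    ∑' j : ℕ, ((2 : ℝ) ^ (-α)) ^ j * min 1 (2 ^ j * h) ≤ C * h ^ α := by
  set θ : ℝ := (2 : ℝ) ^ (-α) with hθ
  have hθ0 : 0 < θ := by positivity
  have hθ1 : θ < 1 := Real.rpow_lt_one_of_one_lt_of_neg (by norm_num) (by linarith)
  have hθ2 : 1 < 2 * θ := by
    have h1 : 2 * θ = (2 : ℝ) ^ (1 - α) := by
      rw [hθ, sub_eq_add_neg, Real.rpow_add (by norm_num), Real.rpow_one]
    rw [h1]
    exact Real.one_lt_rpow (by norm_num) (by linarith)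
  have hθα : θ * 2 ^ α = 1 := by
    rw [hθ, Real.rpow_neg (by norm_num), inv_mul_cancel₀ (by positivity)]
  set S : ℝ → ℝ := fun h => ∑' j : ℕ, θ ^ j * min 1 (2 ^ j * h) with hS
  have hSle : ∀ h, 0 ≤ h → S h ≤ (1 - θ)⁻¹ := by
    intro h hh
    rw [← tsum_geometric_of_lt_one hθ0.le hθ1]
    refine (summable_pow_mul_min hθ0.le hθ1 hh).tsum_le_tsum (fun j => ?_)
      (summable_geometric_of_lt_one hθ0.le hθ1)
    exact mul_le_of_le_one_right (by positivity) (min_le_left _ _)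
  have hSrec : ∀ h, 0 ≤ h → S h = min 1 h + θ * S (2 * h) := by
    intro h hh
    simp only [hS]
    rw [(summable_pow_mul_min hθ0.le hθ1 hh).tsum_eq_zero_add, ← tsum_mul_left]
    congr 1
    · simp
    · refine tsum_congr fun j => ?_
      rw [pow_succ, pow_succ, mul_assoc (2 ^ j) 2 h]
      ring
  set D : ℝ := (2 * θ - 1)⁻¹ with hD
  have hD0 : 0 < D := inv_pos.2 (by linarith)
  have hDθ : D * (2 * θ - 1) = 1 := inv_mul_cancel₀ (by linarith)
  have hE0 : 0 < (1 - θ)⁻¹ := inv_pos.2 (by linarith)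
  set C : ℝ := (1 - θ)⁻¹ + 2 * D with hC
  have hC0 : 0 < C := by positivity
  have key : ∀ (N : ℕ) (h : ℝ), 1 ≤ 2 ^ N * h → h ≤ 2 → S h ≤ C * h ^ α - D * h := by
    intro N
    have hbig : ∀ h : ℝ, 1 ≤ h → h ≤ 2 → S h ≤ C * h ^ α - D * h := by
      intro h h1 h2
      have h3 : 1 ≤ h ^ α := Real.one_le_rpow h1 hα.le
      have h4 := hSle h (by linarith)
      nlinarith
    induction N with
    | zero => intro h h1 h2; exact hbig h (by simpa using h1) h2
    | succ N ih =>
      intro h h1 h2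
      rcases le_or_gt 1 h with h3 | h3
      · exact hbig h h3 h2
      · have h0 : 0 < h := by
          by_contra hneg
          have : (2 : ℝ) ^ (N + 1) * h ≤ 0 :=
            mul_nonpos_of_nonneg_of_nonpos (by positivity) (not_lt.1 hneg)
          linarith
        have h5 := ih (2 * h) (by rw [pow_succ] at h1; linarith) (by linarith)
        rw [hSrec h h0.le, min_eq_right h3.le]
        rw [Real.mul_rpow (by norm_num) h0.le] at h5
        have h6 := mul_le_mul_of_nonneg_left h5 hθ0.le
        have h7 : θ * (C * (2 ^ α * h ^ α) - D * (2 * h)) =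
            (θ * 2 ^ α) * (C * h ^ α) - (D * (2 * θ - 1)) * h - D * h := by ring
        rw [h7, hθα, hDθ] at h6
        linarith
  refine ⟨C, hC0.le, fun h hh => ?_⟩
  rcases hh.eq_or_lt with rfl | hpos
  · simp [Real.zero_rpow hα.ne']
  rcases le_or_gt h 2 with h2 | h2
  · obtain ⟨N, hN⟩ := pow_unbounded_of_one_lt h⁻¹ (one_lt_two (α := ℝ))
    have h1 : 1 ≤ 2 ^ N * h := by
      have := mul_lt_mul_of_pos_right hN hpos
      rw [inv_mul_cancel₀ hpos.ne'] at this
      exact this.le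
    have := key N h h1 h2
    have h3 : 0 < D * h := by positivity
    exact this.trans (by linarith)
  · have h3 : 1 ≤ h ^ α := Real.one_le_rpow (by linarith) hα.le
    refine (hSle h hh).trans ?_
    nlinarith

end ApproximateInverse

section ApproximateInverse

open scoped ContDiff
open MeasureTheory

set_option maxSynthPendingDepth 3

variable {n : ℕ}

lemma HasFDerivAt.const_smul_comp_smul {F : Type*} [NormedAddCommGroup F] [NormedSpace ℝ F]
    {u : EuclideanSpace ℝ (Fin n) → F} {u' : EuclideanSpace ℝ (Fin n) →L[ℝ] F} {s : ℝ}
    {x : EuclideanSpace ℝ (Fin n)} (k : ℝ) (h : HasFDerivAt u u' (s • x)) :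
    HasFDerivAt (fun x => k • u (s • x)) ((k * s) • u') x := by
  have h1 : HasFDerivAt (fun x : EuclideanSpace ℝ (Fin n) => s • x)
      (s • ContinuousLinearMap.id ℝ (EuclideanSpace ℝ (Fin n))) x :=
    (hasFDerivAt_id x).const_smul s
  refine ((h.comp x h1).const_smul k).congr_fderiv ?_
  ext v
  simp [smul_smul]

lemma hessTrace_smear {f : EuclideanSpace ℝ (Fin n) → ℝ} (A : Fin n → Fin n → ℝ)
    {Φ : EuclideanSpace ℝ (Fin n) →
      EuclideanSpace ℝ (Fin n) →L[ℝ] EuclideanSpace ℝ (Fin n) →L[ℝ] ℝ}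
    (hf : Continuous f) (hΦ : Continuous Φ) (hc : HasCompactSupport Φ)
    (x : EuclideanSpace ℝ (Fin n)) :
    hessTrace A (smear f Φ x) = smear f (fun z => hessTrace A (Φ z)) x := by
  have h := (hessTrace A).integral_comp_comm (integrable_smear hf hΦ hc x)
  rw [smear, ← h]
  simp [smear]

lemma tendsto_smear_dyadic {ρ f : EuclideanSpace ℝ (Fin n) → ℝ} {M α : ℝ} (hα : 0 < α)
    (hα1 : α ≤ 1) (hM0 : 0 ≤ M)
    (hρ : Continuous ρ) (hc : HasCompactSupport ρ) (hI : ∫ x, ρ x = 1)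
    (hH : ∀ (j : ℕ) (x y : EuclideanSpace ℝ (Fin n)),
      |f (((2 : ℝ) ^ j)⁻¹ • x) - f (((2 : ℝ) ^ j)⁻¹ • y)| ≤
        M * ((2 : ℝ) ^ (-α)) ^ j * ‖x - y‖ ^ α) (x : EuclideanSpace ℝ (Fin n)) :
    Filter.Tendsto (fun j : ℕ => smear (fun t => f (((2 : ℝ) ^ j)⁻¹ • t)) ρ ((2 : ℝ) ^ j • x))
      Filter.atTop (𝓝 (f x)) := by
  have hθ0 : (0 : ℝ) < (2 : ℝ) ^ (-α) := by positivity
  have hθ1 : (2 : ℝ) ^ (-α) < 1 := Real.rpow_lt_one_of_one_lt_of_neg (by norm_num) (by linarith)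
  obtain ⟨R₀, hR₀⟩ := hc.isCompact.isBounded.subset_closedBall 0
  have hsupp : ∀ t, ρ t ≠ 0 → ‖t‖ ≤ max R₀ 1 := fun t ht => by
    have := hR₀ (subset_tsupport _ ht)
    rw [mem_closedBall, dist_zero_right] at this
    exact this.trans (le_max_left _ _)
  rw [tendsto_iff_norm_sub_tendsto_zero]
  have h1 : Filter.Tendsto (fun j : ℕ => M * ((2 : ℝ) ^ (-α)) ^ j * max R₀ 1 * ∫ t, ‖ρ t‖)
      Filter.atTop (𝓝 0) := by
    have := ((tendsto_pow_atTop_nhds_zero_of_lt_one hθ0.le hθ1).const_mul M).mul_const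
      (max R₀ 1 * ∫ t, ‖ρ t‖)
    simpa [mul_assoc] using this
  refine squeeze_zero (fun _ => norm_nonneg _) (fun j => ?_) h1
  have h2 := norm_smear_sub_le (f := fun t => f (((2 : ℝ) ^ j)⁻¹ • t))
    (continuous_of_abs_sub_le_rpow hα (hH j)) hα hα1 (by positivity) (hH j)
    (le_max_right R₀ 1) hρ hc hsupp ((2 : ℝ) ^ j • x)
  rw [hI, smul_eq_mul, mul_one, inv_smul_smul₀ (by positivity)] at h2
  exact h2

lemma exists_parametrix (hn : 0 < n) (A : Fin n → Fin n → ℝ) {lam : ℝ} (hlam : 0 < lam)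
    (hA : ∀ ξ : EuclideanSpace ℝ (Fin n), lam * ‖ξ‖ ^ 2 ≤ ∑ i, ∑ j, A i j * ξ i * ξ j)
    {α : ℝ} (hα : 0 < α) (hα1 : α < 1) :
    ∃ C : ℝ, 0 ≤ C ∧ ∀ (f : EuclideanSpace ℝ (Fin n) → ℝ) (m M : ℝ), 0 ≤ m → 0 ≤ M →
      (∀ x, |f x| ≤ m) → (∀ x y, |f x - f y| ≤ M * ‖x - y‖ ^ α) →
      ∃ (u : EuclideanSpace ℝ (Fin n) → ℝ) (p : _) (H : _) (g : EuclideanSpace ℝ (Fin n) → ℝ),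
        BoundedC2On univ u p H (C * (m + M)) ∧
        (∀ x y, ‖H x - H y‖ ≤ C * M * ‖x - y‖ ^ α) ∧ (∀ x, hessTrace A (H x) = f x - g x) ∧
        ∀ x y, |g x - g y| ≤ C * m * ‖x - y‖ := by
  obtain ⟨ψ, ρ, hψ, hψc, hρ, hρc, hρ1, hψρ⟩ := exists_elliptic_kernel hn A hlam hA
  obtain ⟨C₁, hC₁, hbd⟩ := exists_smear_bounds hψ hψc
  obtain ⟨C₂, hC₂, hsum⟩ := tsum_pow_mul_min_le hα hα1
  have hψ1 := (contDiff_infty_iff_fderiv.1 hψ).2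
  have hψ2 := (contDiff_infty_iff_fderiv.1 hψ1).2
  have hc2 := (hψc.fderiv (𝕜 := ℝ)).fderiv (𝕜 := ℝ)
  set θ : ℝ := (2 : ℝ) ^ (-α) with hθ
  have hθ0 : 0 < θ := by positivity
  have hθ1 : θ < 1 := Real.rpow_lt_one_of_one_lt_of_neg (by norm_num) (by linarith)
  have hθ2 : (2 : ℝ)⁻¹ ≤ θ := by
    rw [hθ, ← Real.rpow_neg_one]
    exact Real.rpow_le_rpow_of_exponent_le (by norm_num) (by linarith)
  have hE0 : 0 < (1 - θ)⁻¹ := inv_pos.2 (by linarith)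
  set I := ∫ t, ‖fderiv ℝ ρ t‖
  have hI : 0 ≤ I := integral_nonneg fun _ => norm_nonneg _
  refine ⟨C₁ * (1 - θ)⁻¹ + 2 * C₁ * C₂ + I, by positivity, ?_⟩
  intro f m M hm0 hM0 hm hM
  have hf : Continuous f := continuous_of_abs_sub_le_rpow hα hM
  set F : ℕ → EuclideanSpace ℝ (Fin n) → ℝ := fun j t => f (((2 : ℝ) ^ j)⁻¹ • t) with hF
  have hFm : ∀ j x, |F j x| ≤ m := fun j x => hm _
  have hFM : ∀ j x y, |F j x - F j y| ≤ M * θ ^ j * ‖x - y‖ ^ α := by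
    intro j x y
    refine (hM _ _).trans (le_of_eq ?_)
    rw [← smul_sub, norm_smul, norm_inv, norm_pow, Real.norm_two,
      Real.mul_rpow (by positivity) (norm_nonneg _), Real.inv_rpow (by positivity),
      ← Real.rpow_neg (by positivity), hθ, ← Real.rpow_natCast, ← Real.rpow_natCast,
      ← Real.rpow_mul (by norm_num), ← Real.rpow_mul (by norm_num), mul_comm (j : ℝ), mul_assoc]
  have hFc : ∀ j, Continuous (F j) := fun j => continuous_of_abs_sub_le_rpow hα (hFM j)
  have hb := fun j => hbd (F j) m (M * θ ^ j) α hα hα1.le hm0 (by positivity) (hFm j) (hFM j)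
  set u : ℕ → EuclideanSpace ℝ (Fin n) → ℝ :=
    fun j x => ((4 : ℝ) ^ j)⁻¹ • smear (F j) ψ ((2 : ℝ) ^ j • x) with hu
  set p : ℕ → EuclideanSpace ℝ (Fin n) → EuclideanSpace ℝ (Fin n) →L[ℝ] ℝ :=
    fun j x => ((2 : ℝ) ^ j)⁻¹ • smear (F j) (fderiv ℝ ψ) ((2 : ℝ) ^ j • x) with hp
  set H : ℕ → EuclideanSpace ℝ (Fin n) →
      EuclideanSpace ℝ (Fin n) →L[ℝ] EuclideanSpace ℝ (Fin n) →L[ℝ] ℝ :=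
    fun j x => smear (F j) (fderiv ℝ (fderiv ℝ ψ)) ((2 : ℝ) ^ j • x) with hH
  have h2θ : ∀ j : ℕ, ((2 : ℝ) ^ j)⁻¹ ≤ θ ^ j := fun j => by
    rw [← inv_pow]
    exact pow_le_pow_left₀ (by norm_num) hθ2 j
  have h4θ : ∀ j : ℕ, ((4 : ℝ) ^ j)⁻¹ ≤ θ ^ j := fun j => by
    rw [← inv_pow]
    exact pow_le_pow_left₀ (by norm_num) (le_trans (by norm_num) hθ2) j
  have hterm : ∀ j, BoundedC2On univ (u j) (p j) (H j) (C₁ * (m + M) * θ ^ j) := by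
    intro j
    obtain ⟨b1, b2, b3, b4, b5, -⟩ := hb j
    have hθj : 0 < θ ^ j := by positivity
    have hCm : 0 ≤ C₁ * m := by positivity
    have hCM : 0 ≤ C₁ * M := by positivity
    refine ⟨fun x _ => ?_, fun x _ => ?_, fun x _ => ?_, fun x _ => ?_, fun x _ => ?_⟩
    · refine ((b1 _).const_smul_comp_smul (((4 : ℝ) ^ j)⁻¹)).congr_fderiv ?_
      simp only [hp]
      congr 1
      rw [show (4 : ℝ) = 2 * 2 by norm_num, mul_pow]
      field_simp
    · refine ((b2 _).const_smul_comp_smul (((2 : ℝ) ^ j)⁻¹)).congr_fderiv ?_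
      rw [inv_mul_cancel₀ (by positivity), one_smul]
    · simp only [hu, smul_eq_mul, abs_mul, abs_of_pos (by positivity : 0 < ((4 : ℝ) ^ j)⁻¹)]
      have := mul_le_mul (h4θ j) (b3 ((2 : ℝ) ^ j • x)) (abs_nonneg _) hθj.le
      nlinarith [mul_nonneg hCM hθj.le]
    · simp only [hp, norm_smul, Real.norm_eq_abs, abs_of_pos (by positivity : 0 < ((2 : ℝ) ^ j)⁻¹)]
      have := mul_le_mul (h2θ j) (b4 ((2 : ℝ) ^ j • x)) (norm_nonneg _) hθj.le
      nlinarith [mul_nonneg hCM hθj.le]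
    · refine (b5 _).trans ?_
      nlinarith [mul_nonneg hCm hθj.le]
  have hK : Summable fun j : ℕ => C₁ * (m + M) * θ ^ j :=
    (summable_geometric_of_lt_one hθ0.le hθ1).mul_left _
  have hKs : ∑' j : ℕ, C₁ * (m + M) * θ ^ j = C₁ * (m + M) * (1 - θ)⁻¹ := by
    rw [tsum_mul_left, tsum_geometric_of_lt_one hθ0.le hθ1]
  have hT := BoundedC2On.tsum isOpen_univ isPreconnected_univ hK hterm
  have hHs : ∀ x, Summable fun j => H j x := fun x =>
    .of_norm_bounded hK fun j => (hterm j).norm_hessian_le x (mem_univ x)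
  rw [hKs] at hT
  refine ⟨_, _, _, smear f ρ, ⟨hT.1, hT.2, fun x hx => (hT.3 x hx).trans ?_,
    fun x hx => (hT.4 x hx).trans ?_, fun x hx => (hT.5 x hx).trans ?_⟩, fun x y => ?_,
    fun x => ?_, fun x y => ?_⟩
  · nlinarith [mul_nonneg (mul_nonneg hC₁ hC₂) (add_nonneg hm0 hM0),
      mul_nonneg hI (add_nonneg hm0 hM0)]
  · nlinarith [mul_nonneg (mul_nonneg hC₁ hC₂) (add_nonneg hm0 hM0),
      mul_nonneg hI (add_nonneg hm0 hM0)]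
  · nlinarith [mul_nonneg (mul_nonneg hC₁ hC₂) (add_nonneg hm0 hM0),
      mul_nonneg hI (add_nonneg hm0 hM0)]
  · rw [← (hHs x).tsum_sub (hHs y)]
    have h1 : ∀ j, ‖H j x - H j y‖ ≤ 2 * C₁ * M * (θ ^ j * min 1 (2 ^ j * ‖x - y‖)) := by
      intro j
      obtain ⟨-, -, -, -, b5, b6⟩ := hb j
      have h2 := b6 ((2 : ℝ) ^ j • x) ((2 : ℝ) ^ j • y)
      rw [← smul_sub, norm_smul, norm_pow, Real.norm_two] at h2
      have h3 : ‖H j x - H j y‖ ≤ C₁ * (M * θ ^ j) + C₁ * (M * θ ^ j) :=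
        (norm_sub_le _ _).trans (add_le_add (b5 _) (b5 _))
      have h4 : 0 ≤ C₁ * (M * θ ^ j) := by positivity
      rcases min_cases 1 ((2 : ℝ) ^ j * ‖x - y‖) with ⟨h5, -⟩ | ⟨h5, -⟩
      · rw [h5]
        linarith
      · rw [h5]
        have h6 : 0 ≤ C₁ * (M * θ ^ j) * (2 ^ j * ‖x - y‖) := by positivity
        refine h2.trans ?_
        linarith
    have h2 : Summable fun j : ℕ => 2 * C₁ * M * (θ ^ j * min 1 (2 ^ j * ‖x - y‖)) :=
      (summable_pow_mul_min hθ0.le hθ1 (norm_nonneg _)).mul_left _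
    refine (tsum_of_norm_bounded h2.hasSum h1).trans ?_
    rw [tsum_mul_left]
    have h3 := mul_le_mul_of_nonneg_left (hsum ‖x - y‖ (norm_nonneg _))
      (by positivity : 0 ≤ 2 * C₁ * M)
    have h4 : 0 ≤ ‖x - y‖ ^ α := by positivity
    have h5 : 0 ≤ C₁ * (1 - θ)⁻¹ * M * ‖x - y‖ ^ α := by positivity
    have h6 : 0 ≤ I * M * ‖x - y‖ ^ α := by positivity
    refine h3.trans ?_
    linarith
  · have h1 : ∀ j, hessTrace A (H j x) =
        smear (F (j + 1)) ρ ((2 : ℝ) ^ (j + 1) • x) - smear (F j) ρ ((2 : ℝ) ^ j • x) := by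
      intro j
      have hd : Continuous fun z : EuclideanSpace ℝ (Fin n) => 2 ^ n * ρ ((2 : ℝ) • z) := by
        have := hρ.continuous
        fun_prop
      have hdc : HasCompactSupport fun z : EuclideanSpace ℝ (Fin n) =>
          2 ^ n * ρ ((2 : ℝ) • z) := by
        refine HasCompactSupport.mul_left ?_
        exact hρc.comp_homeomorph (Homeomorph.smulOfNeZero (2 : ℝ) two_ne_zero)
      have h2 := smear_comp_smul (F j) ρ ((2 : ℝ) ^ j • x)
      have h3 : (fun t => F j ((2 : ℝ)⁻¹ • t)) = F (j + 1) := by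
        ext t
        simp only [hF, smul_smul, pow_succ, mul_inv]
      rw [h3, smul_smul, ← pow_succ'] at h2
      simp only [hH]
      rw [hessTrace_smear A (hFc j) hψ2.continuous hc2, ← h2]
      simp_rw [hψρ]
      rw [smear, smear, smear, ← integral_sub (integrable_smear (hFc j) hd hdc _)
        (integrable_smear (hFc j) hρ.continuous hρc _)]
      simp only [smul_eq_mul, mul_sub]
    have h2 := ((hHs x).hasSum.mapL (hessTrace A)).tendsto_sum_nat
    simp only [h1, Finset.sum_range_sub (fun j => smear (F j) ρ ((2 : ℝ) ^ j • x))] at h2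
    have h3 := (tendsto_smear_dyadic hα hα1.le hM0 hρ.continuous hρc hρ1 hFM x).sub_const
      (smear (F 0) ρ ((2 : ℝ) ^ 0 • x))
    have h4 : F 0 = f := by
      ext t
      simp [hF]
    rw [tendsto_nhds_unique h2 h3, h4, pow_zero, one_smul]
  · have h1 := convex_univ.norm_image_sub_le_of_norm_hasFDerivWithin_le
      (fun z _ => (hasFDerivAt_smear hf (hρ.of_le (by norm_cast)) hρc z).hasFDerivWithinAt)
      (fun z _ => norm_smear_le hm (contDiff_infty_iff_fderiv.1 hρ).2.continuous
        (hρc.fderiv (𝕜 := ℝ)) z) (mem_univ y) (mem_univ x)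
    rw [Real.norm_eq_abs] at h1
    refine h1.trans (mul_le_mul_of_nonneg_right ?_ (norm_nonneg _))
    have h5 : 0 ≤ C₁ * (1 - θ)⁻¹ * m := by positivity
    have h6 : 0 ≤ C₁ * C₂ * m := by positivity
    linarith

end ApproximateInverse

section LocalParametrix

set_option maxSynthPendingDepth 3

variable {n : ℕ}

/-- The inner product as a continuous bilinear form. -/
def innerForm (n : ℕ) : EuclideanSpace ℝ (Fin n) →L[ℝ] EuclideanSpace ℝ (Fin n) →L[ℝ] ℝ :=
  innerSL ℝ

lemma innerForm_apply (x y : EuclideanSpace ℝ (Fin n)) : innerForm n x y = inner ℝ x y := rfl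

lemma norm_innerForm_apply (x : EuclideanSpace ℝ (Fin n)) : ‖innerForm n x‖ = ‖x‖ :=
  innerSL_apply_norm ℝ x

lemma norm_innerForm_le : ‖innerForm n‖ ≤ 1 := norm_innerSL_le ℝ

lemma hessTrace_innerForm (A : Fin n → Fin n → ℝ) :
    hessTrace A (innerForm n) = ∑ i, A i i := by
  simp only [hessTrace_apply, innerForm_apply]
  refine Finset.sum_congr rfl fun i _ => ?_
  rw [Finset.sum_eq_single i]
  · simp
  · intro j _ hj
    simp [EuclideanSpace.inner_single_left, hj]
  · simp

lemma sum_diag_pos (hn : 0 < n) {A : Fin n → Fin n → ℝ} {lam : ℝ} (hlam : 0 < lam)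
    (hA : ∀ ξ : EuclideanSpace ℝ (Fin n), lam * ‖ξ‖ ^ 2 ≤ ∑ i, ∑ j, A i j * ξ i * ξ j) :
    0 < ∑ i, A i i := by
  have h1 : ∀ k, lam ≤ A k k := by
    intro k
    have := hA (EuclideanSpace.single k 1)
    simpa [PiLp.single_apply] using this
  have : Nonempty (Fin n) := ⟨⟨0, hn⟩⟩
  exact Finset.sum_pos (fun i _ => hlam.trans_le (h1 i)) Finset.univ_nonempty

lemma le_four_mul_rpow {t α : ℝ} (ht : 0 ≤ t) (ht4 : t ≤ 4) (hα : 0 < α) (hα1 : α ≤ 1) :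
    t ≤ 4 * t ^ α := by
  have h1 : (t / 4) ^ (1 : ℝ) ≤ (t / 4) ^ α :=
    Real.rpow_le_rpow_of_exponent_ge' (by positivity) (by linarith) hα.le hα1
  have h2 : (t / 4) ^ α ≤ t ^ α := Real.rpow_le_rpow (by positivity) (by linarith) hα.le
  rw [Real.rpow_one] at h1
  linarith

lemma hasFDerivAt_half_norm_sq (κ : ℝ) (x : EuclideanSpace ℝ (Fin n)) :
    HasFDerivAt (fun x : EuclideanSpace ℝ (Fin n) => κ / 2 * ‖x‖ ^ 2) (κ • innerForm n x) x := by
  refine ((hasStrictFDerivAt_norm_sq x).hasFDerivAt.const_mul (κ / 2)).congr_fderiv ?_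
  ext v
  simp [innerForm_apply]
  ring

/-- `f` is bounded by `N` on `s` and Hölder continuous there with exponent `α` and constant `N`. -/
structure HolderBound (α : ℝ) (s : Set (EuclideanSpace ℝ (Fin n)))
    (f : EuclideanSpace ℝ (Fin n) → ℝ) (N : ℝ) : Prop where
  abs_le : ∀ x ∈ s, |f x| ≤ N
  abs_sub_le : ∀ x ∈ s, ∀ y ∈ s, |f x - f y| ≤ N * ‖x - y‖ ^ α

namespace HolderBound

variable {α N N' : ℝ} {s t : Set (EuclideanSpace ℝ (Fin n))}
  {f f' : EuclideanSpace ℝ (Fin n) → ℝ}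

lemma mono (h : HolderBound α s f N) (hN : N ≤ N') (hst : t ⊆ s) : HolderBound α t f N' :=
  ⟨fun x hx => (h.1 x (hst hx)).trans hN, fun x hx y hy => (h.2 x (hst hx) y (hst hy)).trans
    (mul_le_mul_of_nonneg_right hN (by positivity))⟩

lemma congr (h : HolderBound α s f N) (hf : ∀ x ∈ s, f' x = f x) : HolderBound α s f' N :=
  ⟨fun x hx => by rw [hf x hx]; exact h.1 x hx,
    fun x hx y hy => by rw [hf x hx, hf y hy]; exact h.2 x hx y hy⟩

lemma add (h : HolderBound α s f N) (h' : HolderBound α s f' N') :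
    HolderBound α s (fun x => f x + f' x) (N + N') := by
  refine ⟨fun x hx => (abs_add_le _ _).trans (add_le_add (h.1 x hx) (h'.1 x hx)),
    fun x hx y hy => ?_⟩
  rw [add_sub_add_comm, add_mul]
  exact (abs_add_le _ _).trans (add_le_add (h.2 x hx y hy) (h'.2 x hx y hy))

lemma neg (h : HolderBound α s f N) : HolderBound α s (fun x => -f x) N := by
  refine ⟨fun x hx => by rw [abs_neg]; exact h.1 x hx, fun x hx y hy => ?_⟩
  rw [← neg_sub', abs_neg]
  exact h.2 x hx y hy

lemma mul (h : HolderBound α s f N) (h' : HolderBound α s f' N') (hN : 0 ≤ N) (hN' : 0 ≤ N') :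
    HolderBound α s (fun x => f x * f' x) (2 * (N * N')) := by
  refine ⟨fun x hx => ?_, fun x hx y hy => ?_⟩
  · rw [abs_mul]
    have := mul_le_mul (h.1 x hx) (h'.1 x hx) (abs_nonneg _) hN
    nlinarith [mul_nonneg hN hN']
  · have h1 : f x * f' x - f y * f' y = (f x - f y) * f' x + f y * (f' x - f' y) := by ring
    rw [h1]
    refine (abs_add_le _ _).trans ?_
    rw [abs_mul, abs_mul]
    have h2 := mul_le_mul (h.2 x hx y hy) (h'.1 x hx) (abs_nonneg _) (by positivity)
    have h3 := mul_le_mul (h.1 y hy) (h'.2 x hx y hy) (abs_nonneg _) hN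
    linarith

lemma sum {ι : Type*} (I : Finset ι) {F : ι → EuclideanSpace ℝ (Fin n) → ℝ} {N : ι → ℝ}
    (h : ∀ i ∈ I, HolderBound α s (F i) (N i)) :
    HolderBound α s (fun x => ∑ i ∈ I, F i x) (∑ i ∈ I, N i) := by
  refine ⟨fun x hx => (Finset.abs_sum_le_sum_abs _ _).trans
    (Finset.sum_le_sum fun i hi => (h i hi).1 x hx), fun x hx y hy => ?_⟩
  rw [← Finset.sum_sub_distrib, Finset.sum_mul]
  exact (Finset.abs_sum_le_sum_abs _ _).trans
    (Finset.sum_le_sum fun i hi => (h i hi).2 x hx y hy)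

end HolderBound

lemma exists_local_parametrix (hn : 0 < n) (A : Fin n → Fin n → ℝ) {lam : ℝ} (hlam : 0 < lam)
    (hA : ∀ ξ : EuclideanSpace ℝ (Fin n), lam * ‖ξ‖ ^ 2 ≤ ∑ i, ∑ j, A i j * ξ i * ξ j)
    {α : ℝ} (hα : 0 < α) (hα1 : α < 1) {ε : ℝ} (hε : 0 < ε) :
    ∃ C : ℝ, 0 ≤ C ∧ ∀ (f : EuclideanSpace ℝ (Fin n) → ℝ) (N : ℝ), 0 ≤ N →
      HolderBound α univ f N →
      ∃ (u : EuclideanSpace ℝ (Fin n) → ℝ) (p : _) (H : _),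
        BoundedC2On (ball 0 2) u p H (C * N) ∧
        (∀ x ∈ ball 0 2, ∀ y ∈ ball 0 2, ‖H x - H y‖ ≤ C * N * ‖x - y‖ ^ α) ∧
        HolderBound α (ball 0 2) (fun x => hessTrace A (H x) - f x) (ε * N) := by
  obtain ⟨C₀, hC₀, hpar⟩ := exists_parametrix hn A hlam hA hα hα1
  set tr := ∑ i, A i i with htr
  have htr0 : 0 < tr := sum_diag_pos hn hlam hA
  set s : ℝ := max 1 (4 * C₀ / ε) with hs
  have hs1 : 1 ≤ s := le_max_left _ _
  have hs0 : 0 < s := by linarith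
  have hsε : 4 * (C₀ / s) ≤ ε := by
    have h1 : 4 * C₀ / ε ≤ s := le_max_right _ _
    rw [div_le_iff₀ hε] at h1
    rw [← mul_div_assoc, div_le_iff₀ hs0]
    linarith
  set T := ‖hessTrace A‖
  have hT : 0 ≤ T := norm_nonneg _
  set Q : ℝ := (1 + T * (2 * C₀ * s)) / tr with hQ
  have hQ0 : 0 ≤ Q := by positivity
  refine ⟨2 * C₀ * s ^ 3 + 2 * Q, by positivity, ?_⟩
  intro f N hN hf
  have hsα : s ^ α ≤ s := by
    conv_rhs => rw [← Real.rpow_one s]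
    exact Real.rpow_le_rpow_of_exponent_le hs1 hα1.le
  obtain ⟨u, p, H, g, hB, hH, htrace, hg⟩ := hpar (fun x => f (s • x)) N (N * s) hN
    (by positivity) (fun x => hf.1 _ (mem_univ _)) (fun x y => by
      refine (hf.2 _ (mem_univ _) _ (mem_univ _)).trans ?_
      rw [← smul_sub, norm_smul, Real.norm_of_nonneg hs0.le,
        Real.mul_rpow hs0.le (norm_nonneg _), mul_assoc]
      gcongr)
  have hN1 : C₀ * (N + N * s) ≤ 2 * C₀ * s * N := by
    have : 0 ≤ C₀ * N := by positivity
    nlinarith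
  set κ : ℝ := g 0 / tr with hκ
  have hκN : |κ| ≤ Q * N := by
    have h1 := htrace 0
    have h2 : |hessTrace A (H 0)| ≤ T * (2 * C₀ * s * N) :=
      ((hessTrace A).le_opNorm _).trans
        (mul_le_mul_of_nonneg_left ((hB.5 0 (mem_univ _)).trans hN1) hT)
    have h3 : g 0 = f (s • 0) - hessTrace A (H 0) := by linarith
    have h4 : |g 0| ≤ N + T * (2 * C₀ * s * N) := by
      rw [h3]
      exact (abs_sub _ _).trans (add_le_add (hf.1 _ (mem_univ _)) h2)
    rw [hκ, abs_div, abs_of_pos htr0, hQ, div_mul_eq_mul_div]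
    gcongr
    linarith
  have hCN : 0 ≤ C₀ * N := by positivity
  have hs2 : s ≤ s ^ 2 := by nlinarith
  have hs3 : s ^ 2 ≤ s ^ 3 := by nlinarith [sq_nonneg s]
  have hQN : 0 ≤ Q * N := by positivity
  refine ⟨fun x => s ^ 2 • u (s⁻¹ • x) + κ / 2 * ‖x‖ ^ 2,
    fun x => s • p (s⁻¹ • x) + κ • innerForm n x,
    fun x => H (s⁻¹ • x) + κ • innerForm n, ⟨fun x hx => ?_, fun x hx => ?_, fun x hx => ?_,
    fun x hx => ?_, fun x hx => ?_⟩, fun x _ y _ => ?_, fun x hx => ?_, fun x hx y hy => ?_⟩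
  · refine HasFDerivAt.add ?_ (hasFDerivAt_half_norm_sq κ x)
    refine ((hB.1 _ (mem_univ _)).const_smul_comp_smul (s ^ 2)).congr_fderiv ?_
    congr 1
    field_simp
  · refine HasFDerivAt.add ?_ ?_
    · refine ((hB.2 _ (mem_univ _)).const_smul_comp_smul s).congr_fderiv ?_
      rw [mul_inv_cancel₀ hs0.ne', one_smul]
    · exact (innerForm n).hasFDerivAt.const_smul κ
  · rw [mem_ball_zero_iff] at hx
    refine (abs_add_le _ _).trans ?_
    have h1 := (hB.3 (s⁻¹ • x) (mem_univ _)).trans hN1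
    rw [smul_eq_mul, abs_mul, abs_mul, abs_div, abs_of_pos (by positivity : 0 < s ^ 2),
      abs_of_nonneg (by positivity : 0 ≤ ‖x‖ ^ 2), abs_of_pos (by norm_num : (0 : ℝ) < 2)]
    have h2 : ‖x‖ ^ 2 ≤ 4 := by nlinarith [norm_nonneg x]
    have h3 := mul_le_mul_of_nonneg_left h1 (by positivity : 0 ≤ s ^ 2)
    have h4 : |κ| / 2 * ‖x‖ ^ 2 ≤ Q * N / 2 * 4 := by gcongr
    linarith
  · rw [mem_ball_zero_iff] at hx
    refine (norm_add_le _ _).trans ?_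
    have h1 := (hB.4 (s⁻¹ • x) (mem_univ _)).trans hN1
    rw [norm_smul, norm_smul, norm_innerForm_apply, Real.norm_of_nonneg hs0.le, Real.norm_eq_abs]
    have h3 := mul_le_mul_of_nonneg_left h1 hs0.le
    have h4 : |κ| * ‖x‖ ≤ Q * N * 2 := by gcongr
    nlinarith
  · refine (norm_add_le _ _).trans ?_
    have h1 := (hB.5 (s⁻¹ • x) (mem_univ _)).trans hN1
    have h5 : ‖innerForm n‖ ≤ 1 := norm_innerForm_le
    rw [norm_smul, Real.norm_eq_abs]
    have h4 : |κ| * ‖innerForm n‖ ≤ Q * N * 1 := by gcongr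
    nlinarith
  · rw [add_sub_add_right_eq_sub]
    refine (hH _ _).trans ?_
    rw [← smul_sub, norm_smul, Real.norm_of_nonneg (by positivity)]
    have h1 : (s⁻¹ * ‖x - y‖) ^ α ≤ ‖x - y‖ ^ α := by
      refine Real.rpow_le_rpow (by positivity) ?_ hα.le
      exact mul_le_of_le_one_left (norm_nonneg _) (inv_le_one_of_one_le₀ hs1)
    have h2 : C₀ * (N * s) ≤ (2 * C₀ * s ^ 3 + 2 * Q) * N := by nlinarith
    gcongr
  · rw [mem_ball_zero_iff] at hx
    have h1 : hessTrace A (H (s⁻¹ • x) + κ • innerForm n) - f x = g 0 - g (s⁻¹ • x) := by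
      rw [map_add, map_smul, hessTrace_innerForm, htrace, smul_inv_smul₀ hs0.ne', hκ, smul_eq_mul,
        div_mul_cancel₀ _ htr0.ne']
      ring
    have h2 := hg 0 (s⁻¹ • x)
    rw [zero_sub, norm_neg, norm_smul, Real.norm_of_nonneg (by positivity)] at h2
    rw [h1]
    refine h2.trans ?_
    have h3 : C₀ * N * (s⁻¹ * ‖x‖) ≤ C₀ * N * (s⁻¹ * 4) := by
      gcongr
      linarith
    have h4 : C₀ * N * (s⁻¹ * 4) = 4 * (C₀ / s) * N := by ring
    rw [h4] at h3
    exact h3.trans (by gcongr)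
  · rw [mem_ball_zero_iff] at hx hy
    have h1 : ∀ x, hessTrace A (H (s⁻¹ • x) + κ • innerForm n) - f x = g 0 - g (s⁻¹ • x) := by
      intro x
      rw [map_add, map_smul, hessTrace_innerForm, htrace, smul_inv_smul₀ hs0.ne', hκ, smul_eq_mul,
        div_mul_cancel₀ _ htr0.ne']
      ring
    have h2 := hg (s⁻¹ • y) (s⁻¹ • x)
    rw [← smul_sub, norm_smul, Real.norm_of_nonneg (by positivity), norm_sub_rev] at h2
    rw [h1, h1, sub_sub_sub_cancel_left]
    refine h2.trans ?_
    have h5 : ‖x - y‖ ≤ 4 := (norm_sub_le _ _).trans (by linarith)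
    have h3 : C₀ * N * (s⁻¹ * ‖x - y‖) ≤ C₀ * N * (s⁻¹ * (4 * ‖x - y‖ ^ α)) := by
      gcongr
      exact le_four_mul_rpow (norm_nonneg _) h5 hα hα1.le
    have h4 : C₀ * N * (s⁻¹ * (4 * ‖x - y‖ ^ α)) = 4 * (C₀ / s) * N * ‖x - y‖ ^ α := by ring
    rw [h4] at h3
    exact h3.trans (by gcongr)

end LocalParametrix

section UnitBall

set_option maxSynthPendingDepth 3

variable {n : ℕ}

/-- The value `∑ Aᵢⱼ Hᵢⱼ + ∑ βᵢ qᵢ + γ t` of a second-order operator at a 2-jet `(t, q, H)`. -/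
def jetForm (A : Fin n → Fin n → ℝ) (β : Fin n → ℝ) (γ : ℝ) (t : ℝ)
    (q : EuclideanSpace ℝ (Fin n) →L[ℝ] ℝ)
    (H : EuclideanSpace ℝ (Fin n) →L[ℝ] EuclideanSpace ℝ (Fin n) →L[ℝ] ℝ) : ℝ :=
  hessTrace A H + (∑ i, β i * q (EuclideanSpace.single i 1)) + γ * t

/-- The radial retraction onto the closed unit ball. -/
def radialRetract (x : EuclideanSpace ℝ (Fin n)) : EuclideanSpace ℝ (Fin n) :=
  (max 1 ‖x‖)⁻¹ • x

lemma radialRetract_mem (x : EuclideanSpace ℝ (Fin n)) : radialRetract x ∈ closedBall 0 1 := by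
  have h : 0 < max 1 ‖x‖ := lt_max_of_lt_left one_pos
  rw [mem_closedBall_zero_iff, radialRetract, norm_smul, norm_inv, Real.norm_of_nonneg h.le,
    inv_mul_le_iff₀ h, mul_one]
  exact le_max_right _ _

lemma radialRetract_of_mem {x : EuclideanSpace ℝ (Fin n)} (hx : x ∈ closedBall 0 1) :
    radialRetract x = x := by
  rw [mem_closedBall_zero_iff] at hx
  rw [radialRetract, max_eq_left hx, inv_one, one_smul]

lemma norm_radialRetract_sub_le (x y : EuclideanSpace ℝ (Fin n)) :
    ‖radialRetract x - radialRetract y‖ ≤ 2 * ‖x - y‖ := by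
  set s := max 1 ‖x‖ with hs
  set t := max 1 ‖y‖ with ht
  have hs1 : 1 ≤ s := le_max_left _ _
  have ht1 : 1 ≤ t := le_max_left _ _
  have hs0 : 0 < s := by linarith
  have ht0 : 0 < t := by linarith
  have hyt : ‖y‖ ≤ t := le_max_right _ _
  have hst : |t - s| ≤ ‖x - y‖ := by
    refine (abs_max_sub_max_le_abs _ _ _ |>.trans ?_ : |max ‖y‖ 1 - max ‖x‖ 1| ≤ _) |>.trans' ?_
    · rw [norm_sub_rev]
      exact abs_norm_sub_norm_le y x
    · rw [hs, ht, max_comm, max_comm 1 ‖x‖]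
  have h1 : radialRetract x - radialRetract y = s⁻¹ • (x - y) + (s⁻¹ * (t - s) * t⁻¹) • y := by
    have h2 : s⁻¹ * (t - s) * t⁻¹ = s⁻¹ - t⁻¹ := by field_simp
    rw [h2, radialRetract, radialRetract, smul_sub, sub_smul]
    abel
  rw [h1]
  refine (norm_add_le _ _).trans ?_
  rw [norm_smul, norm_smul, norm_mul, norm_mul, norm_inv, norm_inv, Real.norm_of_nonneg hs0.le,
    Real.norm_of_nonneg ht0.le, Real.norm_eq_abs]
  have hsi : s⁻¹ ≤ 1 := inv_le_one_of_one_le₀ hs1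
  have h3 : s⁻¹ * ‖x - y‖ ≤ ‖x - y‖ := mul_le_of_le_one_left (norm_nonneg _) hsi
  have h4 : t⁻¹ * ‖y‖ ≤ 1 := by
    rw [inv_mul_le_iff₀ ht0]
    linarith
  have h5 : s⁻¹ * |t - s| * t⁻¹ * ‖y‖ = s⁻¹ * |t - s| * (t⁻¹ * ‖y‖) := by ring
  have h6 : s⁻¹ * |t - s| * (t⁻¹ * ‖y‖) ≤ 1 * ‖x - y‖ * 1 := by gcongr
  rw [h5]
  linarith

lemma HolderBound.comp_radialRetract {α N : ℝ} {f : EuclideanSpace ℝ (Fin n) → ℝ} (hα : 0 < α)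
    (hα1 : α ≤ 1) (hN : 0 ≤ N) (h : HolderBound α (closedBall 0 1) f N) :
    HolderBound α univ (fun x => f (radialRetract x)) (2 * N) := by
  refine ⟨fun x _ => (h.1 _ (radialRetract_mem x)).trans (by linarith), fun x _ y _ => ?_⟩
  refine (h.2 _ (radialRetract_mem x) _ (radialRetract_mem y)).trans ?_
  have h1 : ‖radialRetract x - radialRetract y‖ ^ α ≤ (2 * ‖x - y‖) ^ α :=
    Real.rpow_le_rpow (norm_nonneg _) (norm_radialRetract_sub_le x y) hα.le
  have h2 : (2 : ℝ) ^ α ≤ 2 := by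
    conv_rhs => rw [← Real.rpow_one 2]
    exact Real.rpow_le_rpow_of_exponent_le (by norm_num) hα1
  rw [Real.mul_rpow (by norm_num) (norm_nonneg _)] at h1
  have h3 : (2 : ℝ) ^ α * ‖x - y‖ ^ α ≤ 2 * ‖x - y‖ ^ α := by gcongr
  calc N * ‖radialRetract x - radialRetract y‖ ^ α ≤ N * (2 * ‖x - y‖ ^ α) := by
        gcongr
        exact h1.trans h3
    _ = 2 * N * ‖x - y‖ ^ α := by ring

/-- The coefficients are `δ`-close in the Hölder norm on the closed unit ball to the pure
second-order operator with constant coefficients `A`. -/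
structure NearConstant (α : ℝ) (A : Fin n → Fin n → ℝ)
    (a : Fin n → Fin n → EuclideanSpace ℝ (Fin n) → ℝ)
    (b : Fin n → EuclideanSpace ℝ (Fin n) → ℝ) (c : EuclideanSpace ℝ (Fin n) → ℝ)
    (δ : ℝ) : Prop where
  second : ∀ i j, HolderBound α (closedBall 0 1) (fun x => a i j x - A i j) δ
  first : ∀ i, HolderBound α (closedBall 0 1) (b i) δ
  zeroth : HolderBound α (closedBall 0 1) c δ

lemma exists_improvement_step (hn : 0 < n) (A : Fin n → Fin n → ℝ) {lam : ℝ} (hlam : 0 < lam)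
    (hA : ∀ ξ : EuclideanSpace ℝ (Fin n), lam * ‖ξ‖ ^ 2 ≤ ∑ i, ∑ j, A i j * ξ i * ξ j)
    {α : ℝ} (hα : 0 < α) (hα1 : α < 1) :
    ∃ C δ : ℝ, 0 ≤ C ∧ 0 < δ ∧ ∀ a b c, NearConstant α A a b c δ →
      ∀ (f : EuclideanSpace ℝ (Fin n) → ℝ) (N : ℝ), 0 ≤ N →
      HolderBound α (closedBall 0 1) f N →
      ∃ (u : EuclideanSpace ℝ (Fin n) → ℝ) (p : _) (H : _),
        BoundedC2On (ball 0 2) u p H (C * N) ∧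
        (∀ x ∈ ball 0 2, ∀ y ∈ ball 0 2, ‖H x - H y‖ ≤ C * N * ‖x - y‖ ^ α) ∧
        HolderBound α (closedBall 0 1)
          (fun x => f x - jetForm (fun i j => a i j x) (fun i => b i x) (c x) (u x) (p x) (H x))
          (N / 2) := by
  obtain ⟨C, hC, hpar⟩ := exists_local_parametrix hn A hlam hA hα hα1
    (by norm_num : (0 : ℝ) < 1 / 8)
  set D : ℝ := 64 * (C + 1) * (n * n + n + 1) with hD
  have hD0 : 0 < D := by positivity
  refine ⟨2 * C, D⁻¹, by positivity, inv_pos.2 hD0, ?_⟩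
  intro a b c hnear f N hN hf
  set δ := D⁻¹ with hδ
  have hδ0 : 0 < δ := inv_pos.2 hD0
  obtain ⟨u, p, H, hB, hH, herr⟩ := hpar (fun x => f (radialRetract x)) (2 * N) (by positivity)
    (hf.comp_radialRetract hα hα1.le hN)
  have hC2 : 2 * C * N = C * (2 * N) := by ring
  refine ⟨u, p, H, by rwa [hC2], by rwa [hC2], ?_⟩
  set K := C * (2 * N) with hK
  have hK0 : 0 ≤ K := by positivity
  have hsub : closedBall (0 : EuclideanSpace ℝ (Fin n)) 1 ⊆ ball 0 2 :=
    closedBall_subset_ball (by norm_num)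
  have hlip : ∀ (v : EuclideanSpace ℝ (Fin n) → ℝ), (∀ x ∈ ball 0 2, |v x| ≤ K) →
      (∀ x ∈ ball 0 2, ∀ y ∈ ball 0 2, |v x - v y| ≤ K * ‖x - y‖) →
      HolderBound α (closedBall 0 1) v (4 * K) := by
    intro v hv hv'
    refine ⟨fun x hx => (hv x (hsub hx)).trans (by linarith), fun x hx y hy => ?_⟩
    refine (hv' x (hsub hx) y (hsub hy)).trans ?_
    rw [mem_closedBall_zero_iff] at hx hy
    have h5 : ‖x - y‖ ≤ 4 := (norm_sub_le _ _).trans (by linarith)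
    have h6 := mul_le_mul_of_nonneg_left (le_four_mul_rpow (norm_nonneg _) h5 hα hα1.le) hK0
    linarith
  have hu : HolderBound α (closedBall 0 1) u (4 * K) := by
    refine hlip u hB.3 fun x hx y hy => ?_
    rw [← Real.norm_eq_abs]
    exact (convex_ball 0 2).norm_image_sub_le_of_norm_hasFDerivWithin_le
      (fun z hz => (hB.1 z hz).hasFDerivWithinAt) hB.4 hy hx
  have hp : ∀ i : Fin n, HolderBound α (closedBall 0 1)
      (fun x => p x (EuclideanSpace.single i 1)) (4 * K) := by
    intro i
    have happ : ∀ q : EuclideanSpace ℝ (Fin n) →L[ℝ] ℝ,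
        |q (EuclideanSpace.single i 1)| ≤ ‖q‖ := fun q => by
      simpa using q.le_opNorm (EuclideanSpace.single i 1)
    refine hlip _ (fun x hx => (happ _).trans (hB.4 x hx)) fun x hx y hy => ?_
    have := (convex_ball 0 2).norm_image_sub_le_of_norm_hasFDerivWithin_le
      (fun z hz => (hB.2 z hz).hasFDerivWithinAt) hB.5 hy hx
    exact (happ (p x - p y)).trans this
  have hHij : ∀ i j : Fin n, HolderBound α (closedBall 0 1)
      (fun x => H x (EuclideanSpace.single i 1) (EuclideanSpace.single j 1)) (4 * K) := by
    intro i j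
    refine ⟨fun x hx => ((abs_apply_single_le _ i j).trans (hB.5 x (hsub hx))).trans
      (by linarith), fun x hx y hy => ?_⟩
    refine ((abs_apply_single_le (H x - H y) i j).trans (hH x (hsub hx) y (hsub hy))).trans ?_
    gcongr
    linarith
  have hK4 : 0 ≤ 4 * K := by positivity
  have htot := ((herr.mono le_rfl hsub).add
    ((HolderBound.sum Finset.univ fun i _ => HolderBound.sum Finset.univ fun j _ =>
      (hnear.second i j).mul (hHij i j) hδ0.le hK4).add
    ((HolderBound.sum Finset.univ fun i _ => (hnear.first i).mul (hp i) hδ0.le hK4).add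
    (hnear.zeroth.mul hu hδ0.le hK4)))).neg
  refine (htot.mono ?_ subset_rfl).congr fun x hx => ?_
  · simp only [Finset.sum_const, Finset.card_univ, Fintype.card_fin, nsmul_eq_mul]
    have h1 : δ * (64 * (C + 1) * (n * n + n + 1)) = 1 := inv_mul_cancel₀ hD0.ne'
    have h2 : δ * (64 * C * (n * n + n + 1)) ≤ 1 := by
      have : 0 ≤ δ * (64 * (n * n + n + 1)) := by positivity
      linarith
    have h3 := mul_le_mul_of_nonneg_right h2 hN
    rw [hK]
    nlinarith
  · rw [radialRetract_of_mem hx, jetForm, hessTrace_apply, hessTrace_apply]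
    simp only [sub_mul, Finset.sum_sub_distrib]
    ring

lemma exists_unit_ball_solution (hn : 0 < n) (A : Fin n → Fin n → ℝ) {lam : ℝ} (hlam : 0 < lam)
    (hA : ∀ ξ : EuclideanSpace ℝ (Fin n), lam * ‖ξ‖ ^ 2 ≤ ∑ i, ∑ j, A i j * ξ i * ξ j)
    {α : ℝ} (hα : 0 < α) (hα1 : α < 1) :
    ∃ C δ : ℝ, 0 ≤ C ∧ 0 < δ ∧ ∀ a b c, NearConstant α A a b c δ →
      ∀ (f : EuclideanSpace ℝ (Fin n) → ℝ) (N : ℝ), 0 ≤ N →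
      HolderBound α (closedBall 0 1) f N →
      ∃ (u : EuclideanSpace ℝ (Fin n) → ℝ) (p : _) (H : _),
        BoundedC2On (ball 0 2) u p H (C * N) ∧ ContinuousOn H (ball 0 2) ∧
        ∀ x ∈ closedBall 0 1,
          jetForm (fun i j => a i j x) (fun i => b i x) (c x) (u x) (p x) (H x) = f x := by
  obtain ⟨C, δ, hC, hδ, hstep⟩ := exists_improvement_step hn A hlam hA hα hα1
  refine ⟨2 * C, δ, by positivity, hδ, ?_⟩
  intro a b c hnear f N hN hf
  have hstep' := hstep a b c hnear
  choose! u p H hB hH hR using hstep'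
  set F : ℕ → EuclideanSpace ℝ (Fin n) → ℝ := fun k => Nat.rec f (fun k φ x => φ x -
    jetForm (fun i j => a i j x) (fun i => b i x) (c x) (u φ (N / 2 ^ k) x) (p φ (N / 2 ^ k) x)
      (H φ (N / 2 ^ k) x)) k with hF
  have hN' : ∀ k : ℕ, 0 ≤ N / 2 ^ k := fun k => by positivity
  have hFb : ∀ k, HolderBound α (closedBall 0 1) (F k) (N / 2 ^ k) := by
    intro k
    induction k with
    | zero => simpa [hF] using hf
    | succ k ih =>
      have := hR (F k) (N / 2 ^ k) (hN' k) ih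
      rw [div_div, ← pow_succ] at this
      exact this
  set U := fun k => u (F k) (N / 2 ^ k)
  set P := fun k => p (F k) (N / 2 ^ k)
  set G := fun k => H (F k) (N / 2 ^ k)
  have hK : HasSum (fun k : ℕ => C * (N / 2 ^ k)) (2 * C * N) := by
    have h1 : (fun k : ℕ => C * (N / 2 ^ k)) = fun k => C * N * (1 / 2) ^ k := by
      ext k
      rw [one_div, inv_pow]
      ring
    rw [show 2 * C * N = C * N * 2 by ring, h1]
    exact hasSum_geometric_two.mul_left (C * N)
  have hbd : ∀ k, BoundedC2On (ball 0 2) (U k) (P k) (G k) (C * (N / 2 ^ k)) := fun k =>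
    hB _ _ (hN' k) (hFb k)
  have hT := BoundedC2On.tsum isOpen_ball (convex_ball 0 2).isPreconnected hK.summable hbd
  rw [hK.tsum_eq] at hT
  refine ⟨_, _, _, hT, ?_, fun x hx => ?_⟩
  · refine continuousOn_tsum (fun k => ?_) hK.summable fun k x hx => (hbd k).norm_hessian_le x hx
    have hHk := hH _ _ (hN' k) (hFb k)
    intro x hx
    rw [ContinuousWithinAt, tendsto_iff_norm_sub_tendsto_zero]
    have h1 : Continuous fun y : EuclideanSpace ℝ (Fin n) => C * (N / 2 ^ k) * ‖y - x‖ ^ α :=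
      continuous_const.mul ((continuous_id.sub continuous_const).norm.rpow_const
        fun _ => Or.inr hα.le)
    have h2 := (h1.tendsto x).mono_left (nhdsWithin_le_nhds (s := ball 0 2))
    simp only [sub_self, norm_zero, Real.zero_rpow hα.ne', mul_zero] at h2
    exact squeeze_zero' (.of_forall fun _ => norm_nonneg _)
      (Filter.eventually_of_mem self_mem_nhdsWithin fun y hy => hHk y hy x hx) h2
  · have hx2 : x ∈ ball (0 : EuclideanSpace ℝ (Fin n)) 2 :=
      closedBall_subset_ball (by norm_num) hx
    have hsU : Summable fun k => U k x :=
      .of_norm_bounded hK.summable fun k => (hbd k).abs_le x hx2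
    have hsP : Summable fun k => P k x :=
      .of_norm_bounded hK.summable fun k => (hbd k).norm_fderiv_le x hx2
    have hsG : Summable fun k => G k x :=
      .of_norm_bounded hK.summable fun k => (hbd k).norm_hessian_le x hx2
    have hsum : HasSum (fun k => jetForm (fun i j => a i j x) (fun i => b i x) (c x)
        (U k x) (P k x) (G k x)) (jetForm (fun i j => a i j x) (fun i => b i x) (c x)
        (∑' k, U k x) (∑' k, P k x) (∑' k, G k x)) := by
      refine ((hsG.hasSum.mapL (hessTrace fun i j => a i j x)).add (hasSum_sum fun i _ => ?_)).add
        (hsU.hasSum.mul_left (c x))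
      exact (hsP.hasSum.mapL
        (ContinuousLinearMap.apply ℝ ℝ (EuclideanSpace.single i (1 : ℝ)))).mul_left (b i x)
    have htel : ∀ k, jetForm (fun i j => a i j x) (fun i => b i x) (c x)
        (U k x) (P k x) (G k x) = F k x - F (k + 1) x := fun k => by
      simp only [hF, U, P, G]
      ring
    have h2 := hsum.tendsto_sum_nat
    simp only [htel, Finset.sum_range_sub' (fun k => F k x)] at h2
    have h3 : Filter.Tendsto (fun k => F k x) Filter.atTop (𝓝 0) := by
      refine squeeze_zero_norm (fun k => (hFb k).abs_le x hx) ?_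
      have := (tendsto_pow_atTop_nhds_zero_of_lt_one (by norm_num : (0 : ℝ) ≤ 1 / 2)
        (by norm_num)).const_mul N
      simpa [div_eq_mul_inv] using this
    have h4 := h3.const_sub (F 0 x)
    rw [sub_zero] at h4
    exact tendsto_nhds_unique h2 h4

end UnitBall

section Jets

set_option maxSynthPendingDepth 3

variable {n : ℕ}

/-- `u` is twice differentiable on `s` with first and second derivatives `p` and `H`. -/
structure HasJetOn (s : Set (EuclideanSpace ℝ (Fin n))) (u : EuclideanSpace ℝ (Fin n) → ℝ)
    (p : EuclideanSpace ℝ (Fin n) → EuclideanSpace ℝ (Fin n) →L[ℝ] ℝ)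
    (H : EuclideanSpace ℝ (Fin n) →
      EuclideanSpace ℝ (Fin n) →L[ℝ] EuclideanSpace ℝ (Fin n) →L[ℝ] ℝ) : Prop where
  hasFDerivAt : ∀ x ∈ s, HasFDerivAt u (p x) x
  hasFDerivAt_fderiv : ∀ x ∈ s, HasFDerivAt p (H x) x

lemma ContDiffOn.hasJetOn {s : Set (EuclideanSpace ℝ (Fin n))}
    {u : EuclideanSpace ℝ (Fin n) → ℝ} (hs : IsOpen s) (h : ContDiffOn ℝ 2 u s) :
    HasJetOn s u (fderiv ℝ u) (fderiv ℝ (fderiv ℝ u)) := by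
  have h2 : ContDiffOn ℝ (1 + 1) u s := by
    rwa [one_add_one_eq_two]
  rw [contDiffOn_succ_iff_fderiv_of_isOpen hs] at h2
  exact ⟨fun x hx => (h2.1.differentiableAt (hs.mem_nhds hx)).hasFDerivAt,
    fun x hx => ((h2.2.2.differentiableOn one_ne_zero).differentiableAt
      (hs.mem_nhds hx)).hasFDerivAt⟩

namespace HasJetOn

variable {s t : Set (EuclideanSpace ℝ (Fin n))} {u v : EuclideanSpace ℝ (Fin n) → ℝ}
  {p q : EuclideanSpace ℝ (Fin n) → EuclideanSpace ℝ (Fin n) →L[ℝ] ℝ}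
  {H G : EuclideanSpace ℝ (Fin n) →
    EuclideanSpace ℝ (Fin n) →L[ℝ] EuclideanSpace ℝ (Fin n) →L[ℝ] ℝ}

lemma mono (h : HasJetOn s u p H) (hts : t ⊆ s) : HasJetOn t u p H :=
  ⟨fun x hx => h.1 x (hts hx), fun x hx => h.2 x (hts hx)⟩

lemma add (h : HasJetOn s u p H) (h' : HasJetOn s v q G) :
    HasJetOn s (fun x => u x + v x) (fun x => p x + q x) (fun x => H x + G x) :=
  ⟨fun x hx => (h.1 x hx).add (h'.1 x hx), fun x hx => (h.2 x hx).add (h'.2 x hx)⟩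

lemma sub (h : HasJetOn s u p H) (h' : HasJetOn s v q G) :
    HasJetOn s (fun x => u x - v x) (fun x => p x - q x) (fun x => H x - G x) :=
  ⟨fun x hx => (h.1 x hx).sub (h'.1 x hx), fun x hx => (h.2 x hx).sub (h'.2 x hx)⟩

lemma const_smul (h : HasJetOn s u p H) (k : ℝ) :
    HasJetOn s (fun x => k • u x) (fun x => k • p x) (fun x => k • H x) :=
  ⟨fun x hx => (h.1 x hx).const_smul k, fun x hx => (h.2 x hx).const_smul k⟩

lemma add_const (h : HasJetOn s u p H) (k : ℝ) : HasJetOn s (fun x => u x + k) p H :=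
  ⟨fun x hx => (h.1 x hx).add_const k, h.2⟩

lemma continuousOn (h : HasJetOn s u p H) : ContinuousOn u s :=
  fun x hx => (h.1 x hx).continuousAt.continuousWithinAt

lemma contDiffOn (h : HasJetOn s u p H) (hs : IsOpen s) (hH : ContinuousOn H s) :
    ContDiffOn ℝ 2 u s := by
  have h0 : ContDiffOn ℝ (0 + 1) p s :=
    (contDiffOn_succ_iff_hasFDerivWithinAt_of_uniqueDiffOn hs.uniqueDiffOn).2
      ⟨by simp, H, contDiffOn_zero.2 hH, fun x hx => (h.2 x hx).hasFDerivWithinAt⟩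
  have h1 : ContDiffOn ℝ (1 + 1) u s :=
    (contDiffOn_succ_iff_hasFDerivWithinAt_of_uniqueDiffOn hs.uniqueDiffOn).2
      ⟨by simp, p, by simpa using h0, fun x hx => (h.1 x hx).hasFDerivWithinAt⟩
  rwa [one_add_one_eq_two] at h1

lemma lopW_eq (h : HasJetOn s u p H) (hs : IsOpen s)
    (a : Fin n → Fin n → EuclideanSpace ℝ (Fin n) → ℝ)
    (b : Fin n → EuclideanSpace ℝ (Fin n) → ℝ) (c : EuclideanSpace ℝ (Fin n) → ℝ)
    {x : EuclideanSpace ℝ (Fin n)} (hx : x ∈ s) :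
    LopW s a b c u x =
      jetForm (fun i j => a i j x) (fun i => b i x) (c x) (u x) (p x) (H x) := by
  have h1 : ∀ j, ∀ z ∈ s, pdW s j u z = p z (EuclideanSpace.single j 1) := by
    intro j z hz
    rw [pdW, fderivWithin_of_isOpen hs hz, (h.1 z hz).fderiv]
  have h2 : ∀ i j, pdW s i (pdW s j u) x =
      H x (EuclideanSpace.single i 1) (EuclideanSpace.single j 1) := by
    intro i j
    have h3 : HasFDerivAt (fun z => p z (EuclideanSpace.single j (1 : ℝ)))
        ((ContinuousLinearMap.apply ℝ ℝ (EuclideanSpace.single j (1 : ℝ))).comp (H x)) x :=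
      (ContinuousLinearMap.apply ℝ ℝ (EuclideanSpace.single j (1 : ℝ))).hasFDerivAt.comp x
        (h.2 x hx)
    have h4 : pdW s j u =ᶠ[𝓝 x] fun z => p z (EuclideanSpace.single j (1 : ℝ)) :=
      Filter.eventually_of_mem (hs.mem_nhds hx) (h1 j)
    rw [pdW, fderivWithin_of_isOpen hs hx, h4.fderiv_eq, h3.fderiv]
    rfl
  simp only [LopW, jetForm, hessTrace_apply, h2, h1 _ x hx]

end HasJetOn

lemma jetForm_add (A : Fin n → Fin n → ℝ) (β : Fin n → ℝ) (γ t t' : ℝ)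
    (q q' : EuclideanSpace ℝ (Fin n) →L[ℝ] ℝ)
    (H H' : EuclideanSpace ℝ (Fin n) →L[ℝ] EuclideanSpace ℝ (Fin n) →L[ℝ] ℝ) :
    jetForm A β γ (t + t') (q + q') (H + H') = jetForm A β γ t q H + jetForm A β γ t' q' H' := by
  simp only [jetForm, map_add, add_apply, mul_add, Finset.sum_add_distrib]
  ring

lemma jetForm_smul (A : Fin n → Fin n → ℝ) (β : Fin n → ℝ) (γ k t : ℝ)
    (q : EuclideanSpace ℝ (Fin n) →L[ℝ] ℝ)
    (H : EuclideanSpace ℝ (Fin n) →L[ℝ] EuclideanSpace ℝ (Fin n) →L[ℝ] ℝ) :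
    jetForm A β γ (k • t) (k • q) (k • H) = k * jetForm A β γ t q H := by
  simp only [jetForm, map_smul, smul_apply, smul_eq_mul, mul_add, Finset.mul_sum]
  congr 1
  · congr 1
    exact Finset.sum_congr rfl fun i _ => by ring
  · ring

lemma jetForm_sub (A : Fin n → Fin n → ℝ) (β : Fin n → ℝ) (γ t t' : ℝ)
    (q q' : EuclideanSpace ℝ (Fin n) →L[ℝ] ℝ)
    (H H' : EuclideanSpace ℝ (Fin n) →L[ℝ] EuclideanSpace ℝ (Fin n) →L[ℝ] ℝ) :
    jetForm A β γ (t - t') (q - q') (H - H') = jetForm A β γ t q H - jetForm A β γ t' q' H' := by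
  simp only [jetForm, map_sub, sub_apply, mul_sub, Finset.sum_sub_distrib]
  ring

end Jets

section SmallBall

set_option maxSynthPendingDepth 3

variable {n : ℕ}

lemma exists_small_ball_solution (hn : 0 < n) {α : ℝ} (hα : 0 < α) (hα1 : α < 1)
    {a : Fin n → Fin n → EuclideanSpace ℝ (Fin n) → ℝ}
    {b : Fin n → EuclideanSpace ℝ (Fin n) → ℝ} {c : EuclideanSpace ℝ (Fin n) → ℝ}
    {y : EuclideanSpace ℝ (Fin n)} {R K lam : ℝ} (hR : 0 < R) (hK : 0 ≤ K) (hlam : 0 < lam)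
    (ha : ∀ i j, HolderBound α (closedBall y R) (a i j) K)
    (hb : ∀ i, HolderBound α (closedBall y R) (b i) K) (hc : HolderBound α (closedBall y R) c K)
    (hell : ∀ ξ : EuclideanSpace ℝ (Fin n), lam * ‖ξ‖ ^ 2 ≤ ∑ i, ∑ j, a i j y * ξ i * ξ j) :
    ∃ C r₀ : ℝ, 0 ≤ C ∧ 0 < r₀ ∧ ∀ r, 0 < r → r ≤ r₀ →
      ∀ (f : EuclideanSpace ℝ (Fin n) → ℝ) (m M : ℝ), 0 ≤ m → 0 ≤ M →
      (∀ x ∈ closedBall y r, |f x| ≤ m) →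
      (∀ x ∈ closedBall y r, ∀ z ∈ closedBall y r, |f x - f z| ≤ M * ‖x - z‖ ^ α) →
      ∃ (u : EuclideanSpace ℝ (Fin n) → ℝ) (p : _) (H : _),
        HasJetOn (ball y (2 * r)) u p H ∧ ContinuousOn H (ball y (2 * r)) ∧
        (∀ x ∈ ball y (2 * r), |u x| ≤ C * (m + r ^ α * M) * r ^ 2) ∧
        ∀ x ∈ closedBall y r,
          jetForm (fun i j => a i j x) (fun i => b i x) (c x) (u x) (p x) (H x) = f x := by
  obtain ⟨C, δ, hC, hδ, hsolve⟩ :=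
    exists_unit_ball_solution hn (fun i j => a i j y) hlam hell hα hα1
  set ε : ℝ := δ / (K + 1) with hε
  have hε0 : 0 < ε := by positivity
  refine ⟨C, min (min R 1) (ε ^ α⁻¹), hC, by positivity, ?_⟩
  intro r hr hr₀ f m M hm hM hfm hfM
  have hrR : r ≤ R := hr₀.trans ((min_le_left _ _).trans (min_le_left _ _))
  have hr1 : r ≤ 1 := hr₀.trans ((min_le_left _ _).trans (min_le_right _ _))
  have hrα : r ^ α ≤ ε := by
    have := Real.rpow_le_rpow hr.le (hr₀.trans (min_le_right _ _)) hα.le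
    rwa [← Real.rpow_mul hε0.le, inv_mul_cancel₀ hα.ne', Real.rpow_one] at this
  have hrα0 : 0 < r ^ α := by positivity
  have hrr : r ≤ r ^ α := by
    conv_lhs => rw [← Real.rpow_one r]
    exact Real.rpow_le_rpow_of_exponent_ge hr hr1 hα1.le
  have hrα1 : r ^ α ≤ 1 := Real.rpow_le_one hr.le hr1 hα.le
  have hKδ : K * r ^ α ≤ δ := by
    have h1 : (K + 1) * r ^ α ≤ δ := by
      have := mul_le_mul_of_nonneg_left hrα (by positivity : 0 ≤ K + 1)
      rwa [hε, mul_div_cancel₀ _ (by positivity)] at this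
    linarith
  have hmem : ∀ x ∈ closedBall (0 : EuclideanSpace ℝ (Fin n)) 1, y + r • x ∈ closedBall y r := by
    intro x hx
    rw [mem_closedBall_zero_iff] at hx
    rw [mem_closedBall, dist_eq_norm, add_sub_cancel_left, norm_smul, Real.norm_of_nonneg hr.le]
    exact mul_le_of_le_one_right hr.le hx
  have hmemR : ∀ x ∈ closedBall (0 : EuclideanSpace ℝ (Fin n)) 1, y + r • x ∈ closedBall y R :=
    fun x hx => closedBall_subset_closedBall hrR (hmem x hx)
  have hdist : ∀ x z : EuclideanSpace ℝ (Fin n), ‖(y + r • x) - (y + r • z)‖ ^ α =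
      r ^ α * ‖x - z‖ ^ α := by
    intro x z
    rw [add_sub_add_left_eq_sub, ← smul_sub, norm_smul, Real.norm_of_nonneg hr.le,
      Real.mul_rpow hr.le (norm_nonneg _)]
  have hlow : ∀ (g : EuclideanSpace ℝ (Fin n) → ℝ) (k : ℝ), 0 ≤ k → k ≤ r ^ α →
      HolderBound α (closedBall y R) g K →
      HolderBound α (closedBall 0 1) (fun x => k * g (y + r • x)) δ := by
    intro g k hk0 hk hg
    refine ⟨fun x hx => ?_, fun x hx z hz => ?_⟩
    · rw [abs_mul, abs_of_nonneg hk0]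
      have := mul_le_mul hk (hg.1 _ (hmemR x hx)) (abs_nonneg _) hrα0.le
      linarith
    · rw [← mul_sub, abs_mul, abs_of_nonneg hk0]
      have h1 := hg.2 _ (hmemR x hx) _ (hmemR z hz)
      rw [hdist] at h1
      have h2 := mul_le_mul (hk.trans hrα1) h1 (abs_nonneg _) zero_le_one
      have h3 : K * r ^ α * ‖x - z‖ ^ α ≤ δ * ‖x - z‖ ^ α := by gcongr
      linarith
  have hnear : NearConstant α (fun i j => a i j y) (fun i j x => a i j (y + r • x))
      (fun i x => r * b i (y + r • x)) (fun x => r ^ 2 * c (y + r • x)) δ := by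
    refine ⟨fun i j => ⟨fun x hx => ?_, fun x hx z hz => ?_⟩, fun i => hlow _ _ hr.le hrr (hb i),
      hlow _ _ (by positivity) (by nlinarith) hc⟩
    · have h1 := (ha i j).2 _ (hmemR x hx) y (mem_closedBall_self hR.le)
      rw [mem_closedBall_zero_iff] at hx
      rw [add_sub_cancel_left, norm_smul, Real.norm_of_nonneg hr.le] at h1
      have h2 : (r * ‖x‖) ^ α ≤ r ^ α :=
        Real.rpow_le_rpow (by positivity) (mul_le_of_le_one_right hr.le hx) hα.le
      exact h1.trans ((mul_le_mul_of_nonneg_left h2 hK).trans hKδ)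
    · rw [sub_sub_sub_cancel_right]
      refine ((ha i j).2 _ (hmemR x hx) _ (hmemR z hz)).trans ?_
      rw [hdist, ← mul_assoc]
      gcongr
  obtain ⟨u, p, H, hB, hH, heq⟩ := hsolve _ _ _ hnear (fun x => f (y + r • x)) (m + r ^ α * M)
    (by positivity) ⟨fun x hx => (hfm _ (hmem x hx)).trans (le_add_of_nonneg_right (by positivity)),
      fun x hx z hz => by
        refine (hfM _ (hmem x hx) _ (hmem z hz)).trans ?_
        rw [hdist, ← mul_assoc]
        gcongr
        linarith⟩
  have hmem2 : ∀ x ∈ ball y (2 * r), r⁻¹ • (x - y) ∈ ball (0 : EuclideanSpace ℝ (Fin n)) 2 := by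
    intro x hx
    rw [mem_ball, dist_eq_norm] at hx
    rw [mem_ball_zero_iff, norm_smul, Real.norm_of_nonneg (by positivity), inv_mul_lt_iff₀ hr]
    linarith
  refine ⟨fun x => r ^ 2 • u (r⁻¹ • (x - y)), fun x => r • p (r⁻¹ • (x - y)),
    fun x => H (r⁻¹ • (x - y)), ⟨fun x hx => ?_, fun x hx => ?_⟩, ?_, fun x hx => ?_,
    fun x hx => ?_⟩
  · refine ((hasFDerivAt_comp_sub (f := fun x => r ^ 2 • u (r⁻¹ • x)) y).2
      ((hB.1 _ (hmem2 x hx)).const_smul_comp_smul (r ^ 2))).congr_fderiv ?_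
    congr 1
    field_simp
  · refine ((hasFDerivAt_comp_sub (f := fun x => r • p (r⁻¹ • x)) y).2
      ((hB.2 _ (hmem2 x hx)).const_smul_comp_smul r)).congr_fderiv ?_
    rw [mul_inv_cancel₀ hr.ne', one_smul]
  · exact hH.comp (by fun_prop) hmem2
  · dsimp only
    rw [smul_eq_mul, abs_mul, abs_of_pos (by positivity : 0 < r ^ 2), mul_comm]
    exact mul_le_mul_of_nonneg_right (hB.3 _ (hmem2 x hx)) (by positivity)
  · have hx1 : r⁻¹ • (x - y) ∈ closedBall (0 : EuclideanSpace ℝ (Fin n)) 1 := by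
      rw [mem_closedBall, dist_eq_norm] at hx
      rw [mem_closedBall_zero_iff, norm_smul, Real.norm_of_nonneg (by positivity),
        inv_mul_le_iff₀ hr]
      linarith
    have h1 := heq _ hx1
    rw [smul_inv_smul₀ hr.ne', add_sub_cancel] at h1
    rw [← h1]
    simp only [jetForm, smul_apply, smul_eq_mul]
    congr 1
    · congr 1
      exact Finset.sum_congr rfl fun i _ => by ring
    · ring

end SmallBall

section Touching

set_option maxSynthPendingDepth 3

variable {n : ℕ}

lemma hasJetOn_quadratic (s : Set (EuclideanSpace ℝ (Fin n))) (y : EuclideanSpace ℝ (Fin n))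
    (t : ℝ) (P : EuclideanSpace ℝ (Fin n) →L[ℝ] ℝ)
    {G : EuclideanSpace ℝ (Fin n) →L[ℝ] EuclideanSpace ℝ (Fin n) →L[ℝ] ℝ}
    (hG : ∀ v w, G v w = G w v) :
    HasJetOn s (fun x => t + P (x - y) + 1 / 2 * G (x - y) (x - y))
      (fun x => P + G (x - y)) (fun _ => G) := by
  have hsub : ∀ x, HasFDerivAt (fun x : EuclideanSpace ℝ (Fin n) => x - y)
      (ContinuousLinearMap.id ℝ _) x := fun x => (hasFDerivAt_id x).sub_const y
  refine ⟨fun x _ => ?_, fun x _ => ?_⟩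
  · have h1 : HasFDerivAt (fun x => P (x - y)) P x :=
      (hasFDerivAt_comp_sub (f := P) y).2 P.hasFDerivAt
    have h2 : HasFDerivAt (fun x => G (x - y)) G x :=
      (hasFDerivAt_comp_sub (f := G) y).2 G.hasFDerivAt
    refine ((h1.const_add t).add ((h2.clm_apply (hsub x)).const_mul (1 / 2))).congr_fderiv ?_
    ext v
    simp [hG v x, hG v y]
    ring
  · have h2 : HasFDerivAt (fun x => G (x - y)) G x :=
      (hasFDerivAt_comp_sub (f := G) y).2 G.hasFDerivAt
    exact h2.const_add P

lemma HasJetOn.symmetric {s : Set (EuclideanSpace ℝ (Fin n))} {u : EuclideanSpace ℝ (Fin n) → ℝ}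
    {p : EuclideanSpace ℝ (Fin n) → EuclideanSpace ℝ (Fin n) →L[ℝ] ℝ}
    {H : EuclideanSpace ℝ (Fin n) →
      EuclideanSpace ℝ (Fin n) →L[ℝ] EuclideanSpace ℝ (Fin n) →L[ℝ] ℝ}
    (h : HasJetOn s u p H) (hs : IsOpen s) {x : EuclideanSpace ℝ (Fin n)} (hx : x ∈ s)
    (v w : EuclideanSpace ℝ (Fin n)) : H x v w = H x w v :=
  second_derivative_symmetric_of_eventually
    (Filter.eventually_of_mem (hs.mem_nhds hx) h.1) (h.2 x hx) v w

lemma HasJetOn.eventually_abs_taylor_le {s : Set (EuclideanSpace ℝ (Fin n))}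
    {u : EuclideanSpace ℝ (Fin n) → ℝ}
    {p : EuclideanSpace ℝ (Fin n) → EuclideanSpace ℝ (Fin n) →L[ℝ] ℝ}
    {H : EuclideanSpace ℝ (Fin n) →
      EuclideanSpace ℝ (Fin n) →L[ℝ] EuclideanSpace ℝ (Fin n) →L[ℝ] ℝ}
    (h : HasJetOn s u p H) (hs : IsOpen s) {y : EuclideanSpace ℝ (Fin n)} (hy : y ∈ s)
    {η : ℝ} (hη : 0 < η) :
    ∀ᶠ x in 𝓝 y, |u x - (u y + p y (x - y) + 1 / 2 * H y (x - y) (x - y))| ≤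
      η * ‖x - y‖ ^ 2 := by
  have hjet := h.sub (hasJetOn_quadratic s y (u y) (p y) (h.symmetric hs hy))
  have hlit := (hasFDerivAt_iff_isLittleO.1 (h.2 y hy)).def hη
  obtain ⟨r, hr, hball⟩ := Metric.eventually_nhds_iff_ball.1 (hlit.and (hs.mem_nhds hy))
  refine Metric.eventually_nhds_iff_ball.2 ⟨r, hr, fun x hx => ?_⟩
  set d := ‖x - y‖ with hd
  have hxd : x ∈ closedBall y d := by rw [mem_closedBall, dist_eq_norm]
  have hsub : closedBall y d ⊆ ball y r :=
    closedBall_subset_ball (by rwa [mem_ball, dist_eq_norm] at hx)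
  have h1 := (convex_closedBall y d).norm_image_sub_le_of_norm_hasFDerivWithin_le (C := η * d)
    (fun z hz => (hjet.1 z (hball z (hsub hz)).2).hasFDerivWithinAt)
    (fun z hz => by
      have h2 := (hball z (hsub hz)).1
      rw [← sub_sub]
      refine h2.trans ?_
      rw [mem_closedBall, dist_eq_norm] at hz
      gcongr) (mem_closedBall_self (norm_nonneg _)) hxd
  simp only [sub_self, map_zero, mul_zero, add_zero, sub_zero, Real.norm_eq_abs] at h1
  rw [← hd] at h1
  linarith

lemma HasJetOn.exists_holderBound {y : EuclideanSpace ℝ (Fin n)} {R α : ℝ} (hR2 : R ≤ 2)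
    (hα : 0 < α) (hα1 : α ≤ 1) {u : EuclideanSpace ℝ (Fin n) → ℝ}
    {p : EuclideanSpace ℝ (Fin n) → EuclideanSpace ℝ (Fin n) →L[ℝ] ℝ}
    (hu : ∀ x, HasFDerivAt u (p x) x) (hp : Continuous p) :
    ∃ N, 0 ≤ N ∧ HolderBound α (closedBall y R) u N := by
  have huc : Continuous u := continuous_iff_continuousAt.2 fun x => (hu x).continuousAt
  obtain ⟨N₁, hN₁⟩ := (isCompact_closedBall y R).exists_bound_of_continuousOn huc.continuousOn
  obtain ⟨N₂, hN₂⟩ := (isCompact_closedBall y R).exists_bound_of_continuousOn hp.continuousOn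
  set N := max (max N₁ N₂) 0
  have hN0 : 0 ≤ N := le_max_right _ _
  have hN1 : N₁ ≤ N := (le_max_left _ _).trans (le_max_left _ _)
  have hN2 : N₂ ≤ N := (le_max_right _ _).trans (le_max_left _ _)
  refine ⟨4 * N, by positivity, fun x hx => ?_, fun x hx z hz => ?_⟩
  · have := hN₁ x hx
    rw [Real.norm_eq_abs] at this
    linarith
  · have h1 := (convex_closedBall y R).norm_image_sub_le_of_norm_hasFDerivWithin_le
      (fun w _ => (hu w).hasFDerivWithinAt) (fun w hw => (hN₂ w hw).trans hN2) hz hx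
    rw [Real.norm_eq_abs] at h1
    have hd : ‖x - z‖ ≤ 4 := by
      rw [← dist_eq_norm]
      have := dist_triangle_right x z y
      rw [mem_closedBall] at hx hz
      linarith
    have h2 := mul_le_mul_of_nonneg_left (le_four_mul_rpow (norm_nonneg _) hd hα hα1) hN0
    linarith

lemma eventually_exists_touching_solution (hn : 0 < n) {α : ℝ} (hα : 0 < α) (hα1 : α < 1)
    {a : Fin n → Fin n → EuclideanSpace ℝ (Fin n) → ℝ}
    {b : Fin n → EuclideanSpace ℝ (Fin n) → ℝ} {c f : EuclideanSpace ℝ (Fin n) → ℝ}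
    {y : EuclideanSpace ℝ (Fin n)} {R K lam : ℝ} (hR : 0 < R) (hR2 : R ≤ 2) (hK : 0 ≤ K)
    (hlam : 0 < lam)
    (ha : ∀ i j, HolderBound α (closedBall y R) (a i j) K)
    (hb : ∀ i, HolderBound α (closedBall y R) (b i) K) (hc : HolderBound α (closedBall y R) c K)
    (hf : HolderBound α (closedBall y R) f K)
    (hell : ∀ ξ : EuclideanSpace ℝ (Fin n), lam * ‖ξ‖ ^ 2 ≤ ∑ i, ∑ j, a i j y * ξ i * ξ j)
    {s : Set (EuclideanSpace ℝ (Fin n))} (hs : IsOpen s) (hys : y ∈ s)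
    {W : EuclideanSpace ℝ (Fin n) → ℝ}
    {p : EuclideanSpace ℝ (Fin n) → EuclideanSpace ℝ (Fin n) →L[ℝ] ℝ}
    {H : EuclideanSpace ℝ (Fin n) →
      EuclideanSpace ℝ (Fin n) →L[ℝ] EuclideanSpace ℝ (Fin n) →L[ℝ] ℝ}
    (hW : HasJetOn s W p H)
    (hlt : jetForm (fun i j => a i j y) (fun i => b i y) (c y) (W y) (p y) (H y) < f y) :
    ∀ᶠ r in 𝓝[>] (0 : ℝ), ∃ v : EuclideanSpace ℝ (Fin n) → ℝ,
      ContDiffOn ℝ 2 v (ball y r) ∧ ContinuousOn v (closedBall y r) ∧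
      (∀ x ∈ ball y r, LopW (ball y r) a b c v x = f x) ∧ (∀ x ∈ sphere y r, W x ≤ v x) ∧
      v y < W y := by
  set τ := f y - jetForm (fun i j => a i j y) (fun i => b i y) (c y) (W y) (p y) (H y) with hτ
  have hτ0 : 0 < τ := sub_pos.2 hlt
  set tr := ∑ i, a i i y with htr
  have htr0 : 0 < tr := sum_diag_pos hn hlam hell
  set κ := τ / tr with hκ
  have hκ0 : 0 < κ := div_pos hτ0 htr0
  set G := H y + κ • innerForm n with hG
  have hGs : ∀ v w, G v w = G w v := fun v w => by
    simp [hG, hW.symmetric hs hys v w, innerForm_apply, real_inner_comm]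
  set q : EuclideanSpace ℝ (Fin n) → ℝ :=
    fun x => W y + p y (x - y) + 1 / 2 * G (x - y) (x - y) with hq
  have hjq : ∀ s, HasJetOn s q (fun x => p y + G (x - y)) fun _ => G := fun s =>
    hasJetOn_quadratic s y (W y) (p y) hGs
  have hGc : Continuous fun x => p y + G (x - y) := by fun_prop
  obtain ⟨N₀, hN₀, hqN⟩ := HasJetOn.exists_holderBound (y := y) hR2 hα hα1.le
    (fun x => (hjq univ).1 x (mem_univ x)) hGc
  have hpart : ∀ i : Fin n, ∃ N, 0 ≤ N ∧ HolderBound α (closedBall y R)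
      (fun x => (p y + G (x - y)) (EuclideanSpace.single i 1)) N := by
    intro i
    refine HasJetOn.exists_holderBound (y := y) hR2 hα hα1.le
      (p := fun _ => (ContinuousLinearMap.apply ℝ ℝ (EuclideanSpace.single i (1 : ℝ))).comp G)
      (fun x => ?_) continuous_const
    exact (ContinuousLinearMap.apply ℝ ℝ (EuclideanSpace.single i (1 : ℝ))).hasFDerivAt.comp x
      ((hjq univ).2 x (mem_univ x))
  choose N₁ hN₁ hqN₁ using hpart
  have hconst : ∀ k : ℝ, HolderBound α (closedBall y R) (fun _ => k) |k| := fun k =>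
    ⟨fun _ _ => le_rfl, fun _ _ _ _ => by
      rw [sub_self, abs_zero]
      positivity⟩
  set L : EuclideanSpace ℝ (Fin n) → ℝ := fun x =>
    jetForm (fun i j => a i j x) (fun i => b i x) (c x) (q x) (p y + G (x - y)) G with hL
  obtain ⟨N, hN, hLN⟩ : ∃ N, 0 ≤ N ∧ HolderBound α (closedBall y R) (fun x => f x + -L x) N := by
    have h1 := hf.add (((HolderBound.sum Finset.univ fun i _ =>
      HolderBound.sum Finset.univ fun j _ => (ha i j).mul
        (hconst (G (EuclideanSpace.single i 1) (EuclideanSpace.single j 1))) hK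
        (abs_nonneg _)).add
      (HolderBound.sum Finset.univ fun i _ => (hb i).mul (hqN₁ i) hK (hN₁ i))).add
      (hc.mul hqN hK hN₀)).neg
    exact ⟨_, (abs_nonneg _).trans (h1.1 y (mem_closedBall_self hR.le)), h1⟩
  have hqy : q y = W y := by simp [hq]
  have hLy : f y + -L y = 0 := by
    simp only [hL, hqy, sub_self, map_zero, add_zero]
    have h1 : jetForm (fun i j => a i j y) (fun i => b i y) (c y) (W y) (p y) G =
        jetForm (fun i j => a i j y) (fun i => b i y) (c y) (W y) (p y) (H y) + κ * tr := by
      simp only [jetForm, hG, map_add, map_smul, hessTrace_innerForm, smul_eq_mul]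
      ring
    rw [h1, hκ, div_mul_cancel₀ _ htr0.ne', hτ]
    ring
  obtain ⟨C, r₀, hC, hr₀, hsolve⟩ := exists_small_ball_solution hn hα hα1 hR hK hlam ha hb hc hell
  have hsmall : Filter.Tendsto (fun r : ℝ => C * (K * (κ / 4 * r ^ 2) + 2 * ((N + K) * r ^ α)))
      (𝓝[>] 0) (𝓝 0) := by
    have h1 : Continuous fun r : ℝ => C * (K * (κ / 4 * r ^ 2) + 2 * ((N + K) * r ^ α)) := by
      have := Real.continuous_rpow_const hα.le
      fun_prop
    have h2 := h1.tendsto 0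
    simp only [Real.zero_rpow hα.ne'] at h2
    norm_num at h2
    exact h2.mono_left nhdsWithin_le_nhds
  have hquad : Filter.Tendsto (fun r : ℝ => κ / 4 * r ^ 2) (𝓝[>] 0) (𝓝 0) := by
    have h1 : Continuous fun r : ℝ => κ / 4 * r ^ 2 := by fun_prop
    have h2 := h1.tendsto 0
    norm_num at h2
    exact h2.mono_left nhdsWithin_le_nhds
  obtain ⟨ρ, hρ, htaylor⟩ := Metric.eventually_nhds_iff_ball.1
    (hW.eventually_abs_taylor_le hs hys (by positivity : 0 < κ / 8))
  filter_upwards [hsmall.eventually_lt_const (by positivity : 0 < κ / 8),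
    hquad.eventually_lt_const one_pos, Ioo_mem_nhdsGT (lt_min (lt_min hr₀ hρ) hR)] with r h1 h2 h3
  have hr : 0 < r := h3.1
  have hrr₀ : r < r₀ := h3.2.trans_le ((min_le_left _ _).trans (min_le_left _ _))
  have hrρ : r < ρ := h3.2.trans_le ((min_le_left _ _).trans (min_le_right _ _))
  have hrR : r < R := h3.2.trans_le (min_le_right _ _)
  have hsubR : closedBall y r ⊆ closedBall y R := closedBall_subset_closedBall hrR.le
  have hrα : 0 < r ^ α := by positivity
  set σ := κ / 4 * r ^ 2 with hσ
  have hσ0 : 0 < σ := by positivity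
  have hcs : HolderBound α (closedBall y R) (fun x => f x + -L x + σ * c x) (N + K) := by
    refine hLN.add ⟨fun x hx => ?_, fun x hx z hz => ?_⟩
    · rw [abs_mul, abs_of_pos hσ0]
      have := mul_le_mul h2.le (hc.1 x hx) (abs_nonneg _) zero_le_one
      linarith
    · rw [← mul_sub, abs_mul, abs_of_pos hσ0]
      have := mul_le_mul h2.le (hc.2 x hx z hz) (abs_nonneg _) zero_le_one
      linarith
  obtain ⟨ζ, pζ, Hζ, hζ, hHζ, hζb, hζL⟩ := hsolve r hr hrr₀.le (fun x => f x + -L x + σ * c x)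
    (K * σ + (N + K) * r ^ α) (N + K) (by positivity) (by positivity) (fun x hx => by
      have h4 := hcs.2 x (hsubR hx) y (mem_closedBall_self hR.le)
      rw [mem_closedBall, dist_eq_norm] at hx
      have h5 : ‖x - y‖ ^ α ≤ r ^ α := Real.rpow_le_rpow (norm_nonneg _) hx hα.le
      have h6 : |σ * c y| ≤ K * σ := by
        rw [abs_mul, abs_of_pos hσ0, mul_comm]
        exact mul_le_mul_of_nonneg_right (hc.1 y (mem_closedBall_self hR.le)) hσ0.le
      rw [hLy, zero_add] at h4
      have h7 := (abs_sub_abs_le_abs_sub (f x + -L x + σ * c x) (σ * c y)).trans h4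
      have h8 := mul_le_mul_of_nonneg_left h5 (by positivity : 0 ≤ N + K)
      linarith) (fun x hx z hz => hcs.2 x (hsubR hx) z (hsubR hz))
  have hζ8 : ∀ x ∈ closedBall y r, |ζ x| ≤ κ / 8 * r ^ 2 := by
    intro x hx
    refine (hζb x (closedBall_subset_ball (by linarith) hx)).trans ?_
    refine mul_le_mul_of_nonneg_right (le_trans (le_of_eq ?_) h1.le) (by positivity)
    ring
  have hjet : HasJetOn (ball y (2 * r)) (fun x => q x + ζ x + -σ)
      (fun x => p y + G (x - y) + pζ x) (fun x => G + Hζ x) :=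
    ((hjq _).add hζ).add_const (-σ)
  refine ⟨fun x => q x + ζ x + -σ, ?_, ?_, fun x hx => ?_, fun x hx => ?_, ?_⟩
  · exact (hjet.contDiffOn isOpen_ball (continuousOn_const.add hHζ)).mono
      (ball_subset_ball (by linarith))
  · exact hjet.continuousOn.mono (closedBall_subset_ball (by linarith))
  · rw [(hjet.mono (ball_subset_ball (by linarith : r ≤ 2 * r))).lopW_eq isOpen_ball a b c hx]
    have h4 := hζL x (ball_subset_closedBall hx)
    have h5 := jetForm_add (fun i j => a i j x) (fun i => b i x) (c x) (q x) (ζ x)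
      (p y + G (x - y)) (pζ x) G (Hζ x)
    have h6 : L x = jetForm (fun i j => a i j x) (fun i => b i x) (c x) (q x)
      (p y + G (x - y)) G := rfl
    rw [h4, ← h6] at h5
    simp only [jetForm] at h5 ⊢
    linarith
  · have hx' : ‖x - y‖ = r := by rwa [mem_sphere, dist_eq_norm] at hx
    have h4 := htaylor x (by rw [mem_ball, dist_eq_norm, hx']; exact hrρ)
    have h5 := hζ8 x (sphere_subset_closedBall hx)
    have h6 : q x = W y + p y (x - y) + 1 / 2 * H y (x - y) (x - y) + κ / 2 * r ^ 2 := by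
      simp only [hq, hG, add_apply, smul_apply, innerForm_apply, real_inner_self_eq_norm_sq, hx',
        smul_eq_mul]
      ring
    rw [hx'] at h4
    have h7 := (abs_le.1 h4).2
    have h8 := (abs_le.1 h5).1
    dsimp only
    rw [h6, hσ]
    linarith
  · have h5 := (abs_le.1 (hζ8 y (mem_closedBall_self hr.le))).2
    have h6 : 0 < κ * r ^ 2 := by positivity
    dsimp only
    rw [hqy, hσ]
    linarith

end Touching

section Comparison

set_option maxSynthPendingDepth 3

variable {n : ℕ}

lemma HasJetOn.apply_self_nonpos_of_isLocalMax {s : Set (EuclideanSpace ℝ (Fin n))}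
    {u : EuclideanSpace ℝ (Fin n) → ℝ}
    {p : EuclideanSpace ℝ (Fin n) → EuclideanSpace ℝ (Fin n) →L[ℝ] ℝ}
    {H : EuclideanSpace ℝ (Fin n) →
      EuclideanSpace ℝ (Fin n) →L[ℝ] EuclideanSpace ℝ (Fin n) →L[ℝ] ℝ}
    (h : HasJetOn s u p H) (hs : IsOpen s) {y : EuclideanSpace ℝ (Fin n)} (hy : y ∈ s)
    (hmax : IsLocalMax u y) (v : EuclideanSpace ℝ (Fin n)) : H y v v ≤ 0 := by
  have hp : p y = 0 := hmax.hasFDerivAt_eq_zero (h.1 y hy)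
  have hη : ∀ η > 0, H y v v ≤ 2 * η * ‖v‖ ^ 2 := by
    intro η hη
    have hline : Filter.Tendsto (fun t : ℝ => y + t • v) (𝓝[>] 0) (𝓝 y) := by
      have hc : Continuous fun t : ℝ => y + t • v := by fun_prop
      have := hc.tendsto 0
      rw [zero_smul, add_zero] at this
      exact this.mono_left nhdsWithin_le_nhds
    obtain ⟨t, ⟨h1, h2⟩, ht⟩ := (((hline.eventually
      (h.eventually_abs_taylor_le hs hy hη)).and (hline.eventually hmax)).and
      self_mem_nhdsWithin).exists
    have ht0 : 0 < t := ht
    simp only [hp, add_sub_cancel_left, zero_apply, map_smul, smul_apply, smul_eq_mul, norm_smul,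
      Real.norm_eq_abs, mul_pow, sq_abs] at h1
    have h3 := (abs_le.1 h1).1
    have h4 : t ^ 2 * H y v v ≤ t ^ 2 * (2 * η * ‖v‖ ^ 2) := by linarith
    exact le_of_mul_le_mul_left h4 (by positivity)
  refine le_of_forall_pos_le_add fun ε hε => ?_
  refine (hη (ε / (2 * (‖v‖ ^ 2 + 1))) (by positivity)).trans ?_
  have h5 : 2 * (ε / (2 * (‖v‖ ^ 2 + 1))) * ‖v‖ ^ 2 = ε * (‖v‖ ^ 2 / (‖v‖ ^ 2 + 1)) := by
    field_simp
  have h6 : ‖v‖ ^ 2 / (‖v‖ ^ 2 + 1) ≤ 1 := (div_le_one (by positivity)).2 (by linarith)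
  have h7 := mul_le_mul_of_nonneg_left h6 hε.le
  linarith

lemma hessTrace_nonpos {A : Fin n → Fin n → ℝ}
    (hA : ∀ ξ : EuclideanSpace ℝ (Fin n), 0 ≤ ∑ i, ∑ j, A i j * ξ i * ξ j)
    {H : EuclideanSpace ℝ (Fin n) →L[ℝ] EuclideanSpace ℝ (Fin n) →L[ℝ] ℝ}
    (hsymm : ∀ v w, H v w = H w v) (hH : ∀ v, H v v ≤ 0) : hessTrace A H ≤ 0 := by
  set M : Matrix (Fin n) (Fin n) ℝ := fun i j =>
    -H (EuclideanSpace.single i 1) (EuclideanSpace.single j 1) with hM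
  have hpos : M.PosSemidef := by
    refine Matrix.PosSemidef.of_dotProduct_mulVec_nonneg (Matrix.IsHermitian.ext fun i j => ?_)
      fun x => ?_
    · simp [hM, hsymm (EuclideanSpace.single j 1)]
    · have hx : (WithLp.toLp 2 x : EuclideanSpace ℝ (Fin n)) =
          ∑ i, x i • EuclideanSpace.single i (1 : ℝ) := by
        ext k
        simp [Pi.single_apply]
      have h1 := hH (WithLp.toLp 2 x)
      rw [hx] at h1
      simp only [map_sum, map_smul, sum_apply, smul_apply, smul_eq_mul] at h1
      have h2 : star x ⬝ᵥ M.mulVec x = -∑ i, x i * ∑ j, x j *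
          H (EuclideanSpace.single j 1) (EuclideanSpace.single i 1) := by
        simp only [dotProduct, Matrix.mulVec, hM, Pi.star_apply, star_trivial,
          ← Finset.sum_neg_distrib, ← mul_neg]
        refine Finset.sum_congr rfl fun i _ => ?_
        congr 1
        refine Finset.sum_congr rfl fun j _ => ?_
        rw [hsymm (EuclideanSpace.single j 1)]
        ring
      rw [h2]
      linarith
  obtain ⟨m, w, hw⟩ := Matrix.posSemidef_iff_eq_sum_vecMulVec.1 hpos
  have h3 : ∀ i j, H (EuclideanSpace.single i 1) (EuclideanSpace.single j 1) =
      -∑ k, w k i * w k j := by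
    intro i j
    have h4 : M i j = ∑ k, w k i * w k j := by
      rw [hw, Matrix.sum_apply]
      simp [Matrix.vecMulVec_apply]
    rw [← h4, hM, neg_neg]
  have h5 : hessTrace A H = -∑ k, ∑ i, ∑ j, A i j * w k i * w k j := by
    rw [hessTrace_apply]
    simp only [h3, mul_neg, Finset.sum_neg_distrib, Finset.mul_sum, ← mul_assoc]
    congr 1
    rw [Finset.sum_comm]
    conv_rhs => rw [Finset.sum_comm]
    rw [Finset.sum_comm]
    refine Finset.sum_congr rfl fun i _ => ?_
    rw [Finset.sum_comm]
  rw [h5, neg_nonpos]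
  exact Finset.sum_nonneg fun k _ => hA (WithLp.toLp 2 (w k))

lemma exists_strict_supersolution (hn : 0 < n) {lam : ℝ} (hlam : 0 < lam) (Lam : ℝ)
    {s : Set (EuclideanSpace ℝ (Fin n))} (hs : Bornology.IsBounded s) :
    ∃ (ψ : EuclideanSpace ℝ (Fin n) → ℝ)
      (p : EuclideanSpace ℝ (Fin n) → EuclideanSpace ℝ (Fin n) →L[ℝ] ℝ)
      (H : EuclideanSpace ℝ (Fin n) →
        EuclideanSpace ℝ (Fin n) →L[ℝ] EuclideanSpace ℝ (Fin n) →L[ℝ] ℝ),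
      HasJetOn univ ψ p H ∧ (∀ x ∈ s, 0 ≤ ψ x) ∧
      ∀ x ∈ s, ∀ (A : Fin n → Fin n → ℝ) (β : Fin n → ℝ) (γ : ℝ),
        (∀ ξ : EuclideanSpace ℝ (Fin n), lam * ‖ξ‖ ^ 2 ≤ ∑ i, ∑ j, A i j * ξ i * ξ j) →
        (∀ i, |β i| ≤ Lam) → γ ≤ 0 → jetForm A β γ (ψ x) (p x) (H x) < 0 := by
  obtain ⟨R, hR⟩ := hs.exists_norm_le
  let o : Fin n := ⟨0, hn⟩
  let ℓ : EuclideanSpace ℝ (Fin n) →L[ℝ] ℝ := EuclideanSpace.proj o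
  set μ := (|Lam| + 1) / lam with hμ
  have hμ0 : 0 < μ := by positivity
  let e : EuclideanSpace ℝ (Fin n) → ℝ := fun x => Real.exp (μ * ℓ x)
  have he : ∀ x, HasFDerivAt e ((e x * μ) • ℓ) x := fun x => by
    have h1 := (ℓ.hasFDerivAt (x := x)).const_mul μ |>.exp
    rwa [smul_smul] at h1
  have hψ : ∀ x ∈ s, 0 ≤ Real.exp (μ * R) - e x := by
    intro x hx
    have h1 : ℓ x ≤ R := (le_abs_self _).trans ((PiLp.norm_apply_le x o).trans (hR x hx))
    exact sub_nonneg.2 (Real.exp_le_exp.2 (mul_le_mul_of_nonneg_left h1 hμ0.le))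
  refine ⟨fun x => Real.exp (μ * R) - e x, fun x => -((e x * μ) • ℓ),
    fun x => -(((e x * μ) * μ) • ℓ.smulRight ℓ), ⟨fun x _ => (he x).const_sub _, fun x _ => ?_⟩,
    hψ, fun x hx A β γ hA hβ hγ => ?_⟩
  · refine (((he x).mul_const μ).smul_const ℓ).neg.congr_fderiv ?_
    ext v w
    simp
    ring
  · have hex : 0 < e x := Real.exp_pos _
    have h1 := hA (EuclideanSpace.single o 1)
    have h2 : lam ≤ A o o := by simpa [PiLp.single_apply] using h1
    have h3 : ∀ i, ℓ (EuclideanSpace.single i 1) = if i = o then 1 else 0 := fun i => by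
      simp [ℓ, PiLp.single_apply, eq_comm]
    have h4 : jetForm A β γ (Real.exp (μ * R) - e x) (-((e x * μ) • ℓ))
        (-(((e x * μ) * μ) • ℓ.smulRight ℓ)) =
        -(e x * μ * (A o o * μ + β o)) + γ * (Real.exp (μ * R) - e x) := by
      simp only [jetForm, hessTrace_apply, neg_apply, smul_apply,
        ContinuousLinearMap.smulRight_apply, smul_eq_mul, h3]
      simp
      ring
    rw [h4]
    have h5 := mul_nonpos_of_nonpos_of_nonneg hγ (hψ x hx)
    have h6 : |Lam| + 1 ≤ A o o * μ := by
      have := mul_le_mul_of_nonneg_right h2 hμ0.le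
      rwa [hμ, mul_div_cancel₀ _ hlam.ne'] at this
    have h7 : 0 < A o o * μ + β o := by
      have := (abs_le.1 (hβ o)).1
      have := le_abs_self Lam
      linarith
    have h8 : 0 < e x * μ * (A o o * μ + β o) := by positivity
    linarith

lemma nonpos_on_closure_of_no_interior_max {s : Set (EuclideanSpace ℝ (Fin n))}
    (hs : Bornology.IsBounded s) {d ψ : EuclideanSpace ℝ (Fin n) → ℝ}
    (hso : IsOpen s) (hd : ContinuousOn d (closure s)) (hψ : Continuous ψ)
    (hψ0 : ∀ x ∈ closure s, 0 ≤ ψ x) (hfr : ∀ x ∈ frontier s, d x ≤ 0)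
    (hno : ∀ δ : ℝ, 0 < δ → ∀ y ∈ s, 0 < d y - δ * ψ y →
      ¬ IsMaxOn (fun x => d x - δ * ψ x) (closure s) y) :
    ∀ x ∈ closure s, d x ≤ 0 := by
  intro x hx
  by_contra! hdx
  set δ := d x / (ψ x + 1) with hδ
  have hψx := hψ0 x hx
  have hδ0 : 0 < δ := by positivity
  have h1 : 0 < d x - δ * ψ x := by
    have h2 : δ * (ψ x + 1) = d x := div_mul_cancel₀ _ (by positivity)
    linarith
  obtain ⟨y, hy, hmax⟩ := hs.isCompact_closure.exists_isMaxOn ⟨x, hx⟩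
    (hd.sub (continuousOn_const.mul hψ.continuousOn))
  have h3 : 0 < d y - δ * ψ y := h1.trans_le (hmax hx)
  by_cases hys : y ∈ s
  · exact hno δ hδ0 y hys h3 hmax
  · have h4 := hfr y ⟨hy, by rwa [hso.interior_eq]⟩
    have h5 := mul_nonneg hδ0.le (hψ0 y hy)
    linarith

end Comparison

section Perron

set_option maxSynthPendingDepth 3

variable {n : ℕ} {Ω : Set (EuclideanSpace ℝ (Fin n))}
  {a : Fin n → Fin n → EuclideanSpace ℝ (Fin n) → ℝ}
  {b : Fin n → EuclideanSpace ℝ (Fin n) → ℝ} {c f : EuclideanSpace ℝ (Fin n) → ℝ} {lam Lam : ℝ}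

/-- The weak maximum principle, for a subsolution and a supersolution in `C²(s) ∩ C⁰(s̄)`. -/
lemma le_of_lopW_le (hn : 0 < n) (hlam : 0 < lam) {s : Set (EuclideanSpace ℝ (Fin n))}
    (hs : IsOpen s) (hsb : Bornology.IsBounded s) (hell : UnifElliptic a lam s)
    (hb : ∀ x ∈ s, ∀ i, |b i x| ≤ Lam) (hc : ∀ x ∈ s, c x ≤ 0)
    {u v : EuclideanSpace ℝ (Fin n) → ℝ} (hu : ContDiffOn ℝ 2 u s) (hv : ContDiffOn ℝ 2 v s)
    (huc : ContinuousOn u (closure s)) (hvc : ContinuousOn v (closure s))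
    (hL : ∀ x ∈ s, LopW s a b c v x ≤ LopW s a b c u x) (hfr : ∀ x ∈ frontier s, u x ≤ v x) :
    ∀ x ∈ closure s, u x ≤ v x := by
  obtain ⟨ψ, pψ, Hψ, hjψ, hψ0, hψL⟩ := exists_strict_supersolution hn hlam Lam hsb.closure
  have hju := hu.hasJetOn hs
  have hjv := hv.hasJetOn hs
  have hψc : Continuous ψ := continuousOn_univ.1 hjψ.continuousOn
  suffices h : ∀ x ∈ closure s, u x - v x ≤ 0 from fun x hx => sub_nonpos.1 (h x hx)
  refine nonpos_on_closure_of_no_interior_max hsb hs (huc.sub hvc) hψc hψ0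
    (fun x hx => sub_nonpos.2 (hfr x hx)) fun δ hδ y hy hpos hmax => ?_
  have hjd := (hju.sub hjv).sub ((hjψ.mono (subset_univ s)).const_smul δ)
  have hloc : IsLocalMax (fun x => u x - v x - δ • ψ x) y :=
    hmax.isLocalMax (Filter.mem_of_superset (hs.mem_nhds hy) subset_closure)
  have hp := hloc.hasFDerivAt_eq_zero (hjd.1 y hy)
  have hH := hessTrace_nonpos (A := fun i j => a i j y)
    (fun ξ => (by positivity : 0 ≤ lam * ‖ξ‖ ^ 2).trans (hell y hy ξ)) (hjd.symmetric hs hy)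
    (hjd.apply_self_nonpos_of_isLocalMax hs hy hloc)
  have h1 : jetForm (fun i j => a i j y) (fun i => b i y) (c y) (u y - v y - δ • ψ y)
      (fderiv ℝ u y - fderiv ℝ v y - δ • pψ y)
      (fderiv ℝ (fderiv ℝ u) y - fderiv ℝ (fderiv ℝ v) y - δ • Hψ y) ≤ 0 := by
    rw [hp]
    have h2 := mul_nonpos_of_nonpos_of_nonneg (hc y hy) hpos.le
    simp only [jetForm, zero_apply, mul_zero, Finset.sum_const_zero, smul_eq_mul]
    linarith
  rw [jetForm_sub, jetForm_sub, jetForm_smul, ← hju.lopW_eq hs a b c hy,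
    ← hjv.lopW_eq hs a b c hy] at h1
  have h3 := hψL y (subset_closure hy) _ _ (c y) (hell y hy) (hb y hy) (hc y hy)
  have h4 := mul_neg_of_pos_of_neg hδ h3
  have h5 := hL y hy
  linarith

lemma subharmonic_of_le_lopW (hn : 0 < n) (hlam : 0 < lam) (hΩ : IsOpen Ω)
    (hell : UnifElliptic a lam Ω) (hb : ∀ x ∈ Ω, ∀ i, |b i x| ≤ Lam) (hc : ∀ x ∈ Ω, c x ≤ 0)
    {w : EuclideanSpace ℝ (Fin n) → ℝ} (hw : ContDiffOn ℝ 2 w Ω)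
    (hwc : ContinuousOn w (closure Ω)) (hL : ∀ x ∈ Ω, f x ≤ LopW Ω a b c w x) :
    Subharmonic Ω a b c f w := by
  refine ⟨hwc, fun y r hr hsub v hv hvc hLv hsph => ?_⟩
  have hball : ball y r ⊆ Ω := ball_subset_closedBall.trans hsub
  have hcl : closure (ball y r) = closedBall y r := closure_ball y hr.ne'
  have hw' := hw.mono hball
  rw [← hcl] at hvc hsub ⊢
  refine le_of_lopW_le hn hlam isOpen_ball isBounded_ball (fun x hx => hell x (hball hx))
    (fun x hx => hb x (hball hx)) (fun x hx => hc x (hball hx)) hw' hv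
    (hw.continuousOn.mono hsub) hvc (fun x hx => ?_) (fun x hx => ?_)
  · have h1 := hL x (hball hx)
    have hj := hw.hasJetOn hΩ
    rw [hj.lopW_eq hΩ a b c (hball hx)] at h1
    rw [hLv x hx, (hj.mono hball).lopW_eq isOpen_ball a b c hx]
    exact h1
  · rw [frontier_ball y hr.ne'] at hx
    exact hsph x hx

lemma MemC0α.eventually_holderBound {α : ℝ≥0} (hα : 0 < α) {h : EuclideanSpace ℝ (Fin n) → ℝ}
    {s : Set (EuclideanSpace ℝ (Fin n))} (hh : MemC0α α h s) {y : EuclideanSpace ℝ (Fin n)} {R : ℝ}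
    (hR : R ≤ 1 / 2) (hys : closedBall y R ⊆ s) :
    ∀ᶠ N in Filter.atTop, HolderBound ((α : ℝ) / 2) (closedBall y R) h N := by
  obtain ⟨C, hC⟩ := hh
  have hα' : (0 : ℝ) < α := hα
  obtain ⟨N₁, hN₁⟩ := (isCompact_closedBall y R).exists_bound_of_continuousOn
    ((hC.continuousOn hα).mono hys)
  filter_upwards [Filter.eventually_ge_atTop N₁, Filter.eventually_ge_atTop (C : ℝ)] with N h1 h2
  refine ⟨fun x hx => (hN₁ x hx).trans h1, fun x hx z hz => ?_⟩
  have h3 := hC.dist_le (hys hx) (hys hz)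
  rw [Real.dist_eq, dist_eq_norm] at h3
  have hd : ‖x - z‖ ≤ 1 := by
    rw [← dist_eq_norm]
    have := dist_triangle_right x z y
    rw [mem_closedBall] at hx hz
    linarith
  have h4 : ‖x - z‖ ^ (α : ℝ) ≤ ‖x - z‖ ^ ((α : ℝ) / 2) :=
    Real.rpow_le_rpow_of_exponent_ge' (norm_nonneg _) hd (by positivity) (by linarith)
  exact h3.trans (mul_le_mul h2 h4 (by positivity) (C.coe_nonneg.trans h2))

/-- A function that is subharmonic in the sense of comparison with local solutions lies below
every classical supersolution lying above it on the boundary. -/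
lemma Subharmonic.le_of_lopW_le (hn : 0 < n) (hΩ : IsOpen Ω) (hΩb : Bornology.IsBounded Ω)
    {α : ℝ≥0} (hα : 0 < α) (hα1 : α ≤ 1) (ha : ∀ i j, MemC0α α (a i j) (closure Ω))
    (hb : ∀ i, MemC0α α (b i) (closure Ω)) (hc : MemC0α α c (closure Ω))
    (hf : MemC0α α f (closure Ω)) (hc0 : ∀ x ∈ closure Ω, c x ≤ 0) (hlam : 0 < lam)
    (hell : UnifElliptic a lam Ω) (hbL : ∀ x ∈ Ω, ∀ i, |b i x| ≤ Lam)
    {u w : EuclideanSpace ℝ (Fin n) → ℝ} (hu : Subharmonic Ω a b c f u)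
    (hw : ContDiffOn ℝ 2 w Ω) (hwc : ContinuousOn w (closure Ω))
    (hL : ∀ x ∈ Ω, LopW Ω a b c w x ≤ f x) (hfr : ∀ x ∈ frontier Ω, u x ≤ w x) :
    ∀ x ∈ closure Ω, u x ≤ w x := by
  obtain ⟨ψ, pψ, Hψ, hjψ, hψ0, hψL⟩ := exists_strict_supersolution hn hlam Lam hΩb.closure
  have hjw := hw.hasJetOn hΩ
  have hψc : Continuous ψ := continuousOn_univ.1 hjψ.continuousOn
  suffices h : ∀ x ∈ closure Ω, u x - w x ≤ 0 from fun x hx => sub_nonpos.1 (h x hx)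
  refine nonpos_on_closure_of_no_interior_max hΩb hΩ (hu.1.sub hwc) hψc hψ0
    (fun x hx => sub_nonpos.2 (hfr x hx)) fun δ hδ y hy hpos hmax => ?_
  set M := u y - w y - δ * ψ y with hM
  have hjW := (hjw.add ((hjψ.mono (subset_univ Ω)).const_smul δ)).add_const M
  have hlt : jetForm (fun i j => a i j y) (fun i => b i y) (c y) (w y + δ • ψ y + M)
      (fderiv ℝ w y + δ • pψ y) (fderiv ℝ (fderiv ℝ w) y + δ • Hψ y) < f y := by
    have h1 := jetForm_add (fun i j => a i j y) (fun i => b i y) (c y) (w y) (δ • ψ y)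
      (fderiv ℝ w y) (δ • pψ y) (fderiv ℝ (fderiv ℝ w) y) (δ • Hψ y)
    rw [jetForm_smul, ← hjw.lopW_eq hΩ a b c hy] at h1
    have h2 := mul_neg_of_pos_of_neg hδ
      (hψL y (subset_closure hy) _ _ (c y) (hell y hy) (hbL y hy) (hc0 y (subset_closure hy)))
    have h3 := mul_nonpos_of_nonpos_of_nonneg (hc0 y (subset_closure hy)) hpos.le
    have h4 := hL y hy
    simp only [jetForm] at h1 h2 ⊢
    linarith
  obtain ⟨R₀, hR₀, hR₀Ω⟩ := Metric.nhds_basis_closedBall.mem_iff.1 (hΩ.mem_nhds hy)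
  set R := min R₀ (1 / 2) with hR
  have hRpos : 0 < R := lt_min hR₀ (by norm_num)
  have hR2 : R ≤ 1 / 2 := min_le_right _ _
  have hRΩ : closedBall y R ⊆ Ω := (closedBall_subset_closedBall (min_le_left _ _)).trans hR₀Ω
  have hRc : closedBall y R ⊆ closure Ω := hRΩ.trans subset_closure
  obtain ⟨K, ⟨⟨⟨haK, hbK⟩, hcK⟩, hfK⟩, hK⟩ := ((((Filter.eventually_all.2 fun i =>
    Filter.eventually_all.2 fun j => (ha i j).eventually_holderBound hα hR2 hRc).and
    (Filter.eventually_all.2 fun i => (hb i).eventually_holderBound hα hR2 hRc)).and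
    (hc.eventually_holderBound hα hR2 hRc)).and (hf.eventually_holderBound hα hR2 hRc)).and
    (Filter.eventually_ge_atTop 0) |>.exists
  have hα' : (0 : ℝ) < α := hα
  have hα1' : (α : ℝ) ≤ 1 := hα1
  obtain ⟨r, ⟨v, hv, hvc, hLv, hsph, hvy⟩, hr⟩ := ((eventually_exists_touching_solution hn
    (half_pos hα') (by linarith) hRpos (by linarith) hK hlam haK hbK hcK hfK (hell y hy) hΩ hy hjW
    hlt).and (Ioo_mem_nhdsGT hRpos)).exists
  have hrΩ : closedBall y r ⊆ Ω := (closedBall_subset_closedBall hr.2.le).trans hRΩ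
  have h5 := hu.2 y r hr.1 hrΩ v hv hvc hLv (fun x hx => ?_) y (mem_closedBall_self hr.1.le)
  · simp only [smul_eq_mul] at hvy
    linarith
  · refine le_trans ?_ (hsph x hx)
    have h6 : u x - w x - δ * ψ x ≤ M :=
      hmax (subset_closure (hrΩ (sphere_subset_closedBall hx)))
    simp only [smul_eq_mul]
    linarith

end Perron

/-- Lemma 2.24, continuous attainment of boundary values. Assume
`c ≤ 0`, `f ∈ C^{0,α}(Ω̄)`, `g ∈ C⁰(Ω̄)`. If `x₀ ∈ ∂Ω` admits a barrier to `(L, f, g)`,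
then the Perron function `u(x) = sup_{v ∈ S_g} v(x)` satisfies `u(x) → g(x₀)` as
`x → x₀` in `Ω`. -/
theorem perron_boundary_value_with_barrier
    {n : ℕ} (Ω : Set (EuclideanSpace ℝ (Fin n)))
    (hΩne : Ω.Nonempty) (hΩopen : IsOpen Ω) (hΩconn : IsConnected Ω)
    (hΩbdd : Bornology.IsBounded Ω)
    (α : ℝ≥0) (hα0 : 0 < α) (hα1 : α ≤ 1)
    (a : Fin n → Fin n → EuclideanSpace ℝ (Fin n) → ℝ)
    (b : Fin n → EuclideanSpace ℝ (Fin n) → ℝ)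
    (c : EuclideanSpace ℝ (Fin n) → ℝ)
    (ha : ∀ i j, MemC0α α (a i j) (closure Ω))
    (hb : ∀ i, MemC0α α (b i) (closure Ω))
    (hc : MemC0α α c (closure Ω))
    (hcneg : ∀ x ∈ closure Ω, c x ≤ 0)
    (lam Lam : ℝ) (hlam : 0 < lam)
    (hell : UnifElliptic a lam Ω)
    (hcoeff : CoeffBound a b c Lam (closure Ω))
    (f g : EuclideanSpace ℝ (Fin n) → ℝ)
    (hf : MemC0α α f (closure Ω))
    (hg : ContinuousOn g (closure Ω))
    (x₀ : EuclideanSpace ℝ (Fin n)) (hx₀ : x₀ ∈ frontier Ω)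
    -- a barrier `(w⁺_ε, w⁻_ε)_{ε>0}` to `(L, f, g)` at `x₀`
    (hbarrier : ∃ wp wm : ℝ → EuclideanSpace ℝ (Fin n) → ℝ,
      (∀ ε : ℝ, 0 < ε →
        ContDiffOn ℝ 2 (wp ε) Ω ∧ ContinuousOn (wp ε) (closure Ω) ∧
        ContDiffOn ℝ 2 (wm ε) Ω ∧ ContinuousOn (wm ε) (closure Ω) ∧
        (∀ x ∈ Ω, LopW Ω a b c (wp ε) x ≤ f x) ∧
        (∀ x ∈ Ω, f x ≤ LopW Ω a b c (wm ε) x) ∧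
        (∀ x ∈ frontier Ω, g x ≤ wp ε x) ∧
        (∀ x ∈ frontier Ω, wm ε x ≤ g x)) ∧
      Filter.Tendsto (fun ε => wp ε x₀) (𝓝[>] (0 : ℝ)) (𝓝 (g x₀)) ∧
      Filter.Tendsto (fun ε => wm ε x₀) (𝓝[>] (0 : ℝ)) (𝓝 (g x₀))) :
    Filter.Tendsto (perron Ω a b c f g) (𝓝[Ω] x₀) (𝓝 (g x₀)) := by
  have hn : 0 < n := by
    rcases Nat.eq_zero_or_pos n with rfl | h
    · rw [Subsingleton.eq_univ_of_nonempty hΩne, frontier_univ] at hx₀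
      exact absurd hx₀ (notMem_empty _)
    · exact h
  obtain ⟨wp, wm, hw, hwp, hwm⟩ := hbarrier
  have hbL : ∀ x ∈ Ω, ∀ i, |b i x| ≤ Lam := fun x hx => (hcoeff x (subset_closure hx)).2.1
  have hup : ∀ ε, 0 < ε → ∀ v, Subfunction Ω a b c f g v → ∀ x ∈ Ω, v x ≤ wp ε x := by
    intro ε hε v hv x hx
    obtain ⟨h1, h2, -, -, h3, -, h4, -⟩ := hw ε hε
    exact hv.1.le_of_lopW_le hn hΩopen hΩbdd hα0 hα1 ha hb hc hf hcneg hlam hell hbL h1 h2 h3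
      (fun z hz => (hv.2 z hz).trans (h4 z hz)) x (subset_closure hx)
  have hsub : ∀ ε, 0 < ε → Subfunction Ω a b c f g (wm ε) := by
    intro ε hε
    obtain ⟨-, -, h1, h2, -, h3, -, h4⟩ := hw ε hε
    exact ⟨subharmonic_of_le_lopW hn hlam hΩopen hell hbL
      (fun x hx => hcneg x (subset_closure hx)) h1 h2 h3, h4⟩
  have hle : ∀ ε, 0 < ε → ∀ x ∈ Ω, perron Ω a b c f g x ≤ wp ε x := fun ε hε x hx =>
    csSup_le ⟨_, wm ε, hsub ε hε, rfl⟩ (by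
      rintro _ ⟨v, hv, rfl⟩
      exact hup ε hε v hv x hx)
  have hge : ∀ ε, 0 < ε → ∀ x ∈ Ω, wm ε x ≤ perron Ω a b c f g x := fun ε hε x hx =>
    le_csSup ⟨wp ε x, by
      rintro _ ⟨v, hv, rfl⟩
      exact hup ε hε v hv x hx⟩ ⟨wm ε, hsub ε hε, rfl⟩
  have hx₀c : x₀ ∈ closure Ω := frontier_subset_closure hx₀
  refine tendsto_order.2 ⟨fun t ht => ?_, fun t ht => ?_⟩
  · obtain ⟨ε, h1, hε⟩ := ((hwm.eventually_const_lt ht).and self_mem_nhdsWithin).exists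
    have hcont := ((hw ε hε).2.2.2.1 x₀ hx₀c).mono subset_closure
    filter_upwards [hcont.eventually_const_lt h1, self_mem_nhdsWithin] with x h2 hx
    exact h2.trans_le (hge ε hε x hx)
  · obtain ⟨ε, h1, hε⟩ := ((hwp.eventually_lt_const ht).and self_mem_nhdsWithin).exists
    have hcont := ((hw ε hε).2.1 x₀ hx₀c).mono subset_closure
    filter_upwards [hcont.eventually_lt_const h1, self_mem_nhdsWithin] with x h2 hx
    exact (hle ε hε x hx).trans_lt h2
end
end

section
/- Let R > 0 and let L₁ be the elliptic operator on B_R(0) ⊂ ℝⁿ with coefficients a_{ij}, b_i ∈ C^{2,α}(B_R^{0,+}(0)). Define g_i(x) = −a_{in}(x^{(n−1)}, 0)/a_{nn}(x^{(n−1)}, 0) for 1 ≤ i < n and F(x) = (x^{(n−1)} + g(x^{(n−1)})·x_n, x_n). Then: (i) F maps points with x_n > 0 to points with y_n > 0; (ii) F maps points with x_n = 0 to points with y_n = 0; (iii) there exists 0 < R' ≤ R such that F restricted to B_{R'}(0) is a C^{2,α}-diffeomorphism onto its image; (iv) the transformed operator L₂ = T_F^{−1} ∘ L₁ ∘ T_F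 has no mixed second-order terms at the flat boundary: for y = F(x) with x_n = 0, the coefficients ã_{in}(y) of ∂_{y_i}∂_{y_n} vanish for all 1 ≤ i < n. -/
open scoped NNReal Topology
open Set Metric

noncomputable section

/-- The projection onto the hyperplane `{x_n = 0}`: `x ↦ (x^{(n−1)}, 0)`. -/
def proj0 {n : ℕ} (x : EuclideanSpace ℝ (Fin (n + 1))) : EuclideanSpace ℝ (Fin (n + 1)) :=
  x - x (Fin.last n) • EuclideanSpace.single (Fin.last n) 1

/-- `g_i(x) = −a_{in}(x^{(n−1)}, 0)/a_{nn}(x^{(n−1)}, 0)` for `i < n`, and `0` for `i = n`. -/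
def gcoef {n : ℕ} (a : Fin (n + 1) → Fin (n + 1) → EuclideanSpace ℝ (Fin (n + 1)) → ℝ)
    (i : Fin (n + 1)) (x : EuclideanSpace ℝ (Fin (n + 1))) : ℝ :=
  if i = Fin.last n then 0
  else -(a i (Fin.last n) (proj0 x)) / (a (Fin.last n) (Fin.last n) (proj0 x))

/-- The flattening map `F(x) = (x^{(n−1)} + g(x^{(n−1)})·x_n, x_n)`. -/
def flatMap {n : ℕ} (a : Fin (n + 1) → Fin (n + 1) → EuclideanSpace ℝ (Fin (n + 1)) → ℝ)
    (x : EuclideanSpace ℝ (Fin (n + 1))) : EuclideanSpace ℝ (Fin (n + 1)) :=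
  x + x (Fin.last n) • ∑ i, gcoef a i x • EuclideanSpace.single i 1

/-- `f` is `α`-Hölder continuous on some neighbourhood of `x`. -/
def HolderNear {X Y : Type*} [PseudoEMetricSpace X] [PseudoEMetricSpace Y] (α : ℝ≥0)
    (f : X → Y) (x : X) : Prop :=
  ∃ C : ℝ≥0, ∃ U ∈ 𝓝 x, HolderOnWith C α f U

namespace HolderNear

section EMetric

variable {X Y Z : Type*} [PseudoEMetricSpace X] [PseudoEMetricSpace Y] [PseudoEMetricSpace Z]
  {α : ℝ≥0} {f g : X → Y} {x : X}

theorem congr (hf : HolderNear α f x) (h : f =ᶠ[𝓝 x] g) : HolderNear α g x := by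
  obtain ⟨C, U, hU, hC⟩ := hf
  refine ⟨C, U ∩ {y | f y = g y}, Filter.inter_mem hU h, fun y hy z hz => ?_⟩
  rw [← hy.2, ← hz.2]
  exact hC y hy.1 z hz.1

theorem prodMk {g : X → Z} (hf : HolderNear α f x) (hg : HolderNear α g x) :
    HolderNear α (fun y => (f y, g y)) x := by
  obtain ⟨C, U, hU, hC⟩ := hf
  obtain ⟨D, V, hV, hD⟩ := hg
  refine ⟨max C D, U ∩ V, Filter.inter_mem hU hV, fun y hy z hz => ?_⟩
  rw [Prod.edist_eq]
  refine max_le ((hC y hy.1 z hz.1).trans ?_) ((hD y hy.2 z hz.2).trans ?_)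
  · gcongr; exact le_max_left _ _
  · gcongr; exact le_max_right _ _

theorem lipschitz_comp {K : ℝ≥0} {φ : Y → Z} (hφ : LipschitzWith K φ) (hf : HolderNear α f x) :
    HolderNear α (φ ∘ f) x := by
  obtain ⟨C, U, hU, hC⟩ := hf
  have h := (holderWith_one.2 hφ).comp_holderOnWith hC
  rw [one_mul] at h
  exact ⟨_, U, hU, h⟩

end EMetric

variable {E F G : Type*} [NormedAddCommGroup E] [NormedSpace ℝ E] [NormedAddCommGroup F]
  [NormedSpace ℝ F] [NormedAddCommGroup G] [NormedSpace ℝ G] {α : ℝ≥0} {f : E → F} {x : E}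

theorem of_contDiffAt (hα : α ≤ 1) (hf : ContDiffAt ℝ 1 f x) : HolderNear α f x := by
  obtain ⟨K, t, ht, hK⟩ := hf.exists_lipschitzOnWith
  refine ⟨_, t ∩ ball x 1, Filter.inter_mem ht (ball_mem_nhds x one_pos),
    HolderOnWith.of_le (D := 2) (fun y hy z hz => ?_)
      ((holderOnWith_one.2 hK).mono inter_subset_left) hα⟩
  rw [edist_dist, ENNReal.ofReal_le_iff_le_toReal (by simp)]
  have := dist_triangle_right y z x
  have h1 := mem_ball.1 hy.2
  have h2 := mem_ball.1 hz.2
  simp only [ENNReal.coe_ofNat, ENNReal.toReal_ofNat]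
  linarith

theorem contDiffAt_comp {X : Type*} [PseudoEMetricSpace X] {f : X → F} {x : X} {φ : F → G}
    (hφ : ContDiffAt ℝ 1 φ (f x)) (hf : HolderNear α f x) (hfc : ContinuousAt f x) :
    HolderNear α (φ ∘ f) x := by
  obtain ⟨C, U, hU, hC⟩ := hf
  obtain ⟨K, t, ht, hK⟩ := hφ.exists_lipschitzOnWith
  have h := (holderOnWith_one.2 hK).comp (hC.mono (inter_subset_left (t := f ⁻¹' t)))
    (fun y hy => hy.2)
  rw [one_mul] at h
  exact ⟨_, _, Filter.inter_mem hU (hfc ht), h⟩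

theorem comp_contDiffAt {Y : Type*} [PseudoEMetricSpace Y] {f : E → Y} {φ : G → E} {z : G}
    (hf : HolderNear α f (φ z)) (hφ : ContDiffAt ℝ 1 φ z) : HolderNear α (f ∘ φ) z := by
  obtain ⟨C, U, hU, hC⟩ := hf
  obtain ⟨K, t, ht, hK⟩ := hφ.exists_lipschitzOnWith
  have h := hC.comp ((holderOnWith_one.2 hK).mono (inter_subset_left (t := φ ⁻¹' U)))
    (fun y hy => hy.2)
  rw [mul_one] at h
  exact ⟨_, _, Filter.inter_mem ht (hφ.continuousAt hU), h⟩

end HolderNear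

/-- `f` is of class `C^{k,α}` on some neighbourhood of `x`. -/
structure ContDiffHolderNear {E F : Type*} [NormedAddCommGroup E] [NormedSpace ℝ E]
    [NormedAddCommGroup F] [NormedSpace ℝ F] (k : ℕ) (α : ℝ≥0) (f : E → F) (x : E) : Prop where
  contDiffAt : ContDiffAt ℝ k f x
  holderNear : HolderNear α (iteratedFDeriv ℝ k f) x

namespace ContDiffHolderNear

universe u

variable {E F G : Type u} [NormedAddCommGroup E] [NormedSpace ℝ E] [NormedAddCommGroup F]
  [NormedSpace ℝ F] [NormedAddCommGroup G] [NormedSpace ℝ G] {k : ℕ} {α : ℝ≥0} {f : E → F} {x : E}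

theorem congr {g : E → F} (hf : ContDiffHolderNear k α f x) (h : f =ᶠ[𝓝 x] g) :
    ContDiffHolderNear k α g x :=
  ⟨hf.1.congr_of_eventuallyEq h.symm, hf.2.congr (h.iteratedFDeriv ℝ k)⟩

theorem zero_iff : ContDiffHolderNear 0 α f x ↔ ContDiffAt ℝ 0 f x ∧ HolderNear α f x := by
  refine ⟨fun h => ⟨h.1, ?_⟩, fun h => ⟨h.1, ?_⟩⟩
  · exact (h.2.lipschitz_comp (continuousMultilinearCurryFin0 ℝ E F).lipschitz).congr
      (.of_forall fun y => by simp [iteratedFDeriv_zero_eq_comp])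
  · rw [iteratedFDeriv_zero_eq_comp]
    exact h.2.lipschitz_comp (continuousMultilinearCurryFin0 ℝ E F).symm.lipschitz

theorem succ_iff : ContDiffHolderNear (k + 1) α f x ↔
    ContDiffAt ℝ (k + 1) f x ∧ ContDiffHolderNear k α (fderiv ℝ f) x := by
  refine ⟨fun h => ⟨h.1, h.1.fderiv_right_succ, ?_⟩, fun h => ⟨h.1, ?_⟩⟩
  · exact (h.2.lipschitz_comp (continuousMultilinearCurryRightEquiv' ℝ k E F).lipschitz).congr
      (.of_forall fun y => by simp [iteratedFDeriv_succ_eq_comp_right])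
  · exact (h.2.2.lipschitz_comp
      (continuousMultilinearCurryRightEquiv' ℝ k E F).symm.lipschitz).congr
      (.of_forall fun y => by simp [iteratedFDeriv_succ_eq_comp_right])

theorem of_contDiffAt (hα : α ≤ 1) (hf : ContDiffAt ℝ (k + 1) f x) :
    ContDiffHolderNear k α f x := by
  refine ⟨hf.of_le (by simp), .of_contDiffAt hα (hf.iteratedFDeriv_right ?_)⟩
  rw [add_comm]

theorem of_succ (hα : α ≤ 1) (hf : ContDiffHolderNear (k + 1) α f x) :
    ContDiffHolderNear k α f x :=
  of_contDiffAt hα (by simpa using hf.1)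

theorem prodMk {g : E → G} (hf : ContDiffHolderNear k α f x) (hg : ContDiffHolderNear k α g x) :
    ContDiffHolderNear k α (fun y => (f y, g y)) x := by
  refine ⟨hf.1.prodMk hg.1, ?_⟩
  refine ((hf.2.prodMk hg.2).lipschitz_comp
    (ContinuousMultilinearMap.prodL ℝ (fun _ : Fin k => E) F G).lipschitz).congr ?_
  filter_upwards [hf.1.eventually (by simp), hg.1.eventually (by simp)] with y h1 h2
  exact (iteratedFDeriv_prodMk h1 h2 le_rfl).symm

theorem _root_.ContDiffAt.fderiv_comp_eventuallyEq {φ : F → G} (hφ : ContDiffAt ℝ 1 φ (f x))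
    (hf : ContDiffAt ℝ 1 f x) :
    (fun y => (fderiv ℝ φ (f y)).comp (fderiv ℝ f y)) =ᶠ[𝓝 x] fderiv ℝ (φ ∘ f) := by
  filter_upwards [hf.eventually (by simp),
    hf.continuousAt.eventually (hφ.eventually (by simp))] with y h1 h2
  exact (fderiv_comp y (h2.differentiableAt one_ne_zero)
    (h1.differentiableAt one_ne_zero)).symm

theorem contDiffAt_comp (hα : α ≤ 1) {φ : F → G} (hφ : ContDiffAt ℝ (k + 1) φ (f x))
    (hf : ContDiffHolderNear k α f x) : ContDiffHolderNear k α (φ ∘ f) x := by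
  induction k generalizing E F G with
  | zero =>
    rw [zero_iff] at hf ⊢
    refine ⟨(hφ.of_le (by simp)).comp x hf.1, hf.2.contDiffAt_comp ?_ hf.1.continuousAt⟩
    simpa using hφ
  | succ k ih =>
    have hf' := succ_iff.1 hf
    refine succ_iff.2 ⟨(hφ.of_le (by simp)).comp x hf'.1, ?_⟩
    have h1 : ContDiffHolderNear k α (fderiv ℝ φ ∘ f) x :=
      ih (by simpa using hφ.fderiv_right_succ) (hf.of_succ hα)
    exact (ih (φ := fun p : (F →L[ℝ] G) × (E →L[ℝ] F) => p.1.comp p.2)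
      isBoundedBilinearMap_comp.contDiff.contDiffAt (h1.prodMk hf'.2)).congr
      (ContDiffAt.fderiv_comp_eventuallyEq (hφ.of_le (by simp)) (hf'.1.of_le (by simp)))

theorem comp_contDiffAt (hα : α ≤ 1) {φ : G → E} {z : G} (hf : ContDiffHolderNear k α f (φ z))
    (hφ : ContDiffAt ℝ (k + 1) φ z) : ContDiffHolderNear k α (f ∘ φ) z := by
  induction k generalizing E F G with
  | zero =>
    rw [zero_iff] at hf ⊢
    refine ⟨hf.1.comp z (hφ.of_le (by simp)), hf.2.comp_contDiffAt ?_⟩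
    simpa using hφ
  | succ k ih =>
    have hf' := succ_iff.1 hf
    refine succ_iff.2 ⟨hf'.1.comp z (hφ.of_le (by simp)), ?_⟩
    have h1 : ContDiffHolderNear k α (fderiv ℝ f ∘ φ) z :=
      ih hf'.2 (hφ.of_le (by simp))
    have h2 : ContDiffHolderNear k α (fderiv ℝ φ) z :=
      of_contDiffAt hα (by simpa using hφ.fderiv_right_succ)
    exact (contDiffAt_comp hα (φ := fun p : (E →L[ℝ] F) × (G →L[ℝ] E) => p.1.comp p.2)
      isBoundedBilinearMap_comp.contDiff.contDiffAt (h1.prodMk h2)).congr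
      (ContDiffAt.fderiv_comp_eventuallyEq (hf'.1.of_le (by simp)) (hφ.of_le (by simp)))

theorem add (hα : α ≤ 1) {g : E → F} (hf : ContDiffHolderNear k α f x)
    (hg : ContDiffHolderNear k α g x) : ContDiffHolderNear k α (fun y => f y + g y) x :=
  contDiffAt_comp hα (φ := fun p : F × F => p.1 + p.2) contDiff_add.contDiffAt (hf.prodMk hg)

theorem sum (hα : α ≤ 1) {ι : Type*} (s : Finset ι) {g : ι → E → F}
    (hg : ∀ i ∈ s, ContDiffHolderNear k α (g i) x) :
    ContDiffHolderNear k α (fun y => ∑ i ∈ s, g i y) x := by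
  classical
  induction s using Finset.induction_on with
  | empty => simpa using of_contDiffAt hα contDiffAt_const
  | insert i s hi ih =>
    simp only [Finset.sum_insert hi]
    exact (hg i (Finset.mem_insert_self i s)).add hα
      (ih fun j hj => hg j (Finset.mem_insert_of_mem hj))

theorem symm [CompleteSpace E] (hα : α ≤ 1) (e : OpenPartialHomeomorph E F) {x : E}
    (hx : x ∈ e.source) {f' : E ≃L[ℝ] F} (hf' : HasFDerivAt e (f' : E →L[ℝ] F) x)
    (he : ContDiffHolderNear (k + 1) α e x) : ContDiffHolderNear (k + 1) α e.symm (e x) := by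
  have hsx : e.symm (e x) = x := e.left_inv hx
  have hG : ContDiffAt ℝ (k + 1) e.symm (e x) :=
    e.contDiffAt_symm (e.map_source hx) (by rwa [hsx]) (by rw [hsx]; exact he.1)
  refine succ_iff.2 ⟨hG, ?_⟩
  have h1 : ContDiffHolderNear k α (fderiv ℝ e ∘ e.symm) (e x) :=
    comp_contDiffAt hα (by rw [hsx]; exact (succ_iff.1 he).2) hG
  have h2 : ContDiffHolderNear k α (ContinuousLinearMap.inverse ∘ (fderiv ℝ e ∘ e.symm)) (e x) := by
    refine contDiffAt_comp hα ?_ h1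
    rw [Function.comp_apply, hsx, hf'.fderiv]
    exact contDiffAt_map_inverse f'
  refine h2.congr ?_
  have hd : ∀ᶠ y in 𝓝 (e x), DifferentiableAt ℝ e (e.symm y) := by
    have h : ∀ᶠ z in 𝓝 (e.symm (e x)), DifferentiableAt ℝ e z := by
      rw [hsx]
      filter_upwards [he.1.eventually (by simp)] with z hz
      exact hz.differentiableAt (by simp)
    exact hG.continuousAt.eventually h
  filter_upwards [hd, hG.eventually (by simp), e.open_target.mem_nhds (e.map_source hx)]
    with y h3 h4 h5
  have h4 := h4.differentiableAt (by simp)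
  refine ContinuousLinearMap.inverse_eq ?_ ?_ <;> rw [Function.comp_apply]
  · rw [← fderiv_comp y h3 h4, ← fderiv_id (x := y)]
    exact Filter.EventuallyEq.fderiv_eq (e.eventually_right_inverse h5)
  · have h6 : DifferentiableAt ℝ e.symm (e (e.symm y)) := by rwa [e.right_inv h5]
    have h7 := fderiv_comp (e.symm y) h6 h3
    rw [e.right_inv h5] at h7
    rw [← h7, ← fderiv_id (x := e.symm y)]
    exact Filter.EventuallyEq.fderiv_eq (e.eventually_left_inverse (e.map_target h5))

theorem of_within_comp_clm {s : Set E} (hs : Convex ℝ s) (hs' : (interior s).Nonempty)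
    (hf : ContDiffOn ℝ k f s) {C : ℝ≥0} (hC : HolderOnWith C α (iteratedFDerivWithin ℝ k f s) s)
    (P : G →L[ℝ] E) {z : G} (hz : P ⁻¹' s ∈ 𝓝 z) : ContDiffHolderNear k α (f ∘ P) z := by
  refine ⟨(hf.comp_continuousLinearMap P).contDiffAt hz, ?_⟩
  have h1 := hC.comp ((holderWith_one.2 P.lipschitz).holderOnWith (P ⁻¹' s)) (fun y hy => hy)
  rw [mul_one] at h1
  have h2 : HolderNear α (iteratedFDerivWithin ℝ k f s ∘ P) z := ⟨_, _, hz, h1⟩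
  refine (h2.lipschitz_comp (ContinuousMultilinearMap.compContinuousLinearMapL
    (F := F) fun _ : Fin k => P).lipschitz).congr ?_
  have hu : UniqueDiffOn ℝ (P ⁻¹' s) :=
    uniqueDiffOn_convex (hs.linear_preimage P.toLinearMap) ⟨z, mem_interior_iff_mem_nhds.2 hz⟩
  filter_upwards [eventually_mem_nhds_iff.2 hz] with y hy
  have h3 := P.iteratedFDerivWithin_comp_right hf (uniqueDiffOn_convex hs hs') hu
    (show y ∈ P ⁻¹' s from mem_of_mem_nhds hy) le_rfl
  rw [iteratedFDerivWithin_eq_iteratedFDeriv hu ((hf.comp_continuousLinearMap P).contDiffAt hy)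
    (mem_of_mem_nhds hy)] at h3
  exact h3.symm

end ContDiffHolderNear

theorem proj0_apply {n : ℕ} (x : EuclideanSpace ℝ (Fin (n + 1))) (i : Fin (n + 1)) :
    proj0 x i = if i = Fin.last n then 0 else x i := by
  by_cases h : i = Fin.last n <;> simp [proj0, h]

theorem proj0_eq_self {n : ℕ} {x : EuclideanSpace ℝ (Fin (n + 1))} (hx : x (Fin.last n) = 0) :
    proj0 x = x := by
  simp [proj0, hx]

theorem norm_proj0_le {n : ℕ} (x : EuclideanSpace ℝ (Fin (n + 1))) : ‖proj0 x‖ ≤ ‖x‖ := by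
  rw [EuclideanSpace.norm_eq, EuclideanSpace.norm_eq]
  refine Real.sqrt_le_sqrt (Finset.sum_le_sum fun i _ => ?_)
  rw [proj0_apply]
  split_ifs
  · simpa using sq_nonneg _
  · rfl

/-- `proj0` as a continuous linear map. -/
def proj0CLM (n : ℕ) : EuclideanSpace ℝ (Fin (n + 1)) →L[ℝ] EuclideanSpace ℝ (Fin (n + 1)) :=
  ContinuousLinearMap.id ℝ _ -
    (EuclideanSpace.proj (Fin.last n)).smulRight (EuclideanSpace.single (Fin.last n) 1)

theorem coe_proj0CLM (n : ℕ) : ⇑(proj0CLM n) = proj0 := by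
  ext x i
  simp [proj0CLM, proj0]

/-- The vector `g(x)` with components `gcoef a i x`. -/
def gvec {n : ℕ} (a : Fin (n + 1) → Fin (n + 1) → EuclideanSpace ℝ (Fin (n + 1)) → ℝ)
    (x : EuclideanSpace ℝ (Fin (n + 1))) : EuclideanSpace ℝ (Fin (n + 1)) :=
  ∑ i, gcoef a i x • EuclideanSpace.single i 1

section FlatMap

variable {n : ℕ} {a : Fin (n + 1) → Fin (n + 1) → EuclideanSpace ℝ (Fin (n + 1)) → ℝ}

theorem gvec_apply (x : EuclideanSpace ℝ (Fin (n + 1))) (i : Fin (n + 1)) :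
    gvec a x i = gcoef a i x := by
  simp [gvec, Finset.sum_apply, Pi.single_apply]

theorem gvec_last (x : EuclideanSpace ℝ (Fin (n + 1))) : gvec a x (Fin.last n) = 0 := by
  simp [gvec_apply, gcoef]

theorem flatMap_last (x : EuclideanSpace ℝ (Fin (n + 1))) :
    flatMap a x (Fin.last n) = x (Fin.last n) := by
  change (x + x (Fin.last n) • gvec a x) (Fin.last n) = _
  simp [gvec_last]

theorem contDiffHolderNear_gvec {k : ℕ} {α : ℝ≥0} (hα : α ≤ 1)
    {x : EuclideanSpace ℝ (Fin (n + 1))}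
    (ha : ∀ i j, ContDiffHolderNear k α (fun y => a i j (proj0 y)) x)
    (hx : a (Fin.last n) (Fin.last n) (proj0 x) ≠ 0) :
    ContDiffHolderNear k α (gvec a) x := by
  refine ContDiffHolderNear.sum hα _ fun i _ => ?_
  by_cases hi : i = Fin.last n
  · simpa [gcoef, hi] using ContDiffHolderNear.of_contDiffAt hα contDiffAt_const
  · simp only [gcoef, hi, if_false]
    refine ContDiffHolderNear.contDiffAt_comp hα
      (φ := fun p : ℝ × ℝ => (-p.1 / p.2) • (EuclideanSpace.single i (1 : ℝ)))
      ?_ ((ha i (Fin.last n)).prodMk (ha (Fin.last n) (Fin.last n)))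
    have h : ContDiffAt ℝ (k + 1) (fun p : ℝ × ℝ => -p.1 / p.2)
        (a i (Fin.last n) (proj0 x), a (Fin.last n) (Fin.last n) (proj0 x)) :=
      contDiffAt_fst.neg.div contDiffAt_snd hx
    exact h.smul contDiffAt_const

theorem contDiffHolderNear_flatMap {k : ℕ} {α : ℝ≥0} (hα : α ≤ 1)
    {x : EuclideanSpace ℝ (Fin (n + 1))} (hg : ContDiffHolderNear k α (gvec a) x) :
    ContDiffHolderNear k α (flatMap a) x := by
  refine ContDiffHolderNear.contDiffAt_comp hα
    (φ := fun p : EuclideanSpace ℝ (Fin (n + 1)) × EuclideanSpace ℝ (Fin (n + 1)) =>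
      p.1 + p.1 (Fin.last n) • p.2) ?_
    ((ContDiffHolderNear.of_contDiffAt hα contDiffAt_id).prodMk hg)
  exact contDiffAt_fst.add (((EuclideanSpace.proj (𝕜 := ℝ) (Fin.last n)).contDiff.contDiffAt.comp _
    contDiffAt_fst).smul contDiffAt_snd)

/-- The linear shear `v ↦ v + v_n • w` along a vector `w` with `w_n = 0`. -/
def shearEquiv (w : EuclideanSpace ℝ (Fin (n + 1))) (hw : w (Fin.last n) = 0) :
    EuclideanSpace ℝ (Fin (n + 1)) ≃L[ℝ] EuclideanSpace ℝ (Fin (n + 1)) :=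
  ContinuousLinearEquiv.equivOfInverse
    (ContinuousLinearMap.id ℝ _ + (EuclideanSpace.proj (Fin.last n)).smulRight w)
    (ContinuousLinearMap.id ℝ _ - (EuclideanSpace.proj (Fin.last n)).smulRight w)
    (fun v => by ext i; simp [hw]) (fun v => by ext i; simp [hw])

theorem shearEquiv_apply (w : EuclideanSpace ℝ (Fin (n + 1))) (hw : w (Fin.last n) = 0)
    (v : EuclideanSpace ℝ (Fin (n + 1))) : shearEquiv w hw v = v + v (Fin.last n) • w :=
  rfl

theorem hasFDerivAt_flatMap {x : EuclideanSpace ℝ (Fin (n + 1))}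
    (hg : DifferentiableAt ℝ (gvec a) x) (hx : x (Fin.last n) = 0) :
    HasFDerivAt (flatMap a) (shearEquiv (gvec a x) (gvec_last x) :
      EuclideanSpace ℝ (Fin (n + 1)) →L[ℝ] EuclideanSpace ℝ (Fin (n + 1))) x := by
  have h := (hasFDerivAt_id (𝕜 := ℝ) x).add
    (((EuclideanSpace.proj (𝕜 := ℝ) (Fin.last n)).hasFDerivAt (x := x)).smul hg.hasFDerivAt)
  refine h.congr_fderiv ?_
  ext v i
  simp [hx, shearEquiv_apply]

end FlatMap

theorem convex_interior_halfBall {n : ℕ} {R : ℝ} (hR : 0 < R) :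
    Convex ℝ (closedBall (0 : EuclideanSpace ℝ (Fin (n + 1))) R ∩ {x | 0 ≤ x (Fin.last n)}) ∧
    (interior (closedBall (0 : EuclideanSpace ℝ (Fin (n + 1))) R ∩
      {x | 0 ≤ x (Fin.last n)})).Nonempty := by
  have hp : Continuous fun x : EuclideanSpace ℝ (Fin (n + 1)) => x (Fin.last n) :=
    (EuclideanSpace.proj (𝕜 := ℝ) (Fin.last n)).continuous
  constructor
  · exact (convex_closedBall _ _).inter
      (convex_halfSpace_ge (EuclideanSpace.proj (𝕜 := ℝ) (Fin.last n)).isLinear 0)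
  · refine ⟨EuclideanSpace.single (Fin.last n) (R / 2), mem_interior.2
      ⟨ball 0 R ∩ {x | 0 < x (Fin.last n)},
        inter_subset_inter ball_subset_closedBall fun x (hx : 0 < x (Fin.last n)) => hx.le,
        isOpen_ball.inter (isOpen_lt continuous_const hp), ?_, ?_⟩⟩
    · simp [abs_of_pos hR]; linarith
    · simpa using hR

/-- Lemma 3.4, transformation removing the mixed second-order terms.
For an elliptic operator `L₁` on `B_R(0)` with `a_{ij}, b_i ∈ C^{2,α}(B_R^{0,+}(0))`,
the map `F(x) = (x^{(n−1)} + g(x^{(n−1)})x_n, x_n)` with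
`g_i = −a_{in}(·,0)/a_{nn}(·,0)` (i) preserves `{x_n > 0}`, (ii) preserves `{x_n = 0}`,
(iii) restricts to a `C^{2,α}`-diffeomorphism on some smaller ball `B_{R'}(0)`, and
(iv) the transformed operator `L₂ = T_F⁻¹ ∘ L₁ ∘ T_F` has no mixed second-order terms
`∂_{y_i}∂_{y_n}` at points of the flat boundary, i.e. the transformed coefficients
`ã_{in}(F x) = Σ_{k,l} a_{kl}(x) ∂_k F_i ∂_l F_n` vanish for `x_n = 0`, `i < n`. -/
theorem flattening_transformation
    {n : ℕ} (R : ℝ) (hR : 0 < R)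
    (α : ℝ≥0) (hα0 : 0 < α) (hα1 : α ≤ 1)
    (a : Fin (n + 1) → Fin (n + 1) → EuclideanSpace ℝ (Fin (n + 1)) → ℝ)
    (b : Fin (n + 1) → EuclideanSpace ℝ (Fin (n + 1)) → ℝ)
    (c : EuclideanSpace ℝ (Fin (n + 1)) → ℝ)
    (S : Set (EuclideanSpace ℝ (Fin (n + 1))))
    (hS : S = closedBall (0 : EuclideanSpace ℝ (Fin (n + 1))) R ∩
      {x | 0 ≤ x (Fin.last n)})
    (ha : ∀ i j, MemC2α α (a i j) S)
    (hb : ∀ i, MemC2α α (b i) S)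
    (hc : MemC0α α c S)
    (hSymm : ∀ i j, ∀ x ∈ S, a i j x = a j i x)
    (lam Lam : ℝ) (hlam : 0 < lam)
    (hell : UnifElliptic a lam S)
    (hcoeff : CoeffBound a b c Lam S) :
    -- (i) points with `x_n > 0` are mapped to points with `y_n > 0`
    (∀ x ∈ ball (0 : EuclideanSpace ℝ (Fin (n + 1))) R,
      0 < x (Fin.last n) → 0 < flatMap a x (Fin.last n)) ∧
    -- (ii) points with `x_n = 0` are mapped to points with `y_n = 0`
    (∀ x ∈ ball (0 : EuclideanSpace ℝ (Fin (n + 1))) R,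
      x (Fin.last n) = 0 → flatMap a x (Fin.last n) = 0) ∧
    -- (iii) `F` restricts to a `C^{2,α}`-diffeomorphism on a smaller ball, and
    -- (iv) the transformed operator has no mixed terms on the flat boundary
    (∃ R' : ℝ, 0 < R' ∧ R' ≤ R ∧
      InjOn (flatMap a) (ball (0 : EuclideanSpace ℝ (Fin (n + 1))) R') ∧
      IsOpen (flatMap a '' ball (0 : EuclideanSpace ℝ (Fin (n + 1))) R') ∧
      ContDiffOn ℝ 2 (flatMap a) (ball (0 : EuclideanSpace ℝ (Fin (n + 1))) R') ∧
      (∃ C : ℝ≥0, HolderOnWith C α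
        (iteratedFDerivWithin ℝ 2 (flatMap a)
          (ball (0 : EuclideanSpace ℝ (Fin (n + 1))) R'))
        (ball (0 : EuclideanSpace ℝ (Fin (n + 1))) R')) ∧
      (∃ G : EuclideanSpace ℝ (Fin (n + 1)) → EuclideanSpace ℝ (Fin (n + 1)),
        (∀ x ∈ ball (0 : EuclideanSpace ℝ (Fin (n + 1))) R', G (flatMap a x) = x) ∧
        ContDiffOn ℝ 2 G (flatMap a '' ball (0 : EuclideanSpace ℝ (Fin (n + 1))) R') ∧
        (∃ C : ℝ≥0, HolderOnWith C α
          (iteratedFDerivWithin ℝ 2 G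
            (flatMap a '' ball (0 : EuclideanSpace ℝ (Fin (n + 1))) R'))
          (flatMap a '' ball (0 : EuclideanSpace ℝ (Fin (n + 1))) R'))) ∧
      (∀ x ∈ ball (0 : EuclideanSpace ℝ (Fin (n + 1))) R', x (Fin.last n) = 0 →
        ∀ i : Fin (n + 1), i ≠ Fin.last n →
          (∑ k, ∑ l, a k l x *
            fderiv ℝ (flatMap a) x (EuclideanSpace.single k 1) i *
            fderiv ℝ (flatMap a) x (EuclideanSpace.single l 1) (Fin.last n)) = 0)) := by
  have hmem : ∀ x ∈ ball (0 : EuclideanSpace ℝ (Fin (n + 1))) R, proj0 x ∈ S := by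
    intro x hx
    rw [hS]
    exact ⟨mem_closedBall_zero_iff.2 ((norm_proj0_le x).trans (mem_ball_zero_iff.1 hx).le),
      by simp [proj0_apply]⟩
  have hann : ∀ x ∈ S, a (Fin.last n) (Fin.last n) x ≠ 0 := by
    intro x hx
    have h := hell x hx (EuclideanSpace.single (Fin.last n) 1)
    simp only [PiLp.norm_single, norm_one, one_pow, mul_one, PiLp.single_apply, mul_ite,
      mul_zero, Finset.sum_ite_eq', Finset.mem_univ, if_true] at h
    exact (hlam.trans_le h).ne'
  have hg : ∀ x ∈ ball (0 : EuclideanSpace ℝ (Fin (n + 1))) R,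
      ContDiffHolderNear 2 α (gvec a) x := by
    intro x hx
    refine contDiffHolderNear_gvec hα1 (fun i j => ?_) (hann _ (hmem x hx))
    obtain ⟨hC2, C, hC⟩ := ha i j
    obtain ⟨hconv, hint⟩ := convex_interior_halfBall (n := n) hR
    have h := ContDiffHolderNear.of_within_comp_clm (hS ▸ hconv) (hS ▸ hint) hC2 hC
      (proj0CLM n) (z := x) (Filter.mem_of_superset (isOpen_ball.mem_nhds hx) fun y hy => by
        rw [mem_preimage, coe_proj0CLM]; exact hmem y hy)
    rwa [coe_proj0CLM] at h
  have hFderiv : ∀ x ∈ ball (0 : EuclideanSpace ℝ (Fin (n + 1))) R,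
      ∀ hx : x (Fin.last n) = 0, HasFDerivAt (flatMap a) _ x := fun x hx hx0 =>
    hasFDerivAt_flatMap ((hg x hx).contDiffAt.differentiableAt (by simp)) hx0
  refine ⟨fun x _ hx => by rwa [flatMap_last], fun x _ hx => by rwa [flatMap_last], ?_⟩
  have h0 := mem_ball_self (x := (0 : EuclideanSpace ℝ (Fin (n + 1)))) hR
  have hF := contDiffHolderNear_flatMap hα1 (hg 0 h0)
  have hF' := hFderiv 0 h0 rfl
  let e := hF.contDiffAt.toOpenPartialHomeomorph (flatMap a) hF' (by simp)
  have hes : (0 : EuclideanSpace ℝ (Fin (n + 1))) ∈ e.source :=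
    hF.contDiffAt.mem_toOpenPartialHomeomorph_source hF' (by simp)
  have hG : ContDiffHolderNear 2 α e.symm (flatMap a 0) :=
    ContDiffHolderNear.symm hα1 e hes hF' hF
  obtain ⟨C, U, hU, hC⟩ := hF.holderNear
  obtain ⟨D, V, hV, hD⟩ := hG.holderNear
  obtain ⟨r, hr, hrsub⟩ := Metric.mem_nhds_iff.1 (Filter.inter_mem
    (Filter.inter_mem (Filter.inter_mem hU (hF.contDiffAt.eventually (by simp)))
      (e.open_source.mem_nhds hes))
    (hF.contDiffAt.continuousAt (Filter.inter_mem hV (hG.contDiffAt.eventually (by simp)))))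
  have hsub := (ball_subset_ball (x := (0 : EuclideanSpace ℝ (Fin (n + 1))))
    (min_le_left r R)).trans hrsub
  have hsrc : ball 0 (min r R) ⊆ e.source := fun x hx => (hsub hx).1.2
  have hopen : IsOpen (flatMap a '' ball 0 (min r R)) :=
    e.isOpen_image_of_subset_source isOpen_ball hsrc
  refine ⟨min r R, lt_min hr hR, min_le_right _ _, e.injOn.mono hsrc, hopen,
    fun x hx => ContDiffAt.contDiffWithinAt (mem_ofPred.1 (hsub hx).1.1.2), ⟨C, ?_⟩,
    ⟨e.symm, fun x hx => e.left_inv (hsrc hx), ?_, D, ?_⟩, ?_⟩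
  · intro x hx y hy
    rw [iteratedFDerivWithin_of_isOpen 2 isOpen_ball hx,
      iteratedFDerivWithin_of_isOpen 2 isOpen_ball hy]
    exact hC x (hsub hx).1.1.1 y (hsub hy).1.1.1
  · rintro _ ⟨x, hx, rfl⟩
    exact ContDiffAt.contDiffWithinAt (mem_ofPred.1 (hsub hx).2.2)
  · rintro _ ⟨x, hx, rfl⟩ _ ⟨y, hy, rfl⟩
    rw [iteratedFDerivWithin_of_isOpen 2 hopen (mem_image_of_mem _ hx),
      iteratedFDerivWithin_of_isOpen 2 hopen (mem_image_of_mem _ hy)]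
    exact hD _ (hsub hx).2.1 _ (hsub hy).2.1
  · intro x hx hx0 i hi
    have hxR := ball_subset_ball (min_le_right r R) hx
    have hxS := hmem x hxR
    rw [proj0_eq_self hx0] at hxS
    rw [(hFderiv x hxR hx0).fderiv]
    have hne := hann x hxS
    simp only [ContinuousLinearEquiv.coe_coe, shearEquiv_apply, PiLp.add_apply, PiLp.smul_apply,
      gvec_apply, gcoef, hi, if_false, proj0_eq_self hx0, smul_eq_mul, mul_zero,
      add_zero, PiLp.single_apply, mul_ite, mul_one, Finset.sum_ite_eq, Finset.mem_univ, if_true,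
      ite_mul, one_mul, zero_mul, mul_add, Finset.sum_add_distrib]
    field_simp
    simp
end
end
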